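/- For every r > 0, the kinematic measure of the set of rigid motions bringing a moving oloid into a hitting position with a fixed congruent oloid satisfies ∫_{SO(3)} λ{ x ∈ ℝ³ : Ω_r ∩ (θ·Ω_r + x) ≠ ∅ } dν(θ) = (r³/3)·[ 9π² + 8E(√3/2) + 22K(√3/2) − 24I ]. -/

import Mathlib

open MeasureTheory Real Pointwise

noncomputable section

/-- The circle `k_A = {(x,y,z) : x² + (y+1/2)² = 1 ∧ z = 0}`. -/
def kA : Set (EuclideanSpace ℝ (Fin 3)) :=
  {p | p 0 ^ 2 + (p 1 + 1/2) ^ 2 = 1 ∧ p 2 = 0}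

/-- The circle `k_B = {(x,y,z) : (y−1/2)² + z² = 1 ∧ x = 0}`. -/
def kB : Set (EuclideanSpace ℝ (Fin 3)) :=
  {p | (p 1 - 1/2) ^ 2 + p 2 ^ 2 = 1 ∧ p 0 = 0}

/-- The oloid `Ω₁`: the convex hull of `k_A ∪ k_B`. -/
def oloid : Set (EuclideanSpace ℝ (Fin 3)) := convexHull ℝ (kA ∪ kB)

/-- The scaled oloid `Ω_r = r • Ω₁`. -/
def oloidR (r : ℝ) : Set (EuclideanSpace ℝ (Fin 3)) := r • oloid

/-- Complete elliptic integral of the first kind `K(k)`. -/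
def ellipticK (k : ℝ) : ℝ := ∫ x in (0:ℝ)..(π/2), 1 / Real.sqrt (1 - k^2 * Real.sin x ^ 2)

/-- Complete elliptic integral of the second kind `E(k)`. -/
def ellipticE (k : ℝ) : ℝ := ∫ x in (0:ℝ)..(π/2), Real.sqrt (1 - k^2 * Real.sin x ^ 2)

/-- The constant `I = ∫₀^{π/2} arccos(cos x/(1+cos x)) dx`. -/
def constI : ℝ := ∫ x in (0:ℝ)..(π/2), Real.arccos (Real.cos x / (1 + Real.cos x))

/-- Support function `h_C(u) = sup {⟨x,u⟩ : x ∈ C}` of a set `C ⊆ ℝ³`. -/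
def suppFn (C : Set (EuclideanSpace ℝ (Fin 3))) (u : EuclideanSpace ℝ (Fin 3)) : ℝ :=
  sSup ((fun x => (inner ℝ x u : ℝ)) '' C)

/-- Mean width of `C`: `(1/(4π)) ∫_{S²} (h_C(u) + h_C(−u)) dσ(u)`, where `σ` is the
2-dimensional Hausdorff measure on the unit sphere. (For `C = ∅` this gives `0`.) -/
def meanWidth (C : Set (EuclideanSpace ℝ (Fin 3))) : ℝ :=
  (1 / (4 * π)) *
    ∫ u in Metric.sphere (0 : EuclideanSpace ℝ (Fin 3)) 1, (suppFn C u + suppFn C (-u)) ∂μH[2]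

/-- The rotation group `SO(3)` as 3×3 real orthogonal matrices of determinant 1. -/
abbrev SO3 := Matrix.specialOrthogonalGroup (Fin 3) ℝ

instance : MeasurableSpace SO3 := borel SO3

instance : BorelSpace SO3 := ⟨rfl⟩

/-- The action of a rotation `θ ∈ SO(3)` on a point of `ℝ³`. -/
def rotate (θ : SO3) (p : EuclideanSpace ℝ (Fin 3)) : EuclideanSpace ℝ (Fin 3) :=
  (EuclideanSpace.equiv (Fin 3) ℝ).symm (Matrix.mulVec θ.1 (EuclideanSpace.equiv (Fin 3) ℝ p))

/-- `θ·S + x`: the image of `S` under the rotation `θ` followed by translation by `x`. -/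
def moveSet (θ : SO3) (x : EuclideanSpace ℝ (Fin 3)) (S : Set (EuclideanSpace ℝ (Fin 3))) :
    Set (EuclideanSpace ℝ (Fin 3)) :=
  (fun p => rotate θ p + x) '' S

/-- `H` is the support function of `C`, and it is attained. -/
structure IsSupport (C : Set (EuclideanSpace ℝ (Fin 3))) (H : EuclideanSpace ℝ (Fin 3) → ℝ) :
    Prop where
  le : ∀ y ∈ C, ∀ u, inner ℝ y u ≤ H u
  attained : ∀ u, ∃ y ∈ C, inner ℝ y u = H u

theorem IsSupport.mem {C : Set (EuclideanSpace ℝ (Fin 3))} {H : EuclideanSpace ℝ (Fin 3) → ℝ}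
    (h : IsSupport C H) (hconv : Convex ℝ C) (hclosed : IsClosed C)
    {y : EuclideanSpace ℝ (Fin 3)} (hy : ∀ u, inner ℝ y u ≤ H u) : y ∈ C := by
  by_contra hyC
  obtain ⟨f, c, hf, hfy⟩ := geometric_hahn_banach_closed_point hconv hclosed hyC
  set u := (InnerProductSpace.toDual ℝ (EuclideanSpace ℝ (Fin 3))).symm f with hu
  have key : ∀ z, f z = inner ℝ z u := fun z => by
    rw [real_inner_comm, hu, InnerProductSpace.toDual_symm_apply]
  obtain ⟨z, hz, hzu⟩ := h.attained u
  have := hf z hz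
  have h2 := hy u
  rw [key] at this hfy
  linarith

theorem ConvexOn.add_inner_le {F : EuclideanSpace ℝ (Fin 3) → ℝ} (hF : ConvexOn ℝ Set.univ F)
    {g u : EuclideanSpace ℝ (Fin 3)} (hg : HasFDerivAt F (innerSL ℝ g) u)
    (v : EuclideanSpace ℝ (Fin 3)) : F u + inner ℝ g (v - u) ≤ F v := by
  have hl : HasDerivAt (fun τ : ℝ => F (AffineMap.lineMap u v τ)) (inner ℝ g (v - u)) 0 := by
    have h1 : HasDerivAt (fun τ : ℝ => AffineMap.lineMap u v τ) (v - u) (0 : ℝ) :=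
      AffineMap.hasDerivAt_lineMap
    have h2 : HasFDerivAt F (innerSL ℝ g) (AffineMap.lineMap u v (0 : ℝ)) := by simpa using hg
    exact h2.comp_hasDerivAt (0 : ℝ) h1
  have hc : ConvexOn ℝ Set.univ (fun τ : ℝ => F (AffineMap.lineMap u v τ)) :=
    hF.comp_affineMap (AffineMap.lineMap u v)
  have := hc.le_slope_of_hasDerivAt (Set.mem_univ 0) (Set.mem_univ 1) one_pos hl
  simp [slope_def_field] at this
  linarith

theorem Convex.isCompact_volume_interior {C : Set (EuclideanSpace ℝ (Fin 3))}
    (hC : Convex ℝ C) : volume C = volume (interior C) := by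
  refine le_antisymm ?_ (measure_mono interior_subset)
  calc volume C ≤ volume (interior C ∪ frontier C) := measure_mono (by
        intro x hx
        by_cases h : x ∈ interior C
        · exact Or.inl h
        · exact Or.inr ⟨subset_closure hx, h⟩)
    _ ≤ volume (interior C) + volume (frontier C) := measure_union_le _ _
    _ = volume (interior C) := by rw [hC.addHaar_frontier volume, add_zero]

theorem exists_gradient_eq {C : Set (EuclideanSpace ℝ (Fin 3))}
    {H F : EuclideanSpace ℝ (Fin 3) → ℝ}
    {G : EuclideanSpace ℝ (Fin 3) → EuclideanSpace ℝ (Fin 3)} (h : IsSupport C H)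
    (hG : ∀ u, HasFDerivAt F (innerSL ℝ (G u)) u) {c : ℝ} (hlow : ∀ u, H u - c ≤ F u)
    {y : EuclideanSpace ℝ (Fin 3)} (hy : y ∈ interior C) : ∃ u, G u = y := by
  obtain ⟨δ, hδ, hball⟩ := Metric.mem_nhds_iff.1 (mem_interior_iff_mem_nhds.1 hy)
  have hH : ∀ u, inner ℝ y u + δ / 2 * ‖u‖ ≤ H u := by
    intro u
    by_cases hu : u = 0
    · have := h.le y (interior_subset hy) u
      simpa [hu] using this
    · have hu' : ‖u‖ ≠ 0 := norm_ne_zero_iff.2 hu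
      have hm : y + (δ / 2 / ‖u‖) • u ∈ C := by
        apply hball
        rw [Metric.mem_ball, dist_eq_norm, add_sub_cancel_left, norm_smul, Real.norm_eq_abs,
          abs_of_pos (by positivity)]
        field_simp
        linarith
      have := h.le _ hm u
      rw [inner_add_left, inner_smul_left, real_inner_self_eq_norm_sq] at this
      simp only [conj_trivial] at this
      convert this using 2
      field_simp
  have hcont : Continuous (fun u => F u - inner ℝ y u) := by
    have : Continuous F := continuous_iff_continuousAt.2 fun u => (hG u).continuousAt
    fun_prop
  have hlim : Filter.Tendsto (fun u => F u - inner ℝ y u)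
      (Filter.cocompact (EuclideanSpace ℝ (Fin 3))) Filter.atTop := by
    refine Filter.tendsto_atTop_mono (f := fun u => δ / 2 * ‖u‖ + (-c)) ?_ ?_
    · intro u
      have := hH u
      have := hlow u
      linarith
    · exact Filter.tendsto_atTop_add_const_right _ _
        ((tendsto_norm_cocompact_atTop).const_mul_atTop (by positivity))
  obtain ⟨u, hu⟩ := hcont.exists_forall_le hlim
  refine ⟨u, ?_⟩
  have hd : HasFDerivAt (fun u => F u - inner ℝ y u) (innerSL ℝ (G u) - innerSL ℝ y) u :=
    (hG u).sub (innerSL ℝ y).hasFDerivAt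
  have hmin : IsLocalMin (fun u => F u - inner ℝ y u) u := Filter.Eventually.of_forall hu
  have h0 := hmin.hasFDerivAt_eq_zero hd
  rw [← map_sub] at h0
  have := congrArg (fun T => T (G u - y)) h0
  rw [innerSL_apply_apply, zero_apply, inner_self_eq_zero] at this
  exact sub_eq_zero.1 this

theorem injective_of_strictConvexOn {F : EuclideanSpace ℝ (Fin 3) → ℝ}
    {G : EuclideanSpace ℝ (Fin 3) → EuclideanSpace ℝ (Fin 3)}
    (hF : StrictConvexOn ℝ Set.univ F) (hG : ∀ u, HasFDerivAt F (innerSL ℝ (G u)) u) :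
    Function.Injective G := by
  intro u v huv
  by_contra hne
  have h1 := hF.convexOn.add_inner_le (hG u) ((1 / 2 : ℝ) • u + (1 / 2 : ℝ) • v)
  have h2 := hF.convexOn.add_inner_le (hG v) ((1 / 2 : ℝ) • u + (1 / 2 : ℝ) • v)
  have h3 := hF.2 (Set.mem_univ u) (Set.mem_univ v) hne (show (0 : ℝ) < 1 / 2 by norm_num)
    (show (0 : ℝ) < 1 / 2 by norm_num) (by norm_num)
  rw [← huv] at h2
  have h4 : inner ℝ (G u) ((1 / 2 : ℝ) • u + (1 / 2 : ℝ) • v - u)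
      + inner ℝ (G u) ((1 / 2 : ℝ) • u + (1 / 2 : ℝ) • v - v) = 0 := by
    rw [← inner_add_right]
    convert inner_zero_right (𝕜 := ℝ) (G u) using 2
    module
  simp only [smul_eq_mul] at h3
  linarith

theorem inner_hessian_nonneg {F : EuclideanSpace ℝ (Fin 3) → ℝ}
    {G : EuclideanSpace ℝ (Fin 3) → EuclideanSpace ℝ (Fin 3)}
    (hF : ConvexOn ℝ Set.univ F) (hG : ∀ u, HasFDerivAt F (innerSL ℝ (G u)) u)
    {A : EuclideanSpace ℝ (Fin 3) →L[ℝ] EuclideanSpace ℝ (Fin 3)} {u : EuclideanSpace ℝ (Fin 3)}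
    (hA : HasFDerivAt G A u) (d : EuclideanSpace ℝ (Fin 3)) : 0 ≤ inner ℝ (A d) d := by
  have hmono : ∀ v w, 0 ≤ inner ℝ (G v - G w) (v - w) := by
    intro v w
    have h1 := hF.add_inner_le (hG v) w
    have h2 := hF.add_inner_le (hG w) v
    rw [inner_sub_left]
    have : inner ℝ (G v) (w - v) = - inner ℝ (G v) (v - w) := by
      rw [← inner_neg_right, neg_sub]
    linarith
  have hl : HasDerivAt (fun τ : ℝ => inner ℝ (G (u + τ • d)) d) (inner ℝ (A d) d) 0 := by
    have h1 : HasDerivAt (fun τ : ℝ => u + τ • d) d (0 : ℝ) := by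
      simpa using ((hasDerivAt_id (0 : ℝ)).smul_const d).const_add u
    have h2 : HasFDerivAt G A (u + (0 : ℝ) • d) := by simpa using hA
    have h3 := h2.comp_hasDerivAt (0 : ℝ) h1
    simpa using h3.inner ℝ (hasDerivAt_const (0 : ℝ) d)
  have hm : Monotone (fun τ : ℝ => inner ℝ (G (u + τ • d)) d) := by
    intro s t hst
    rcases hst.eq_or_lt with rfl | hlt
    · exact le_rfl
    have := hmono (u + t • d) (u + s • d)
    rw [show u + t • d - (u + s • d) = (t - s) • d by module, inner_smul_right,
      inner_sub_left] at this
    have h5 := nonneg_of_mul_nonneg_right this (sub_pos.2 hlt)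
    simp only
    linarith
  rw [← hl.deriv]
  exact hm.deriv_nonneg

theorem ContinuousLinearMap.det_nonneg_of_inner_nonneg
    {A : EuclideanSpace ℝ (Fin 3) →L[ℝ] EuclideanSpace ℝ (Fin 3)}
    (hA : ∀ d, 0 ≤ inner ℝ (A d) d) : 0 ≤ A.det := by
  by_contra! hneg
  let φ : ℝ → ℝ := fun τ => ((1 - τ) • A + τ • ContinuousLinearMap.id ℝ _).det
  have hφ : ContinuousOn φ (Set.Icc 0 1) := by
    have : Continuous φ := ContinuousLinearMap.continuous_det.comp (by fun_prop)
    exact this.continuousOn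
  have h0 : φ 0 < 0 := by
    have : (1 - (0 : ℝ)) • A + (0 : ℝ) • ContinuousLinearMap.id ℝ _ = A := by module
    simp only [φ, this]
    exact hneg
  have h1 : φ 1 = 1 := by simp [φ, ContinuousLinearMap.det]
  obtain ⟨τ, hτ, hτ0⟩ := intermediate_value_Icc zero_le_one hφ
    (show (0 : ℝ) ∈ Set.Icc (φ 0) (φ 1) by rw [h1]; exact ⟨h0.le, zero_le_one⟩)
  have hτpos : 0 < τ := by
    rcases hτ.1.eq_or_lt with h | h
    · rw [← h] at hτ0; linarith
    · exact h
  have hker := LinearMap.bot_lt_ker_of_det_eq_zero (f :=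
    (((1 - τ) • A + τ • ContinuousLinearMap.id ℝ (EuclideanSpace ℝ (Fin 3)) :
      EuclideanSpace ℝ (Fin 3) →L[ℝ] EuclideanSpace ℝ (Fin 3)) :
        EuclideanSpace ℝ (Fin 3) →ₗ[ℝ] EuclideanSpace ℝ (Fin 3))) hτ0
  obtain ⟨d, hd, hd0⟩ := (Submodule.ne_bot_iff _).1 hker.ne'
  rw [LinearMap.mem_ker] at hd
  have h2 : (1 - τ) • A d + τ • d = 0 := by simpa using hd
  have h3 : inner ℝ ((1 - τ) • A d + τ • d) d = 0 := by rw [h2, inner_zero_left]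
  rw [inner_add_left, inner_smul_left, inner_smul_left, real_inner_self_eq_norm_sq] at h3
  simp only [conj_trivial] at h3
  have h4 : 0 < τ * ‖d‖ ^ 2 := by have := norm_pos_iff.2 hd0; positivity
  have h5 := mul_nonneg (sub_nonneg.2 hτ.2) (hA d)
  linarith

/-- The volume of a convex body is the integral of the Hessian determinant of any smooth strictly
convex function asymptotic to its support function. -/
theorem volume_eq_lintegral_det {C : Set (EuclideanSpace ℝ (Fin 3))}
    {H F : EuclideanSpace ℝ (Fin 3) → ℝ}
    {G : EuclideanSpace ℝ (Fin 3) → EuclideanSpace ℝ (Fin 3)}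
    {A : EuclideanSpace ℝ (Fin 3) → EuclideanSpace ℝ (Fin 3) →L[ℝ] EuclideanSpace ℝ (Fin 3)}
    (hconv : Convex ℝ C) (hclosed : IsClosed C) (h : IsSupport C H)
    (hF : StrictConvexOn ℝ Set.univ F) (hG : ∀ u, HasFDerivAt F (innerSL ℝ (G u)) u)
    (hA : ∀ u, HasFDerivAt G (A u) u) {c : ℝ} (hlow : ∀ u, H u - c ≤ F u)
    (hup : ∀ u d, F (u + d) ≤ F u + H d) :
    volume C = ∫⁻ u, ENNReal.ofReal (A u).det := by
  have hGC : ∀ u, G u ∈ C := by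
    intro u
    refine h.mem hconv hclosed fun d => ?_
    have h1 := hF.convexOn.add_inner_le (hG u) (u + d)
    have h2 := hup u d
    rw [add_sub_cancel_left] at h1
    linarith
  have himg : volume C = volume (G '' Set.univ) := by
    apply le_antisymm
    · rw [hconv.isCompact_volume_interior]
      refine measure_mono fun y hy => ?_
      obtain ⟨u, hu⟩ := exists_gradient_eq h hG hlow hy
      exact ⟨u, trivial, hu⟩
    · refine measure_mono ?_
      rintro _ ⟨u, -, rfl⟩
      exact hGC u
  rw [himg, ← lintegral_abs_det_fderiv_eq_addHaar_image volume MeasurableSet.univ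
    (fun u _ => (hA u).hasFDerivWithinAt) (injective_of_strictConvexOn hF hG).injOn,
    setLIntegral_univ]
  refine lintegral_congr fun u => ?_
  rw [abs_of_nonneg (ContinuousLinearMap.det_nonneg_of_inner_nonneg
    (inner_hessian_nonneg hF.convexOn hG (hA u)))]

theorem IsSupport.add_smul {K L : Set (EuclideanSpace ℝ (Fin 3))}
    {HK HL : EuclideanSpace ℝ (Fin 3) → ℝ} (hK : IsSupport K HK) (hL : IsSupport L HL)
    {t : ℝ} (ht : 0 ≤ t) : IsSupport (K + t • L) (fun u => HK u + t * HL u) where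
  le := by
    rintro _ ⟨x, hx, _, ⟨y, hy, rfl⟩, rfl⟩ u
    simp only [inner_add_left, inner_smul_left, conj_trivial]
    exact add_le_add (hK.le x hx u) (mul_le_mul_of_nonneg_left (hL.le y hy u) ht)
  attained := by
    intro u
    obtain ⟨x, hx, hxu⟩ := hK.attained u
    obtain ⟨y, hy, hyu⟩ := hL.attained u
    refine ⟨x + t • y, Set.add_mem_add hx (Set.smul_mem_smul_set hy), ?_⟩
    simp only [inner_add_left, inner_smul_left, conj_trivial, hxu, hyu]

theorem ContinuousLinearMap.det_add_smul_interpolation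
    (A B : EuclideanSpace ℝ (Fin 3) →L[ℝ] EuclideanSpace ℝ (Fin 3)) (t : ℝ) :
    (A + t • B).det = (t - 1) * (t - 2) * (t - 3) / (-6) * (A + (0 : ℝ) • B).det
      + t * (t - 2) * (t - 3) / 2 * (A + (1 : ℝ) • B).det
      + t * (t - 1) * (t - 3) / (-2) * (A + (2 : ℝ) • B).det
      + t * (t - 1) * (t - 2) / 6 * (A + (3 : ℝ) • B).det := by
  set b := (EuclideanSpace.basisFun (Fin 3) ℝ).toBasis
  have key : ∀ s : ℝ, (A + s • B).det
      = (LinearMap.toMatrix b b (A : EuclideanSpace ℝ (Fin 3) →ₗ[ℝ] EuclideanSpace ℝ (Fin 3))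
        + s • LinearMap.toMatrix b b
          (B : EuclideanSpace ℝ (Fin 3) →ₗ[ℝ] EuclideanSpace ℝ (Fin 3))).det := by
    intro s
    rw [ContinuousLinearMap.det, ← LinearMap.det_toMatrix b]
    simp
  simp only [key, Matrix.det_fin_three, Matrix.add_apply, Matrix.smul_apply, smul_eq_mul]
  ring

/-- `F` is a smooth convex function, with gradient `G` and continuous Hessian `A`, at bounded
distance from the support function `H`. -/
structure IsSmoothing (H F : EuclideanSpace ℝ (Fin 3) → ℝ)
    (G : EuclideanSpace ℝ (Fin 3) → EuclideanSpace ℝ (Fin 3))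
    (A : EuclideanSpace ℝ (Fin 3) → EuclideanSpace ℝ (Fin 3) →L[ℝ] EuclideanSpace ℝ (Fin 3)) :
    Prop where
  strictConvexOn : StrictConvexOn ℝ Set.univ F
  hasFDerivAt : ∀ u, HasFDerivAt F (innerSL ℝ (G u)) u
  hasFDerivAt_gradient : ∀ u, HasFDerivAt G (A u) u
  continuous_hessian : Continuous A
  le : ∀ u, H u ≤ F u
  add_le : ∀ u d, F (u + d) ≤ F u + H d

theorem IsSmoothing.add_smul {H₁ F₁ H₂ F₂ : EuclideanSpace ℝ (Fin 3) → ℝ}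
    {G₁ G₂ : EuclideanSpace ℝ (Fin 3) → EuclideanSpace ℝ (Fin 3)}
    {A₁ A₂ : EuclideanSpace ℝ (Fin 3) → EuclideanSpace ℝ (Fin 3) →L[ℝ] EuclideanSpace ℝ (Fin 3)}
    (h₁ : IsSmoothing H₁ F₁ G₁ A₁) (h₂ : IsSmoothing H₂ F₂ G₂ A₂) {t : ℝ} (ht : 0 ≤ t) :
    IsSmoothing (fun u => H₁ u + t * H₂ u) (fun u => F₁ u + t * F₂ u) (fun u => G₁ u + t • G₂ u)
      (fun u => A₁ u + t • A₂ u) where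
  strictConvexOn := h₁.strictConvexOn.add_convexOn (h₂.strictConvexOn.convexOn.smul ht)
  hasFDerivAt u := by
    rw [map_add, map_smul]
    exact (h₁.hasFDerivAt u).add ((h₂.hasFDerivAt u).const_mul t)
  hasFDerivAt_gradient u :=
    (h₁.hasFDerivAt_gradient u).add ((h₂.hasFDerivAt_gradient u).const_smul t)
  continuous_hessian := h₁.continuous_hessian.add (h₂.continuous_hessian.const_smul t)
  le u := add_le_add (h₁.le u) (mul_le_mul_of_nonneg_left (h₂.le u) ht)
  add_le u d := by
    have := h₁.add_le u d
    have := mul_le_mul_of_nonneg_left (h₂.add_le u d) ht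
    linarith

theorem IsSmoothing.integrable_det {C : Set (EuclideanSpace ℝ (Fin 3))}
    {H F : EuclideanSpace ℝ (Fin 3) → ℝ}
    {G : EuclideanSpace ℝ (Fin 3) → EuclideanSpace ℝ (Fin 3)}
    {A : EuclideanSpace ℝ (Fin 3) → EuclideanSpace ℝ (Fin 3) →L[ℝ] EuclideanSpace ℝ (Fin 3)}
    (hF : IsSmoothing H F G A) (h : IsSupport C H) (hconv : Convex ℝ C) (hcomp : IsCompact C) :
    Integrable (fun u => (A u).det) ∧ volume.real C = ∫ u, (A u).det := by
  have hvol := volume_eq_lintegral_det hconv hcomp.isClosed h hF.strictConvexOn hF.hasFDerivAt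
    hF.hasFDerivAt_gradient (c := 0) (fun u => by simpa using hF.le u) hF.add_le
  have hnn : 0 ≤ᵐ[volume] fun u => (A u).det := Filter.Eventually.of_forall fun u =>
    ContinuousLinearMap.det_nonneg_of_inner_nonneg (inner_hessian_nonneg
      hF.strictConvexOn.convexOn hF.hasFDerivAt (hF.hasFDerivAt_gradient u))
  have hmeas : AEStronglyMeasurable (fun u => (A u).det) (volume : Measure (EuclideanSpace ℝ (Fin 3))) :=
    (ContinuousLinearMap.continuous_det.comp hF.continuous_hessian).aestronglyMeasurable
  refine ⟨(lintegral_ofReal_ne_top_iff_integrable hmeas hnn).1 ?_, ?_⟩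
  · rw [← hvol]
    exact hcomp.measure_lt_top.ne
  · rw [integral_eq_lintegral_of_nonneg_ae hnn hmeas, ← hvol, Measure.real]

theorem exists_volume_add_smul_eq_cubic {K L : Set (EuclideanSpace ℝ (Fin 3))}
    {HK HL f g : EuclideanSpace ℝ (Fin 3) → ℝ}
    {Gf Gg : EuclideanSpace ℝ (Fin 3) → EuclideanSpace ℝ (Fin 3)}
    {Af Ag : EuclideanSpace ℝ (Fin 3) → EuclideanSpace ℝ (Fin 3) →L[ℝ] EuclideanSpace ℝ (Fin 3)}
    (hK : IsSupport K HK) (hL : IsSupport L HL) (hKconv : Convex ℝ K) (hLconv : Convex ℝ L)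
    (hKc : IsCompact K) (hLc : IsCompact L)
    (hf : IsSmoothing HK f Gf Af) (hg : IsSmoothing HL g Gg Ag) :
    ∃ c₀ c₁ c₂ c₃ : ℝ, ∀ t : ℝ, 0 ≤ t →
      volume.real (K + t • L) = c₀ + c₁ * t + c₂ * t ^ 2 + c₃ * t ^ 3 := by
  have key : ∀ t : ℝ, 0 ≤ t → Integrable (fun u => (Af u + t • Ag u).det) ∧
      volume.real (K + t • L) = ∫ u, (Af u + t • Ag u).det := fun t ht =>
    (hf.add_smul hg ht).integrable_det (hK.add_smul hL ht) (hKconv.add (hLconv.smul t))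
      (hKc.add (hLc.smul t))
  set v : ℝ → ℝ := fun t => ∫ u, (Af u + t • Ag u).det with hv
  have hpoly : ∀ t : ℝ, 0 ≤ t → v t = (t - 1) * (t - 2) * (t - 3) / (-6) * v 0
      + t * (t - 2) * (t - 3) / 2 * v 1 + t * (t - 1) * (t - 3) / (-2) * v 2
      + t * (t - 1) * (t - 2) / 6 * v 3 := by
    intro t ht
    have i0 := (key 0 le_rfl).1
    have i1 := (key 1 zero_le_one).1
    have i2 := (key 2 zero_le_two).1
    have i3 := (key 3 zero_le_three).1
    simp only [hv]
    rw [integral_congr_ae (Filter.Eventually.of_forall fun u =>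
      ContinuousLinearMap.det_add_smul_interpolation (Af u) (Ag u) t)]
    rw [integral_add (((i0.const_mul _).fun_add (i1.const_mul _)).fun_add (i2.const_mul _))
      (i3.const_mul _), integral_add ((i0.const_mul _).fun_add (i1.const_mul _)) (i2.const_mul _),
      integral_add (i0.const_mul _) (i1.const_mul _)]
    simp only [integral_const_mul]
  refine ⟨v 0, -(11 / 6) * v 0 + 3 * v 1 - 3 / 2 * v 2 + 1 / 3 * v 3,
    v 0 - 5 / 2 * v 1 + 2 * v 2 - 1 / 2 * v 3,
    -(1 / 6) * v 0 + 1 / 2 * v 1 - 1 / 2 * v 2 + 1 / 6 * v 3, fun t ht => ?_⟩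
  rw [(key t ht).2]
  linear_combination hpoly t ht

/-- The support function of the disc bounded by `kA`. -/
def suppA (u : EuclideanSpace ℝ (Fin 3)) : ℝ := √(u 0 ^ 2 + u 1 ^ 2) - u 1 / 2

/-- The support function of the disc bounded by `kB`. -/
def suppB (u : EuclideanSpace ℝ (Fin 3)) : ℝ := √(u 1 ^ 2 + u 2 ^ 2) + u 1 / 2

/-- The support function of the oloid. -/
def suppO (u : EuclideanSpace ℝ (Fin 3)) : ℝ := max (suppA u) (suppB u)

theorem inner_eq_sum (x y : EuclideanSpace ℝ (Fin 3)) :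
    inner ℝ x y = x 0 * y 0 + x 1 * y 1 + x 2 * y 2 := by
  simp [PiLp.inner_apply, Fin.sum_univ_three, mul_comm]

theorem exists_unit_mul_add_eq_sqrt (a b : ℝ) :
    ∃ x y : ℝ, x ^ 2 + y ^ 2 = 1 ∧ x * a + y * b = √(a ^ 2 + b ^ 2) := by
  rcases eq_or_ne (a ^ 2 + b ^ 2) 0 with h | h
  · have ha : a = 0 := by nlinarith [sq_nonneg a, sq_nonneg b]
    have hb : b = 0 := by nlinarith [sq_nonneg a, sq_nonneg b]
    exact ⟨1, 0, by norm_num, by simp [ha, hb]⟩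
  · have hp : 0 < a ^ 2 + b ^ 2 := lt_of_le_of_ne (by positivity) h.symm
    have hs := Real.sqrt_pos.2 hp
    have hsq := Real.sq_sqrt hp.le
    refine ⟨a / √(a ^ 2 + b ^ 2), b / √(a ^ 2 + b ^ 2), ?_, ?_⟩
    · rw [div_pow, div_pow, ← add_div, hsq, div_self h]
    · rw [div_mul_eq_mul_div, div_mul_eq_mul_div, ← add_div, div_eq_iff hs.ne']
      nlinarith

theorem mul_add_mul_le_sqrt {x y : ℝ} (h : x ^ 2 + y ^ 2 = 1) (a b : ℝ) :
    x * a + y * b ≤ √(a ^ 2 + b ^ 2) := by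
  apply Real.le_sqrt_of_sq_le
  nlinarith [sq_nonneg (x * b - y * a), sq_nonneg (x * a + y * b)]

theorem isSupport_oloid : IsSupport oloid suppO where
  le := by
    intro y hy u
    have hsub : kA ∪ kB ⊆ {y | inner ℝ y u ≤ suppO u} := by
      rintro p (⟨h1, h2⟩ | ⟨h1, h2⟩)
      · have := mul_add_mul_le_sqrt h1 (u 0) (u 1)
        show inner ℝ p u ≤ suppO u
        refine le_trans ?_ (le_max_left _ _)
        rw [inner_eq_sum, suppA, h2]
        linarith
      · have := mul_add_mul_le_sqrt h1 (u 1) (u 2)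
        show inner ℝ p u ≤ suppO u
        refine le_trans ?_ (le_max_right _ _)
        rw [inner_eq_sum, suppB, h2]
        linarith
    have hconv : Convex ℝ {y : EuclideanSpace ℝ (Fin 3) | inner ℝ y u ≤ suppO u} :=
      convex_halfSpace_le ⟨fun x y => inner_add_left _ _ _,
        fun c x => by simp [inner_smul_left]⟩ _
    exact convexHull_min hsub hconv hy
  attained := by
    intro u
    rcases le_total (suppB u) (suppA u) with h | h
    · obtain ⟨x, y, hxy, he⟩ := exists_unit_mul_add_eq_sqrt (u 0) (u 1)
      refine ⟨!₂[x, y - 1 / 2, 0], subset_convexHull _ _ (Or.inl ⟨?_, ?_⟩), ?_⟩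
      · simpa using hxy
      · simp
      · rw [suppO, max_eq_left h, suppA, ← he, inner_eq_sum]
        simp
        ring
    · obtain ⟨x, y, hxy, he⟩ := exists_unit_mul_add_eq_sqrt (u 1) (u 2)
      refine ⟨!₂[0, x + 1 / 2, y], subset_convexHull _ _ (Or.inr ⟨?_, ?_⟩), ?_⟩
      · simpa using hxy
      · simp
      · rw [suppO, max_eq_right h, suppB, ← he, inner_eq_sum]
        simp
        ring

theorem continuous_suppO : Continuous suppO := by
  unfold suppO suppA suppB
  fun_prop

theorem suppO_smul {c : ℝ} (hc : 0 ≤ c) (u : EuclideanSpace ℝ (Fin 3)) :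
    suppO (c • u) = c * suppO u := by
  have h : ∀ a b : ℝ, √((c * a) ^ 2 + (c * b) ^ 2) = c * √(a ^ 2 + b ^ 2) := by
    intro a b
    rw [← Real.sqrt_sq hc, ← Real.sqrt_mul (sq_nonneg c), Real.sqrt_sq hc]
    ring_nf
  simp only [suppO, suppA, suppB, PiLp.smul_apply, smul_eq_mul, h]
  rw [mul_max_of_nonneg _ _ hc]
  ring_nf

theorem isCompact_convexJoin {s t : Set (EuclideanSpace ℝ (Fin 3))} (hs : IsCompact s)
    (ht : IsCompact t) : IsCompact (convexJoin ℝ s t) := by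
  have h : convexJoin ℝ s t = (fun q : (EuclideanSpace ℝ (Fin 3) × EuclideanSpace ℝ (Fin 3)) × ℝ =>
      (1 - q.2) • q.1.1 + q.2 • q.1.2) '' ((s ×ˢ t) ×ˢ Set.Icc (0 : ℝ) 1) := by
    ext p
    simp only [mem_convexJoin, segment_eq_image, Set.mem_image, Set.mem_prod, Prod.exists]
    constructor
    · rintro ⟨a, ha, b, hb, l, hl, rfl⟩
      exact ⟨a, b, l, ⟨⟨ha, hb⟩, hl⟩, rfl⟩
    · rintro ⟨a, b, l, ⟨⟨ha, hb⟩, hl⟩, rfl⟩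
      exact ⟨a, ha, b, hb, l, hl, rfl⟩
  rw [h]
  exact ((hs.prod ht).prod isCompact_Icc).image (by fun_prop)

theorem sq_add_sq_convex {s t : ℝ} (hs : 0 ≤ s) (ht : 0 ≤ t) (hst : s + t = 1) {x y x' y' : ℝ}
    (h : x ^ 2 + y ^ 2 ≤ 1) (h' : x' ^ 2 + y' ^ 2 ≤ 1) :
    (s * x + t * x') ^ 2 + (s * y + t * y') ^ 2 ≤ 1 := by
  have h1 : 0 ≤ s * t * ((x - x') ^ 2 + (y - y') ^ 2) := by positivity
  obtain rfl : t = 1 - s := by linarith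
  nlinarith [mul_le_mul_of_nonneg_left h hs, mul_le_mul_of_nonneg_left h' ht]

theorem isCompact_convexHull_kA : IsCompact (convexHull ℝ kA) := by
  have hD : convexHull ℝ kA = {p | p 0 ^ 2 + (p 1 + 1 / 2) ^ 2 ≤ 1 ∧ p 2 = 0} := by
    refine Set.Subset.antisymm (convexHull_min (fun p hp => ⟨hp.1.le, hp.2⟩) ?_) ?_
    · rintro p ⟨h1, h2⟩ q ⟨h3, h4⟩ s t hs ht hst
      refine ⟨?_, by simp [h2, h4]⟩
      have := sq_add_sq_convex hs ht hst h1 h3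
      have e : (s • p + t • q) 1 + 1 / 2 = s * (p 1 + 1 / 2) + t * (q 1 + 1 / 2) := by
        simp only [PiLp.add_apply, PiLp.smul_apply, smul_eq_mul]
        linear_combination (-1 / 2) * hst
      rw [e]
      exact this
    · rintro p ⟨h1, h2⟩
      have hw : 0 ≤ 1 - (p 1 + 1 / 2) ^ 2 := by nlinarith [sq_nonneg (p 0)]
      have hsq := Real.sq_sqrt hw
      have hmem : ∀ e : ℝ, e ^ 2 = 1 - (p 1 + 1 / 2) ^ 2 →
          !₂[e, p 1, 0] ∈ convexHull ℝ kA := fun e he =>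
        subset_convexHull _ _ ⟨by simp [he], by simp⟩
      rcases hw.eq_or_lt with h0 | h0
      · convert hmem (p 0) (by nlinarith [sq_nonneg (p 0)]) using 1
        ext i
        fin_cases i <;> simp [h2]
      · have hpos := Real.sqrt_pos.2 h0
        set w := √(1 - (p 1 + 1 / 2) ^ 2)
        have hle : |p 0| ≤ w := abs_le_of_sq_le_sq (by linarith) hpos.le
        rw [abs_le] at hle
        have := (convex_convexHull ℝ kA) (hmem w hsq) (hmem (-w) (by rw [neg_sq, hsq]))
          (a := (w + p 0) / (2 * w)) (b := (w - p 0) / (2 * w))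
          (div_nonneg (by linarith) (by linarith)) (div_nonneg (by linarith) (by linarith))
          (by field_simp; ring)
        convert this using 1
        ext i
        fin_cases i
        · simp
          field_simp
          ring
        · simp
          field_simp
          ring
        · simp [h2]
  rw [hD]
  have hc1 : IsClosed {p : EuclideanSpace ℝ (Fin 3) | p 0 ^ 2 + (p 1 + 1 / 2) ^ 2 ≤ 1} :=
    isClosed_le (by fun_prop) (by fun_prop)
  have hc2 : IsClosed {p : EuclideanSpace ℝ (Fin 3) | p 2 = 0} :=
    isClosed_eq (by fun_prop) (by fun_prop)
  refine (isCompact_closedBall (0 : EuclideanSpace ℝ (Fin 3)) 2).of_isClosed_subset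
    (hc1.inter hc2) ?_
  rintro p ⟨h1, h2⟩
  rw [mem_closedBall_zero_iff, EuclideanSpace.norm_eq, Real.sqrt_le_left (by norm_num)]
  simp only [Fin.sum_univ_three, Real.norm_eq_abs, sq_abs]
  rw [h2]
  nlinarith [sq_nonneg (p 1 - 1 / 2), sq_nonneg (p 0)]

/-- The linear isometry `(x, y, z) ↦ (z, -y, x)`, which exchanges the two circles. -/
def swapAB : EuclideanSpace ℝ (Fin 3) ≃ₗᵢ[ℝ] EuclideanSpace ℝ (Fin 3) where
  toFun u := !₂[u 2, -u 1, u 0]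
  invFun u := !₂[u 2, -u 1, u 0]
  map_add' u v := by
    ext i
    fin_cases i <;> simp [add_comm]
  map_smul' c u := by
    ext i
    fin_cases i <;> simp
  left_inv u := by
    ext i
    fin_cases i <;> simp
  right_inv u := by
    ext i
    fin_cases i <;> simp
  norm_map' u := by
    simp [EuclideanSpace.norm_eq, Fin.sum_univ_three]
    ring_nf

theorem swapAB_apply (u : EuclideanSpace ℝ (Fin 3)) : swapAB u = !₂[u 2, -u 1, u 0] := rfl

theorem swapAB_image_kA : swapAB '' kA = kB := by
  ext p
  constructor
  · rintro ⟨q, ⟨h1, h2⟩, rfl⟩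
    refine ⟨?_, ?_⟩
    · simp [swapAB_apply]
      linarith
    · simpa [swapAB_apply] using h2
  · rintro ⟨h1, h2⟩
    refine ⟨!₂[p 2, -p 1, p 0], ⟨?_, ?_⟩, ?_⟩
    · simp
      linarith
    · simpa using h2
    · ext i
      fin_cases i <;> simp [swapAB_apply]

theorem isCompact_oloid : IsCompact oloid := by
  have hA : kA.Nonempty := ⟨!₂[1, -1 / 2, 0], by norm_num [kA]; rfl⟩
  have hB : kB.Nonempty := swapAB_image_kA ▸ hA.image _
  rw [oloid, convexHull_union hA hB]
  refine isCompact_convexJoin isCompact_convexHull_kA ?_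
  rw [← swapAB_image_kA]
  have := swapAB.toLinearEquiv.toLinearMap.image_convexHull kA
  exact this ▸ isCompact_convexHull_kA.image swapAB.continuous

theorem convex_oloid : Convex ℝ oloid := convex_convexHull _ _

/-- A smooth convex upper approximation of `max`. -/
def smoothMax (a b : ℝ) : ℝ := (a + b) / 2 + √(1 + ((a - b) / 2) ^ 2)

theorem smoothMax_spec (a b : ℝ) : a < smoothMax a b ∧ b < smoothMax a b ∧
    (smoothMax a b - a) * (smoothMax a b - b) = 1 := by
  have h := Real.sq_sqrt (show 0 ≤ 1 + ((a - b) / 2) ^ 2 by positivity)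
  have h2 : |(a - b) / 2| < √(1 + ((a - b) / 2) ^ 2) := by
    apply Real.lt_sqrt_of_sq_lt
    rw [sq_abs]
    linarith
  rw [abs_lt] at h2
  unfold smoothMax
  refine ⟨by linarith, by linarith, by linarith⟩

theorem smoothMax_lt {a b a' b' : ℝ} (ha : a ≤ a') (hb : b ≤ b') (h : a < a' ∨ b < b') :
    smoothMax a b < smoothMax a' b' := by
  obtain ⟨h1, h2, h3⟩ := smoothMax_spec a b
  obtain ⟨h1', h2', h3'⟩ := smoothMax_spec a' b'
  by_contra! hle
  have e1 : smoothMax a' b' - a' ≤ smoothMax a b - a := by linarith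
  have e2 : smoothMax a' b' - b' ≤ smoothMax a b - b := by linarith
  rcases h with h | h <;> nlinarith

theorem smoothMax_le {a b a' b' : ℝ} (ha : a ≤ a') (hb : b ≤ b') :
    smoothMax a b ≤ smoothMax a' b' := by
  by_cases h : a < a' ∨ b < b'
  · exact (smoothMax_lt ha hb h).le
  · push Not at h
    rw [ha.antisymm h.1, hb.antisymm h.2]

theorem smoothMax_add (a b m : ℝ) : smoothMax (a + m) (b + m) = smoothMax a b + m := by
  unfold smoothMax
  ring_nf

theorem sqrt_convex_lt {s t : ℝ} (hs : 0 < s) (ht : 0 < t) (hst : s + t = 1) {x y x' y' : ℝ}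
    (h : x ≠ x' ∨ y ≠ y') : √(1 + (s * x + t * x') ^ 2 + (s * y + t * y') ^ 2)
      < s * √(1 + x ^ 2 + y ^ 2) + t * √(1 + x' ^ 2 + y' ^ 2) := by
  have hP := Real.sq_sqrt (show 0 ≤ 1 + x ^ 2 + y ^ 2 by positivity)
  have hP' := Real.sq_sqrt (show 0 ≤ 1 + x' ^ 2 + y' ^ 2 by positivity)
  have hp := Real.sqrt_pos.2 (show 0 < 1 + x ^ 2 + y ^ 2 by positivity)
  have hp' := Real.sqrt_pos.2 (show 0 < 1 + x' ^ 2 + y' ^ 2 by positivity)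
  set P := √(1 + x ^ 2 + y ^ 2)
  set P' := √(1 + x' ^ 2 + y' ^ 2)
  have hpos : 0 < (x - x') ^ 2 + (y - y') ^ 2 := by
    rcases h with h | h
    · have := sub_ne_zero.2 h; positivity
    · have := sub_ne_zero.2 h; positivity
  have hPP : 1 + x * x' + y * y' < P * P' := by
    apply lt_of_abs_lt
    apply abs_lt_of_sq_lt_sq _ (by positivity)
    rw [mul_pow, hP, hP']
    nlinarith [sq_nonneg (x * y' - y * x')]
  rw [Real.sqrt_lt' (by positivity)]
  have hst2 : (s + t) ^ 2 = 1 := by rw [hst]; norm_num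
  have := mul_lt_mul_of_pos_left hPP (mul_pos hs ht)
  calc 1 + (s * x + t * x') ^ 2 + (s * y + t * y') ^ 2
      = s ^ 2 * (1 + x ^ 2 + y ^ 2) + t ^ 2 * (1 + x' ^ 2 + y' ^ 2)
        + 2 * (s * t * (1 + x * x' + y * y')) := by linear_combination -hst2
    _ < s ^ 2 * P ^ 2 + t ^ 2 * P' ^ 2 + 2 * (s * t * (P * P')) := by rw [hP, hP']; linarith
    _ = _ := by ring

theorem sqrt_convex_le {s t : ℝ} (hs : 0 < s) (ht : 0 < t) (hst : s + t = 1) (x y x' y' : ℝ) :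
    √(1 + (s * x + t * x') ^ 2 + (s * y + t * y') ^ 2)
      ≤ s * √(1 + x ^ 2 + y ^ 2) + t * √(1 + x' ^ 2 + y' ^ 2) := by
  by_cases h : x ≠ x' ∨ y ≠ y'
  · exact (sqrt_convex_lt hs ht hst h).le
  · push Not at h
    rw [h.1, h.2, ← add_mul, ← add_mul, ← add_mul, hst, one_mul, one_mul, one_mul]

theorem smoothMax_convex {s t : ℝ} (hs : 0 < s) (ht : 0 < t) (hst : s + t = 1) (a b a' b' : ℝ) :
    smoothMax (s * a + t * a') (s * b + t * b') ≤ s * smoothMax a b + t * smoothMax a' b' := by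
  have := sqrt_convex_le hs ht hst ((a - b) / 2) 0 ((a' - b') / 2) 0
  simp only [mul_zero, add_zero, ne_eq, OfNat.ofNat_ne_zero, not_false_eq_true, zero_pow] at this
  unfold smoothMax
  rw [show (s * a + t * a' - (s * b + t * b')) / 2 = s * ((a - b) / 2) + t * ((a' - b') / 2) by
    ring]
  linarith

theorem sqrt_add_le (x y a b : ℝ) : √(1 + (x + a) ^ 2 + (y + b) ^ 2)
    ≤ √(1 + x ^ 2 + y ^ 2) + √(a ^ 2 + b ^ 2) := by
  have hP := Real.sq_sqrt (show 0 ≤ 1 + x ^ 2 + y ^ 2 by positivity)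
  have hQ := Real.sq_sqrt (show 0 ≤ a ^ 2 + b ^ 2 by positivity)
  have hp := Real.sqrt_nonneg (1 + x ^ 2 + y ^ 2)
  have hq := Real.sqrt_nonneg (a ^ 2 + b ^ 2)
  set P := √(1 + x ^ 2 + y ^ 2)
  set Q := √(a ^ 2 + b ^ 2)
  have hPQ : x * a + y * b ≤ P * Q := by
    apply le_of_abs_le
    apply abs_le_of_sq_le_sq _ (by positivity)
    rw [mul_pow, hP, hQ]
    nlinarith [sq_nonneg (x * b - y * a), sq_nonneg a, sq_nonneg b]
  rw [Real.sqrt_le_left (by positivity)]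
  nlinarith

/-- A smooth strictly convex function asymptotic to the support function of the oloid. -/
def smoothO (u : EuclideanSpace ℝ (Fin 3)) : ℝ :=
  smoothMax (√(1 + u 0 ^ 2 + u 1 ^ 2) - u 1 / 2) (√(1 + u 1 ^ 2 + u 2 ^ 2) + u 1 / 2)

theorem contDiff_smoothO : ContDiff ℝ 2 smoothO := by
  have h : ∀ i : Fin 3, ContDiff ℝ 2 (fun u : EuclideanSpace ℝ (Fin 3) => u i) := fun i => by
    fun_prop
  have hs : ∀ i j : Fin 3, ContDiff ℝ 2
      (fun u : EuclideanSpace ℝ (Fin 3) => √(1 + u i ^ 2 + u j ^ 2)) := fun i j =>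
    ((contDiff_const.add ((h i).pow 2)).add ((h j).pow 2)).sqrt fun u => by positivity
  unfold smoothO smoothMax
  have hA := (hs 0 1).sub ((h 1).div_const 2)
  have hB := (hs 1 2).add ((h 1).div_const 2)
  exact ((hA.add hB).div_const 2).add
    ((contDiff_const.add (((hA.sub hB).div_const 2).pow 2)).sqrt fun u => by positivity)

theorem strictConvexOn_smoothO : StrictConvexOn ℝ Set.univ smoothO := by
  refine ⟨convex_univ, fun u _ v _ huv s t hs ht hst => ?_⟩
  have hA := sqrt_convex_le hs ht hst (u 0) (u 1) (v 0) (v 1)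
  have hB := sqrt_convex_le hs ht hst (u 1) (u 2) (v 1) (v 2)
  simp only [smul_eq_mul]
  refine lt_of_lt_of_le ?_ (smoothMax_convex hs ht hst _ _ _ _)
  simp only [smoothO, PiLp.add_apply, PiLp.smul_apply, smul_eq_mul]
  refine smoothMax_lt (by linarith) (by linarith) ?_
  by_cases h : u 0 ≠ v 0 ∨ u 1 ≠ v 1
  · left
    have := sqrt_convex_lt hs ht hst h
    linarith
  · right
    push Not at h
    have h2 : u 2 ≠ v 2 := fun h2 => huv (by
      ext i
      fin_cases i
      exacts [h.1, h.2, h2])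
    have := sqrt_convex_lt (x := u 1) (x' := v 1) hs ht hst (Or.inr h2)
    linarith

theorem exists_isSmoothing_oloid : ∃ G A, IsSmoothing suppO smoothO G A := by
  have hd : ∀ u, HasGradientAt smoothO (gradient smoothO u) u := fun u =>
    ((contDiff_smoothO.differentiable (by norm_num)) u).hasGradientAt
  have hG : ContDiff ℝ 1 (gradient smoothO) := by
    unfold gradient
    exact (InnerProductSpace.toDual ℝ (EuclideanSpace ℝ (Fin 3))).symm.toContinuousLinearEquiv.contDiff.comp
      (contDiff_smoothO.fderiv_right (by norm_num))
  refine ⟨gradient smoothO, fderiv ℝ (gradient smoothO), strictConvexOn_smoothO, fun u => ?_,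
    fun u => ((hG.differentiable (by norm_num)) u).hasFDerivAt,
    hG.continuous_fderiv (by norm_num), fun u => ?_, fun u d => ?_⟩
  · exact (hd u).hasFDerivAt
  · refine max_le ?_ ?_
    · refine le_trans ?_ (smoothMax_spec _ _).1.le
      exact sub_le_sub_right (Real.sqrt_le_sqrt (by linarith)) _
    · refine le_trans ?_ (smoothMax_spec _ _).2.1.le
      exact add_le_add_left (Real.sqrt_le_sqrt (by linarith)) _
  · rw [smoothO, smoothO, ← smoothMax_add]
    simp only [PiLp.add_apply]
    refine smoothMax_le ?_ ?_
    · have := sqrt_add_le (u 0) (u 1) (d 0) (d 1)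
      have h2 : suppA d ≤ suppO d := le_max_left _ _
      rw [suppA] at h2
      linarith
    · have := sqrt_add_le (u 1) (u 2) (d 1) (d 2)
      have h2 : suppB d ≤ suppO d := le_max_right _ _
      rw [suppB] at h2
      linarith

theorem IsSupport.image {C : Set (EuclideanSpace ℝ (Fin 3))} {H : EuclideanSpace ℝ (Fin 3) → ℝ}
    (h : IsSupport C H) (T : EuclideanSpace ℝ (Fin 3) ≃ₗᵢ[ℝ] EuclideanSpace ℝ (Fin 3)) :
    IsSupport (T '' C) (fun u => H (T.symm u)) where
  le := by
    rintro _ ⟨y, hy, rfl⟩ u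
    rw [← T.symm.inner_map_map, T.symm_apply_apply]
    exact h.le y hy _
  attained u := by
    obtain ⟨y, hy, hyu⟩ := h.attained (T.symm u)
    refine ⟨T y, ⟨y, hy, rfl⟩, ?_⟩
    rw [← T.symm.inner_map_map, T.symm_apply_apply, hyu]

theorem IsSmoothing.image {H F : EuclideanSpace ℝ (Fin 3) → ℝ}
    {G : EuclideanSpace ℝ (Fin 3) → EuclideanSpace ℝ (Fin 3)}
    {A : EuclideanSpace ℝ (Fin 3) → EuclideanSpace ℝ (Fin 3) →L[ℝ] EuclideanSpace ℝ (Fin 3)}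
    (h : IsSmoothing H F G A)
    (T : EuclideanSpace ℝ (Fin 3) ≃ₗᵢ[ℝ] EuclideanSpace ℝ (Fin 3)) :
    ∃ G' A', IsSmoothing (fun u => H (T.symm u)) (fun u => F (T.symm u)) G' A' := by
  set S : EuclideanSpace ℝ (Fin 3) →L[ℝ] EuclideanSpace ℝ (Fin 3) :=
    ((T.symm.toContinuousLinearEquiv : EuclideanSpace ℝ (Fin 3) ≃L[ℝ] EuclideanSpace ℝ (Fin 3)) :
      EuclideanSpace ℝ (Fin 3) →L[ℝ] EuclideanSpace ℝ (Fin 3)) with hS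
  set T' : EuclideanSpace ℝ (Fin 3) →L[ℝ] EuclideanSpace ℝ (Fin 3) :=
    ((T.toContinuousLinearEquiv : EuclideanSpace ℝ (Fin 3) ≃L[ℝ] EuclideanSpace ℝ (Fin 3)) :
      EuclideanSpace ℝ (Fin 3) →L[ℝ] EuclideanSpace ℝ (Fin 3)) with hT
  refine ⟨fun u => T (G (T.symm u)), fun u => T' ∘L (A (T.symm u)) ∘L S, ?_, ?_, ?_, ?_, ?_, ?_⟩
  · refine ⟨convex_univ, fun u _ v _ huv s t hs ht hst => ?_⟩
    simp only [map_add, map_smul]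
    exact h.strictConvexOn.2 trivial trivial (T.symm.injective.ne huv) hs ht hst
  · intro u
    have h1 : HasFDerivAt (fun u => T.symm u) S u := S.hasFDerivAt
    have h2 := (h.hasFDerivAt (T.symm u)).comp u h1
    have h3 : innerSL ℝ (T (G (T.symm u))) = (innerSL ℝ (G (T.symm u))).comp S := by
      ext v
      simp only [innerSL_apply_apply, ContinuousLinearMap.comp_apply]
      rw [← T.symm.inner_map_map, T.symm_apply_apply]
      rfl
    rw [h3]
    exact h2
  · intro u
    have h1 : HasFDerivAt (fun u => T.symm u) S u := S.hasFDerivAt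
    have h2 := (h.hasFDerivAt_gradient (T.symm u)).comp u h1
    exact T'.hasFDerivAt.comp u h2
  · exact continuous_const.clm_comp
      ((h.continuous_hessian.comp T.symm.continuous).clm_comp continuous_const)
  · exact fun u => h.le _
  · intro u d
    simp only [map_add]
    exact h.add_le _ _

theorem exists_volume_oloid_add_smul_image_eq_cubic
    (T : EuclideanSpace ℝ (Fin 3) ≃ₗᵢ[ℝ] EuclideanSpace ℝ (Fin 3)) :
    ∃ c₀ c₁ c₂ c₃ : ℝ, ∀ t : ℝ, 0 ≤ t →
      volume.real (oloid + t • (T '' oloid)) = c₀ + c₁ * t + c₂ * t ^ 2 + c₃ * t ^ 3 := by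
  obtain ⟨G, A, hO⟩ := exists_isSmoothing_oloid
  obtain ⟨G', A', hT⟩ := hO.image T
  exact exists_volume_add_smul_eq_cubic isSupport_oloid (isSupport_oloid.image T) convex_oloid
    (convex_oloid.linear_image T.toLinearEquiv.toLinearMap) isCompact_oloid
    (isCompact_oloid.image T.continuous) hO hT

/-- The elliptic modulus function `√(1 - (3/4) sin² x)`. -/
def dl (x : ℝ) : ℝ := √(1 - 3 / 4 * sin x ^ 2)

theorem dl_sq (x : ℝ) : dl x ^ 2 = 1 - 3 / 4 * sin x ^ 2 :=
  Real.sq_sqrt (by nlinarith [sin_sq_le_one x])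

theorem half_le_dl (x : ℝ) : 1 / 2 ≤ dl x := by
  apply Real.le_sqrt_of_sq_le
  nlinarith [sin_sq_le_one x]

theorem dl_pos (x : ℝ) : 0 < dl x := lt_of_lt_of_le (by norm_num) (half_le_dl x)

theorem continuous_dl : Continuous dl := by
  unfold dl
  fun_prop

theorem hasDerivAt_dl (x : ℝ) : HasDerivAt dl (-(3 / 4) * sin x * cos x / dl x) x := by
  have h : HasDerivAt (fun x => 1 - 3 / 4 * sin x ^ 2) (-(3 / 4 * (2 * sin x * cos x))) x := by
    have := ((hasDerivAt_sin x).pow 2).const_mul (3 / 4)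
    simpa using this.const_sub 1
  have h2 := h.sqrt (by nlinarith [sin_sq_le_one x])
  have := dl_pos x
  refine h2.congr_deriv ?_
  change _ / (2 * dl x) = _
  field_simp

theorem sqrt_three_sq : √3 ^ 2 = (3 : ℝ) := Real.sq_sqrt (by norm_num)

/-- First coordinate of the point of `kA` on the ruling with parameter `x`. -/
def rulA (x : ℝ) : ℝ := √3 * dl x * sin x

/-- Third coordinate of the point of `kB` on the ruling with parameter `x`. -/
def rulB (x : ℝ) : ℝ := √3 * cos x / (2 * dl x ^ 2)

/-- Slope of the point of `kA` on the ruling with parameter `x`. -/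
def slopeA (x : ℝ) : ℝ := -(√3 / 2) * cos x ^ 2 / (dl x * sin x)

/-- Slope of the point of `kB` on the ruling with parameter `x`. -/
def slopeB (x : ℝ) : ℝ := √3 / 4 * sin x ^ 2 / cos x

theorem sin_pos_of_mem {x : ℝ} (hx : x ∈ Set.Ioo 0 (π / 2)) : 0 < sin x :=
  sin_pos_of_mem_Ioo ⟨hx.1, by linarith [hx.2, pi_pos]⟩

theorem cos_pos_of_mem {x : ℝ} (hx : x ∈ Set.Ioo 0 (π / 2)) : 0 < cos x :=
  cos_pos_of_mem_Ioo ⟨by linarith [hx.1, pi_pos], hx.2⟩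

theorem rulA_pos {x : ℝ} (hx : x ∈ Set.Ioo 0 (π / 2)) : 0 < rulA x := by
  have := sin_pos_of_mem hx
  have := dl_pos x
  unfold rulA
  positivity

theorem rulB_pos {x : ℝ} (hx : x ∈ Set.Ioo 0 (π / 2)) : 0 < rulB x := by
  have := cos_pos_of_mem hx
  have := dl_pos x
  unfold rulB
  positivity

theorem hasDerivAt_slopeA {x : ℝ} (hx : x ∈ Set.Ioo 0 (π / 2)) :
    HasDerivAt slopeA (√3 / 3 * (1 / 2 + dl x ^ 2) * cos x / (dl x ^ 3 * sin x ^ 2)) x := by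
  have hs := sin_pos_of_mem hx
  have hd := dl_pos x
  have h1 := ((hasDerivAt_cos x).pow 2).const_mul (-(√3 / 2))
  have h2 := (hasDerivAt_dl x).mul (hasDerivAt_sin x)
  refine (h1.div h2 (by simp; constructor <;> positivity)).congr_deriv ?_
  have hc : cos x ^ 2 = 1 - sin x ^ 2 := cos_sq' x
  have hdd := dl_sq x
  simp only [Pi.mul_apply, Pi.pow_apply]
  field_simp
  norm_num
  linear_combination cos x * 3 * (4 * dl x ^ 2 - 3 * sin x ^ 2) * hc
    + cos x * (4 + 12 * sin x ^ 2) * hdd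

theorem hasDerivAt_slopeB {x : ℝ} (hx : x ∈ Set.Ioo 0 (π / 2)) :
    HasDerivAt slopeB (√3 / 4 * sin x * (1 + cos x ^ 2) / cos x ^ 2) x := by
  have hc := cos_pos_of_mem hx
  have h1 := ((hasDerivAt_sin x).pow 2).const_mul (√3 / 4)
  refine (h1.div (hasDerivAt_cos x) hc.ne').congr_deriv ?_
  have hc : sin x ^ 2 = 1 - cos x ^ 2 := sin_sq x
  simp only [Pi.pow_apply]
  field_simp
  norm_num
  linear_combination sin x * hc

theorem strictMonoOn_slopeA : StrictMonoOn slopeA (Set.Ioo 0 (π / 2)) := by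
  refine strictMonoOn_of_deriv_pos (convex_Ioo _ _)
    (fun x hx => (hasDerivAt_slopeA hx).continuousAt.continuousWithinAt) fun x hx => ?_
  rw [interior_Ioo] at hx
  rw [(hasDerivAt_slopeA hx).deriv]
  have := sin_pos_of_mem hx
  have := cos_pos_of_mem hx
  have := dl_pos x
  positivity

theorem strictMonoOn_slopeB : StrictMonoOn slopeB (Set.Ioo 0 (π / 2)) := by
  refine strictMonoOn_of_deriv_pos (convex_Ioo _ _)
    (fun x hx => (hasDerivAt_slopeB hx).continuousAt.continuousWithinAt) fun x hx => ?_
  rw [interior_Ioo] at hx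
  rw [(hasDerivAt_slopeB hx).deriv]
  have := sin_pos_of_mem hx
  have := cos_pos_of_mem hx
  positivity

theorem strictMonoOn_slope {y₀ y₂ : ℝ} (h₀ : 0 < y₀) (h₂ : 0 < y₂) :
    StrictMonoOn (fun x => y₀ * slopeA x + y₂ * slopeB x) (Set.Ioo 0 (π / 2)) :=
  fun _ hx _ hx' h => add_lt_add
    (mul_lt_mul_of_pos_left (strictMonoOn_slopeA hx hx' h) h₀)
    (mul_lt_mul_of_pos_left (strictMonoOn_slopeB hx hx' h) h₂)

theorem continuousOn_slope (y₀ y₂ : ℝ) :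
    ContinuousOn (fun x => y₀ * slopeA x + y₂ * slopeB x) (Set.Ioo 0 (π / 2)) := fun _ hx =>
  ((continuousAt_const.mul (hasDerivAt_slopeA hx).continuousAt).add
    (continuousAt_const.mul (hasDerivAt_slopeB hx).continuousAt)).continuousWithinAt

theorem tendsto_slope_zero {y₀ : ℝ} (h₀ : 0 < y₀) (y₂ : ℝ) :
    Filter.Tendsto (fun x => y₀ * slopeA x + y₂ * slopeB x) (nhdsWithin 0 (Set.Ioo 0 (π / 2)))
      Filter.atBot := by
  have hB : Filter.Tendsto (fun x => y₂ * slopeB x) (nhdsWithin 0 (Set.Ioo 0 (π / 2)))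
      (nhds (y₂ * slopeB 0)) := by
    have : ContinuousAt slopeB 0 := by
      unfold slopeB
      exact ContinuousAt.div (by fun_prop) (by fun_prop) (by simp)
    exact (this.const_mul y₂).tendsto.mono_left nhdsWithin_le_nhds
  refine Filter.Tendsto.atBot_add ?_ hB
  have h1 : Filter.Tendsto (fun x => dl x * sin x) (nhdsWithin 0 (Set.Ioo 0 (π / 2)))
      (nhdsWithin 0 (Set.Ioi 0)) := by
    refine tendsto_nhdsWithin_of_tendsto_nhds_of_eventually_within _ ?_ ?_
    · have : Continuous (fun x => dl x * sin x) := continuous_dl.mul continuous_sin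
      have := (this.tendsto 0).mono_left (nhdsWithin_le_nhds (s := Set.Ioo 0 (π / 2)))
      simpa using this
    · filter_upwards [self_mem_nhdsWithin] with x hx
      exact mul_pos (dl_pos x) (sin_pos_of_mem hx)
  have h2 := tendsto_inv_nhdsGT_zero.comp h1
  have h3 : Filter.Tendsto (fun x => y₀ * (-(√3 / 2) * cos x ^ 2))
      (nhdsWithin 0 (Set.Ioo 0 (π / 2))) (nhds (y₀ * (-(√3 / 2) * cos 0 ^ 2))) := by
    have : Continuous (fun x => y₀ * (-(√3 / 2) * cos x ^ 2)) := by fun_prop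
    exact (this.tendsto 0).mono_left nhdsWithin_le_nhds
  refine (h3.neg_mul_atTop ?_ h2).congr fun x => ?_
  · have : 0 < √3 := by positivity
    simp
    positivity
  · simp [slopeA, div_eq_mul_inv, mul_assoc]

theorem tendsto_slope_pi_div_two (y₀ : ℝ) {y₂ : ℝ} (h₂ : 0 < y₂) :
    Filter.Tendsto (fun x => y₀ * slopeA x + y₂ * slopeB x)
      (nhdsWithin (π / 2) (Set.Ioo 0 (π / 2))) Filter.atTop := by
  have hA : Filter.Tendsto (fun x => y₀ * slopeA x) (nhdsWithin (π / 2) (Set.Ioo 0 (π / 2)))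
      (nhds (y₀ * slopeA (π / 2))) := by
    have : ContinuousAt slopeA (π / 2) := by
      unfold slopeA
      exact ContinuousAt.div (by fun_prop) (continuous_dl.mul continuous_sin).continuousAt
        (by simpa using (dl_pos _).ne')
    exact (this.const_mul y₀).tendsto.mono_left nhdsWithin_le_nhds
  refine Filter.Tendsto.add_atTop hA ?_
  have h1 : Filter.Tendsto cos (nhdsWithin (π / 2) (Set.Ioo 0 (π / 2)))
      (nhdsWithin 0 (Set.Ioi 0)) := by
    refine tendsto_nhdsWithin_of_tendsto_nhds_of_eventually_within _ ?_ ?_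
    · have := (continuous_cos.tendsto (π / 2)).mono_left
        (nhdsWithin_le_nhds (s := Set.Ioo 0 (π / 2)))
      simpa using this
    · filter_upwards [self_mem_nhdsWithin] with x hx
      exact cos_pos_of_mem hx
  have h2 := tendsto_inv_nhdsGT_zero.comp h1
  have h3 : Filter.Tendsto (fun x => y₂ * (√3 / 4 * sin x ^ 2))
      (nhdsWithin (π / 2) (Set.Ioo 0 (π / 2))) (nhds (y₂ * (√3 / 4 * sin (π / 2) ^ 2))) := by
    have : Continuous (fun x => y₂ * (√3 / 4 * sin x ^ 2)) := by fun_prop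
    exact (this.tendsto _).mono_left nhdsWithin_le_nhds
  refine (h3.pos_mul_atTop ?_ h2).congr fun x => ?_
  · have : 0 < √3 := by positivity
    simp
    positivity
  · simp [slopeB, div_eq_mul_inv, mul_assoc]

theorem exists_slope_eq {y₀ y₂ : ℝ} (h₀ : 0 < y₀) (h₂ : 0 < y₂) (y₁ : ℝ) :
    ∃ x ∈ Set.Ioo 0 (π / 2), y₀ * slopeA x + y₂ * slopeB x = y₁ := by
  have hpi : 0 < π / 2 := by positivity
  have hl : (nhds 0 ⊓ Filter.principal (Set.Ioo 0 (π / 2))).NeBot := left_nhdsWithin_Ioo_neBot hpi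
  have hr : (nhds (π / 2) ⊓ Filter.principal (Set.Ioo 0 (π / 2))).NeBot :=
    right_nhdsWithin_Ioo_neBot hpi
  obtain ⟨x, hx, h⟩ := isPreconnected_Ioo.intermediate_value_Iii inf_le_right inf_le_right
    (continuousOn_slope y₀ y₂) (tendsto_slope_zero h₀ y₂) (tendsto_slope_pi_div_two y₀ h₂)
    (Set.mem_univ y₁)
  exact ⟨x, hx, h⟩

/-- The point with parameters `(x, λ)` on the rulings of the oloid. -/
def rulPt (x l : ℝ) : EuclideanSpace ℝ (Fin 3) :=
  !₂[(1 - l) * rulA x, (1 - l) * (rulA x * slopeA x) + l * (rulB x * slopeB x), l * rulB x]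

/-- A normal vector to the oloid along the ruling with parameter `x`. -/
def nrm (x : ℝ) : EuclideanSpace ℝ (Fin 3) :=
  !₂[√3 * dl x * sin x, -1 + 3 / 2 * sin x ^ 2, √3 * cos x]

theorem rulA_mul_slopeA {x : ℝ} (hx : x ∈ Set.Ioo 0 (π / 2)) :
    rulA x * slopeA x = -(3 / 2) * cos x ^ 2 := by
  have := sin_pos_of_mem hx
  have := dl_pos x
  unfold rulA slopeA
  field_simp
  linear_combination -cos x ^ 2 * sqrt_three_sq

theorem rulB_mul_slopeB {x : ℝ} (hx : x ∈ Set.Ioo 0 (π / 2)) :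
    rulB x * slopeB x = 3 / 8 * sin x ^ 2 / dl x ^ 2 := by
  have := cos_pos_of_mem hx
  have := dl_pos x
  unfold rulB slopeB
  field_simp
  linear_combination 8 * sin x ^ 2 * sqrt_three_sq

theorem inner_rulPt_nrm {x : ℝ} (hx : x ∈ Set.Ioo 0 (π / 2)) (l : ℝ) :
    inner ℝ (rulPt x l) (nrm x) = 1 / 2 + dl x ^ 2 := by
  have hd := dl_pos x
  have hc := cos_sq' x
  have h2 := dl_sq x
  have h3 := sqrt_three_sq
  rw [inner_eq_sum, rulPt, rulA_mul_slopeA hx, rulB_mul_slopeB hx, nrm]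
  simp only [rulA, rulB, Matrix.cons_val]
  field_simp
  rw [show dl x ^ 4 = (dl x ^ 2) ^ 2 by ring, h3, hc, h2]
  ring

theorem suppO_nrm (x : ℝ) : suppO (nrm x) = 1 / 2 + dl x ^ 2 := by
  have hc := cos_sq' x
  have h2 := dl_sq x
  have h3 := sqrt_three_sq
  have hA : suppA (nrm x) = 1 / 2 + dl x ^ 2 := by
    have : (√3 * dl x * sin x) ^ 2 + (-1 + 3 / 2 * sin x ^ 2) ^ 2 = 1 := by
      rw [mul_pow, mul_pow, h3, h2]
      ring
    simp [suppA, nrm, this]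
    linarith
  have hB : suppB (nrm x) = 1 / 2 + dl x ^ 2 := by
    have : (-1 + 3 / 2 * sin x ^ 2) ^ 2 + (√3 * cos x) ^ 2 = (2 * dl x ^ 2) ^ 2 := by
      rw [mul_pow, h3, h2, hc]
      ring
    simp only [suppB, nrm, Matrix.cons_val, this]
    rw [Real.sqrt_sq (by positivity)]
    linarith
  rw [suppO, hA, hB, max_self]

theorem norm_nrm (x : ℝ) : ‖nrm x‖ = 2 * dl x := by
  have hd := dl_pos x
  rw [EuclideanSpace.norm_eq, Real.sqrt_eq_iff_mul_self_eq (by positivity) (by positivity)]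
  simp only [Fin.sum_univ_three, Real.norm_eq_abs, sq_abs, nrm, Matrix.cons_val]
  have hc := cos_sq' x
  have h2 := dl_sq x
  have h3 := sqrt_three_sq
  rw [mul_pow, mul_pow, mul_pow, h3, hc]
  linear_combination (3 * sin x ^ 2 - 4) * h2

theorem rulPt_mem {x l : ℝ} (hx : x ∈ Set.Ioo 0 (π / 2)) (hl : l ∈ Set.Icc (0 : ℝ) 1) :
    rulPt x l ∈ oloid := by
  have hc := cos_sq' x
  have h2 := dl_sq x
  have h3 := sqrt_three_sq
  have hd := dl_pos x
  have hA : !₂[rulA x, rulA x * slopeA x, 0] ∈ oloid := by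
    refine subset_convexHull _ _ (Or.inl ⟨?_, by simp⟩)
    simp only [Matrix.cons_val]
    rw [rulA_mul_slopeA hx, rulA, mul_pow, mul_pow, h3, h2, hc]
    ring
  have hB : !₂[0, rulB x * slopeB x, rulB x] ∈ oloid := by
    refine subset_convexHull _ _ (Or.inr ⟨?_, by simp⟩)
    simp only [Matrix.cons_val]
    rw [rulB_mul_slopeB hx, rulB, div_pow, mul_pow, h3, hc]
    field_simp
    rw [show dl x ^ 4 = (dl x ^ 2) ^ 2 by ring, h2]
    ring
  have := convex_oloid hA hB (sub_nonneg.2 hl.2) hl.1 (by ring)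
  convert this using 1
  ext i
  fin_cases i <;> simp [rulPt]

theorem lintegral_fin_three {F : (Fin 3 → ℝ) → ENNReal} (hF : Measurable F) :
    ∫⁻ y, F y = ∫⁻ a, ∫⁻ b, ∫⁻ c, F ![a, b, c] := by
  rw [← (volume_preserving_piFinSuccAbove (fun _ => ℝ) (0 : Fin 3)).symm.lintegral_comp hF]
  have h1 : Measurable fun q : ℝ × (Fin 2 → ℝ) =>
      F ((MeasurableEquiv.piFinSuccAbove (fun _ : Fin 3 => ℝ) 0).symm q) :=
    hF.comp (MeasurableEquiv.measurable _)
  rw [Measure.volume_eq_prod, lintegral_prod _ h1.aemeasurable]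
  refine lintegral_congr fun a => ?_
  have h2 : Measurable fun q : Fin 2 → ℝ =>
      F ((MeasurableEquiv.piFinSuccAbove (fun _ : Fin 3 => ℝ) 0).symm (a, q)) :=
    h1.comp measurable_prodMk_left
  rw [← (volume_preserving_finTwoArrow ℝ).symm.lintegral_comp h2]
  have h3 : Measurable fun q : ℝ × ℝ => F ((MeasurableEquiv.piFinSuccAbove (fun _ : Fin 3 => ℝ) 0).symm
      (a, MeasurableEquiv.finTwoArrow.symm q)) := h2.comp (MeasurableEquiv.measurable _)
  rw [Measure.volume_eq_prod, lintegral_prod _ h3.aemeasurable]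
  refine lintegral_congr fun b => lintegral_congr fun c => ?_
  congr 1
  ext i
  fin_cases i <;> rfl

theorem lintegral_euclidean_fin_three {F : EuclideanSpace ℝ (Fin 3) → ENNReal}
    (hF : Measurable F) : ∫⁻ y, F y = ∫⁻ a, ∫⁻ b, ∫⁻ c, F !₂[a, b, c] := by
  have h := (EuclideanSpace.volume_preserving_symm_measurableEquiv_toLp (Fin 3)).symm
  rw [← h.lintegral_comp hF]
  exact lintegral_fin_three (hF.comp (MeasurableEquiv.measurable _))

/-- The Jacobian density of the ruled parametrization. -/
def jac (x l : ℝ) : ℝ :=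
  (1 / 2 + dl x ^ 2) / (2 * dl x ^ 3) * ((1 - l) * (3 * cos x ^ 2) + l * (3 / 2 * sin x ^ 2))

theorem jac_eq {x : ℝ} (hx : x ∈ Set.Ioo 0 (π / 2)) (l : ℝ) :
    rulA x * rulB x * ((1 - l) * rulA x *
      (√3 / 3 * (1 / 2 + dl x ^ 2) * cos x / (dl x ^ 3 * sin x ^ 2))
      + l * rulB x * (√3 / 4 * sin x * (1 + cos x ^ 2) / cos x ^ 2)) = jac x l := by
  have := sin_pos_of_mem hx
  have := cos_pos_of_mem hx
  have := dl_pos x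
  have h4 : √3 ^ 4 = (3 : ℝ) ^ 2 := by
    rw [show √3 ^ 4 = (√3 ^ 2) ^ 2 by ring, sqrt_three_sq]
  unfold rulA rulB jac
  field_simp
  rw [h4, cos_sq', dl_sq]
  ring

theorem jac_pos {x l : ℝ} (hx : x ∈ Set.Ioo 0 (π / 2)) (hl : l ∈ Set.Ioo (0 : ℝ) 1) :
    0 < jac x l := by
  have := sin_pos_of_mem hx
  have := cos_pos_of_mem hx
  have := dl_pos x
  have h1 := sub_pos.2 hl.2
  have h2 := hl.1
  unfold jac
  positivity

/-- The cone parametrization of a quadrant by the rulings of the oloid. -/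
def ruling (u : Fin 3 → ℝ) : Fin 3 → ℝ :=
  ![u 2 * ((1 - u 1) * rulA (u 0)),
    u 2 * ((1 - u 1) * (rulA (u 0) * slopeA (u 0)) + u 1 * (rulB (u 0) * slopeB (u 0))),
    u 2 * (u 1 * rulB (u 0))]

/-- The parameter domain of `ruling`. -/
def rulDom : Set (Fin 3 → ℝ) := {u | u 0 ∈ Set.Ioo 0 (π / 2) ∧ u 1 ∈ Set.Ioo (0 : ℝ) 1 ∧ 0 < u 2}

theorem ruling_slope (u : Fin 3 → ℝ) : ruling u 0 * slopeA (u 0) + ruling u 2 * slopeB (u 0)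
    = ruling u 1 := by
  simp [ruling]
  ring

theorem ruling_pos {u : Fin 3 → ℝ} (hu : u ∈ rulDom) : 0 < ruling u 0 ∧ 0 < ruling u 2 := by
  obtain ⟨h0, h1, h2⟩ := hu
  exact ⟨mul_pos h2 (mul_pos (sub_pos.2 h1.2) (rulA_pos h0)), mul_pos h2 (mul_pos h1.1 (rulB_pos h0))⟩

theorem image_ruling : ruling '' rulDom = {y | 0 < y 0 ∧ 0 < y 2} := by
  ext y
  constructor
  · rintro ⟨u, hu, rfl⟩
    exact ruling_pos hu
  · rintro ⟨h0, h2⟩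
    obtain ⟨x, hx, hxy⟩ := exists_slope_eq h0 h2 (y 1)
    have hA := rulA_pos hx
    have hB := rulB_pos hx
    have hα : 0 < y 0 / rulA x := div_pos h0 hA
    have hβ : 0 < y 2 / rulB x := div_pos h2 hB
    set α := y 0 / rulA x with hα'
    set β := y 2 / rulB x with hβ'
    have e0 : α * rulA x = y 0 := div_mul_cancel₀ _ hA.ne'
    have e2 : β * rulB x = y 2 := div_mul_cancel₀ _ hB.ne'
    have hl : (α + β) * (β / (α + β)) = β := by field_simp
    refine ⟨![x, β / (α + β), α + β], ⟨hx, ⟨by simp; positivity, ?_⟩, by simp; positivity⟩, ?_⟩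
    · simp only [Matrix.cons_val]
      rw [div_lt_one (by positivity)]
      linarith
    · ext i
      fin_cases i
      · simp [ruling]
        linear_combination e0 - rulA x * hl
      · simp [ruling]
        linear_combination hxy + slopeA x * e0 + slopeB x * e2 - slopeA x * rulA x * hl
          + slopeB x * rulB x * hl
      · simp [ruling]
        linear_combination e2 + rulB x * hl

theorem injOn_ruling : Set.InjOn ruling rulDom := by
  intro u hu v hv huv
  have h0 : u 0 = v 0 := by
    have h := ruling_pos hu
    refine (strictMonoOn_slope h.1 h.2).injOn hu.1 hv.1 ?_
    change ruling u 0 * slopeA (u 0) + ruling u 2 * slopeB (u 0)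
      = ruling u 0 * slopeA (v 0) + ruling u 2 * slopeB (v 0)
    rw [ruling_slope, huv, ruling_slope]
  have e0 := congrFun huv 0
  have e2 := congrFun huv 2
  simp only [ruling, Matrix.cons_val, ← h0] at e0 e2
  have hA := rulA_pos hu.1
  have hB := rulB_pos hu.1
  have e0' : u 2 * (1 - u 1) = v 2 * (1 - v 1) := by
    apply mul_right_cancel₀ hA.ne'
    linarith
  have e2' : u 2 * u 1 = v 2 * v 1 := by
    apply mul_right_cancel₀ hB.ne'
    linarith
  have h2 : u 2 = v 2 := by linarith
  have h1 : u 1 = v 1 := by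
    rw [← h2] at e2'
    exact mul_left_cancel₀ hu.2.2.ne' e2'
  ext i
  fin_cases i
  exacts [h0, h1, h2]

theorem differentiableAt_rulA (x : ℝ) : DifferentiableAt ℝ rulA x :=
  ((hasDerivAt_dl x).differentiableAt.const_mul _).mul differentiable_sin.differentiableAt

theorem differentiableAt_rulB (x : ℝ) : DifferentiableAt ℝ rulB x :=
  (differentiable_cos.differentiableAt.const_mul _).div
    (((hasDerivAt_dl x).differentiableAt.pow 2).const_mul 2) (by have := dl_pos x; positivity)

theorem hasFDerivAt_fin_three {f : (Fin 3 → ℝ) → Fin 3 → ℝ} {u : Fin 3 → ℝ}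
    {L₀ L₁ L₂ : (Fin 3 → ℝ) →L[ℝ] ℝ} (h₀ : HasFDerivAt (fun x => f x 0) L₀ u)
    (h₁ : HasFDerivAt (fun x => f x 1) L₁ u) (h₂ : HasFDerivAt (fun x => f x 2) L₂ u) :
    HasFDerivAt f (ContinuousLinearMap.pi ![L₀, L₁, L₂]) u := by
  refine hasFDerivAt_pi'.2 fun i => ?_
  fin_cases i
  exacts [h₀, h₁, h₂]

theorem exists_hasFDerivAt_ruling {u : Fin 3 → ℝ} (hu : u ∈ rulDom) :
    ∃ A : (Fin 3 → ℝ) →L[ℝ] (Fin 3 → ℝ), HasFDerivAt ruling A u ∧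
      |A.det| = u 2 ^ 2 * jac (u 0) (u 1) := by
  have hp : ∀ i : Fin 3, HasFDerivAt (fun u : Fin 3 → ℝ => u i)
      (ContinuousLinearMap.proj i : (Fin 3 → ℝ) →L[ℝ] ℝ) u := fun i =>
    (ContinuousLinearMap.proj i : (Fin 3 → ℝ) →L[ℝ] ℝ).hasFDerivAt
  have hA := (differentiableAt_rulA (u 0)).hasDerivAt.comp_hasFDerivAt u (hp 0)
  have hB := (differentiableAt_rulB (u 0)).hasDerivAt.comp_hasFDerivAt u (hp 0)
  have hSA := (hasDerivAt_slopeA hu.1).comp_hasFDerivAt u (hp 0)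
  have hSB := (hasDerivAt_slopeB hu.1).comp_hasFDerivAt u (hp 0)
  have h0 := (hp 2).mul (((hp 1).const_sub 1).mul hA)
  have h1 := (hp 2).mul ((((hp 1).const_sub 1).mul (hA.mul hSA)).add ((hp 1).mul (hB.mul hSB)))
  have h2 := (hp 2).mul ((hp 1).mul hB)
  refine ⟨_, hasFDerivAt_fin_three h0 h1 h2, ?_⟩
  have hpos : 0 < u 2 ^ 2 * jac (u 0) (u 1) := mul_pos (pow_pos hu.2.2 2) (jac_pos hu.1 hu.2.1)
  rw [ContinuousLinearMap.det, ← LinearMap.det_toMatrix', Matrix.det_fin_three, ← abs_of_pos hpos,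
    ← jac_eq hu.1]
  rw [abs_eq_abs]
  left
  generalize √3 / 3 * (1 / 2 + dl (u 0) ^ 2) * cos (u 0) / (dl (u 0) ^ 3 * sin (u 0) ^ 2) = p
  generalize √3 / 4 * sin (u 0) * (1 + cos (u 0) ^ 2) / cos (u 0) ^ 2 = q
  simp [LinearMap.toMatrix'_apply]
  ring

theorem continuous_jac : Continuous fun q : ℝ × ℝ => jac q.1 q.2 := by
  unfold jac
  have h : Continuous fun q : ℝ × ℝ => dl q.1 := continuous_dl.comp continuous_fst
  refine Continuous.mul (Continuous.div (by fun_prop) (by fun_prop) fun q => ?_) (by fun_prop)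
  have := dl_pos q.1
  positivity

theorem measurableSet_rulDom : MeasurableSet rulDom := by
  refine MeasurableSet.inter ?_ (MeasurableSet.inter ?_ ?_)
  · exact measurableSet_Ioo.preimage (measurable_pi_apply 0)
  · exact measurableSet_Ioo.preimage (measurable_pi_apply 1)
  · exact measurableSet_Ioi.preimage (measurable_pi_apply 2)

theorem toLp_ruling (u : Fin 3 → ℝ) : WithLp.toLp 2 (ruling u) = u 2 • rulPt (u 0) (u 1) := by
  ext i
  fin_cases i <;> simp [ruling, rulPt]

/-- The open quadrant wedge `{y₀ > 0, y₂ > 0}`. -/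
def wedge : Set (EuclideanSpace ℝ (Fin 3)) := {y | 0 < y 0 ∧ 0 < y 2}

theorem isOpen_wedge : IsOpen wedge := by
  have h0 : IsOpen {y : EuclideanSpace ℝ (Fin 3) | 0 < y 0} :=
    isOpen_lt (by fun_prop) (by fun_prop)
  have h2 : IsOpen {y : EuclideanSpace ℝ (Fin 3) | 0 < y 2} :=
    isOpen_lt (by fun_prop) (by fun_prop)
  exact h0.inter h2

theorem measurable_rulPt : Measurable fun q : ℝ × ℝ => rulPt q.1 q.2 := by
  have hd := continuous_dl.measurable
  unfold rulPt rulA rulB slopeA slopeB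
  refine (PiLp.continuous_toLp 2 _).measurable.comp (measurable_pi_iff.2 fun i => ?_)
  fin_cases i <;> simp <;> fun_prop

theorem volume_inter_wedge {C : Set (EuclideanSpace ℝ (Fin 3))} (hC : MeasurableSet C) :
    volume (C ∩ wedge) = ∫⁻ x in Set.Ioo 0 (π / 2), ∫⁻ l in Set.Ioo (0 : ℝ) 1,
      ENNReal.ofReal (jac x l) * ∫⁻ s in Set.Ioi (0 : ℝ),
        ENNReal.ofReal (s ^ 2) * C.indicator 1 (s • rulPt x l) := by
  have hmp := EuclideanSpace.volume_preserving_symm_measurableEquiv_toLp (Fin 3)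
  have h1 : volume (C ∩ wedge) = ∫⁻ y in {y : Fin 3 → ℝ | 0 < y 0 ∧ 0 < y 2},
      C.indicator 1 (WithLp.toLp 2 y) := by
    have hQ : MeasurableSet {y : Fin 3 → ℝ | 0 < y 0 ∧ 0 < y 2} :=
      (measurableSet_Ioi.preimage (measurable_pi_apply 0)).inter
        (measurableSet_Ioi.preimage (measurable_pi_apply 2))
    have hW := hC.inter isOpen_wedge.measurableSet
    rw [← lintegral_indicator_one hW, ← hmp.symm.lintegral_comp (measurable_one.indicator hW),
      ← lintegral_indicator hQ]
    refine lintegral_congr fun y => ?_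
    rw [Set.inter_comm, ← Set.indicator_indicator]
    rfl
  have h2 : ∫⁻ y in {y : Fin 3 → ℝ | 0 < y 0 ∧ 0 < y 2}, C.indicator 1 (WithLp.toLp 2 y)
      = ∫⁻ u in rulDom, ENNReal.ofReal (u 2 ^ 2 * jac (u 0) (u 1)) *
        C.indicator 1 (u 2 • rulPt (u 0) (u 1)) := by
    choose! A hA hdet using @exists_hasFDerivAt_ruling
    rw [← image_ruling, lintegral_image_eq_lintegral_abs_det_fderiv_mul volume
      measurableSet_rulDom (fun u hu => (hA hu).hasFDerivWithinAt) injOn_ruling]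
    refine setLIntegral_congr_fun measurableSet_rulDom fun u hu => ?_
    simp only [hdet hu, toLp_ruling]
  rw [h1, h2, ← lintegral_indicator measurableSet_rulDom, lintegral_fin_three]
  · rw [← lintegral_indicator measurableSet_Ioo]
    refine lintegral_congr fun x => ?_
    by_cases hx : x ∈ Set.Ioo 0 (π / 2)
    · rw [Set.indicator_of_mem hx, ← lintegral_indicator measurableSet_Ioo]
      refine lintegral_congr fun l => ?_
      by_cases hl : l ∈ Set.Ioo (0 : ℝ) 1
      · rw [Set.indicator_of_mem hl, ← lintegral_const_mul', ← lintegral_indicator measurableSet_Ioi]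
        · refine lintegral_congr fun s => ?_
          by_cases hs : 0 < s
          · rw [Set.indicator_of_mem (show ![x, l, s] ∈ rulDom from ⟨hx, hl, hs⟩),
              Set.indicator_of_mem (show s ∈ Set.Ioi 0 from hs)]
            simp only [Matrix.cons_val]
            rw [ENNReal.ofReal_mul (by positivity), mul_comm (ENNReal.ofReal (s ^ 2)), mul_assoc]
          · rw [Set.indicator_of_notMem (fun h => hs h.2.2),
              Set.indicator_of_notMem (show s ∉ Set.Ioi 0 from hs)]
        · exact ENNReal.ofReal_ne_top
      · rw [Set.indicator_of_notMem hl]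
        simp only [Set.indicator_of_notMem (fun h : ![x, l, _] ∈ rulDom => hl h.2.1),
          lintegral_zero]
    · rw [Set.indicator_of_notMem hx]
      simp only [Set.indicator_of_notMem (fun h : ![x, _, _] ∈ rulDom => hx h.1), lintegral_zero]
  · have h01 : Measurable fun u : Fin 3 → ℝ => (u 0, u 1) :=
      (measurable_pi_apply (0 : Fin 3)).prodMk (measurable_pi_apply (1 : Fin 3))
    refine Measurable.indicator (Measurable.mul ?_ ?_) measurableSet_rulDom
    · have := continuous_jac.measurable.comp h01
      exact (((measurable_pi_apply (2 : Fin 3)).pow_const 2).mul this).ennreal_ofReal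
    · have := measurable_rulPt.comp h01
      exact (measurable_one.indicator hC).comp ((measurable_pi_apply (2 : Fin 3)).smul this)

theorem zero_mem_oloid : (0 : EuclideanSpace ℝ (Fin 3)) ∈ oloid := by
  have h : ∀ e : ℝ, e ^ 2 = 3 / 4 → !₂[e, 0, 0] ∈ oloid := fun e he =>
    subset_convexHull _ _ (Or.inl ⟨by simp [he]; norm_num, by simp⟩)
  have h1 : (√3 / 2) ^ 2 = 3 / 4 := by
    rw [div_pow, sqrt_three_sq]
    norm_num
  have := convex_oloid (h _ h1) (h (-(√3 / 2)) (by rw [neg_sq, h1]))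
    (show (0 : ℝ) ≤ 1 / 2 by norm_num) (show (0 : ℝ) ≤ 1 / 2 by norm_num) (by norm_num)
  convert this using 1
  ext i
  fin_cases i <;> simp

theorem continuous_nrm : Continuous nrm := by
  have hd := continuous_dl
  unfold nrm
  refine (PiLp.continuous_toLp 2 _).comp (continuous_pi fun i => ?_)
  fin_cases i <;> simp <;> fun_prop

theorem rulPt_add_smul_mem {x l : ℝ} (hx : x ∈ Set.Ioo 0 (π / 2)) (hl : l ∈ Set.Ioo (0 : ℝ) 1)
    {d : EuclideanSpace ℝ (Fin 3)} (hd : inner ℝ d (nrm x) < 0) :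
    ∀ᶠ t in nhdsWithin (0 : ℝ) (Set.Ioi 0), rulPt x l + t • d ∈ oloid := by
  have hS : {x' | x' ∈ Set.Ioo 0 (π / 2) ∧ inner ℝ d (nrm x') < 0} ∈ nhds x := by
    refine Filter.inter_mem (Ioo_mem_nhds hx.1 hx.2) ?_
    have : Continuous fun x' => inner ℝ d (nrm x') := continuous_const.inner continuous_nrm
    exact this.continuousAt.eventually_lt continuousAt_const hd
  obtain ⟨ε, hε, hball⟩ := Metric.nhds_basis_closedBall.mem_iff.1 hS
  have hmem : ∀ x', x - ε ≤ x' → x' ≤ x + ε →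
      x' ∈ Set.Ioo 0 (π / 2) ∧ inner ℝ d (nrm x') < 0 := fun x' h1 h2 =>
    hball (by rw [Metric.mem_closedBall, Real.dist_eq, abs_le]; constructor <;> linarith)
  have ha := (hmem (x - ε) le_rfl (by linarith)).1
  have hb := (hmem (x + ε) (by linarith) le_rfl).1
  set X := rulPt x l with hX
  have hXW : 0 < X 0 ∧ 0 < X 2 := by
    simp only [hX, rulPt, Matrix.cons_val]
    exact ⟨mul_pos (sub_pos.2 hl.2) (rulA_pos hx), mul_pos hl.1 (rulB_pos hx)⟩
  have hXs : X 0 * slopeA x + X 2 * slopeB x = X 1 := by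
    simp only [hX, rulPt, Matrix.cons_val]
    ring
  have hmono := strictMonoOn_slope hXW.1 hXW.2
  have h1 := hmono ha hx (by linarith)
  have h2 := hmono hx hb (by linarith)
  simp only [hXs] at h1 h2
  have hev : ∀ᶠ t in nhds (0 : ℝ), 0 < (X + t • d) 0 ∧ 0 < (X + t • d) 2 ∧
      (X + t • d) 0 * slopeA (x - ε) + (X + t • d) 2 * slopeB (x - ε) < (X + t • d) 1 ∧
      (X + t • d) 1 < (X + t • d) 0 * slopeA (x + ε) + (X + t • d) 2 * slopeB (x + ε) := by
    refine Filter.Eventually.and ?_ (Filter.Eventually.and ?_ (Filter.Eventually.and ?_ ?_)) <;>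
    refine ContinuousAt.eventually_lt (by fun_prop) (by fun_prop) ?_
    · simpa using hXW.1
    · simpa using hXW.2
    · simpa using h1
    · simpa using h2
  filter_upwards [nhdsWithin_le_nhds hev, self_mem_nhdsWithin] with t ⟨ht0, ht2, hta, htb⟩ ht
  obtain ⟨u, hu, huy⟩ : WithLp.ofLp (X + t • d) ∈ ruling '' rulDom := by
    rw [image_ruling]
    exact ⟨ht0, ht2⟩
  have hus := ruling_slope u
  rw [huy] at hus
  have hm := strictMonoOn_slope ht0 ht2
  have hua : x - ε < u 0 := (hm.lt_iff_lt ha hu.1).1 (by simpa only [hus] using hta)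
  have hub : u 0 < x + ε := (hm.lt_iff_lt hu.1 hb).1 (by simpa only [hus] using htb)
  have hn := (hmem _ hua.le hub.le).2
  have hy : X + t • d = u 2 • rulPt (u 0) (u 1) := by
    rw [← toLp_ruling, huy]
  have hXn := isSupport_oloid.le X (rulPt_mem hx ⟨hl.1.le, hl.2.le⟩) (nrm (u 0))
  have hyn := congrArg (fun z => inner ℝ z (nrm (u 0))) hy
  simp only [inner_add_left, inner_smul_left, inner_rulPt_nrm hu.1, conj_trivial] at hyn
  rw [suppO_nrm] at hXn
  have hdl := dl_pos (u 0)
  have htn := mul_neg_of_pos_of_neg (show 0 < t from ht) hn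
  have hs : u 2 ≤ 1 := by
    by_contra! hlt
    nlinarith [mul_lt_mul_of_pos_right hlt (show 0 < 1 / 2 + dl (u 0) ^ 2 by positivity)]
  rw [hy]
  exact convex_oloid.smul_mem_of_zero_mem zero_mem_oloid
    (rulPt_mem hu.1 ⟨hu.2.1.1.le, hu.2.1.2.le⟩) ⟨hu.2.2.le, hs⟩

/-- The cubic radial moment of `C` in the direction of a ruling point. -/
def radial (C : Set (EuclideanSpace ℝ (Fin 3))) (q : ℝ × ℝ) : ENNReal :=
  ∫⁻ s in Set.Ioi (0 : ℝ), ENNReal.ofReal (s ^ 2) * C.indicator 1 (s • rulPt q.1 q.2)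

theorem measurable_radial {C : Set (EuclideanSpace ℝ (Fin 3))} (hC : MeasurableSet C) :
    Measurable (radial C) := by
  unfold radial
  refine Measurable.lintegral_prod_right' (ν := volume.restrict (Set.Ioi (0 : ℝ)))
    (f := fun p : (ℝ × ℝ) × ℝ =>
      ENNReal.ofReal (p.2 ^ 2) * C.indicator 1 (p.2 • rulPt p.1.1 p.1.2)) ?_
  have h1 : Measurable fun p : (ℝ × ℝ) × ℝ => p.1 := measurable_fst
  have h := measurable_rulPt.comp h1
  exact ((measurable_snd.pow_const 2).ennreal_ofReal).mul
    ((measurable_one.indicator hC).comp (measurable_snd.smul h))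

theorem lintegral_Ioc_sq {R : ℝ} (hR : 0 ≤ R) :
    ∫⁻ s in Set.Ioc 0 R, ENNReal.ofReal (s ^ 2) = ENNReal.ofReal (R ^ 3 / 3) := by
  rw [← ofReal_integral_eq_lintegral_ofReal]
  · rw [← intervalIntegral.integral_of_le hR, integral_pow]
    norm_num
  · exact (continuous_pow 2).integrableOn_Ioc
  · exact Filter.Eventually.of_forall fun s => sq_nonneg s

theorem radial_le {C : Set (EuclideanSpace ℝ (Fin 3))} {q : ℝ × ℝ} {R : ℝ} (hR : 0 ≤ R)
    (h : ∀ s, 0 < s → s • rulPt q.1 q.2 ∈ C → s ≤ R) :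
    radial C q ≤ ENNReal.ofReal (R ^ 3 / 3) := by
  rw [radial, ← lintegral_Ioc_sq hR, ← lintegral_indicator measurableSet_Ioi,
    ← lintegral_indicator measurableSet_Ioc]
  refine lintegral_mono fun s => ?_
  by_cases hs : 0 < s
  · rw [Set.indicator_of_mem (show s ∈ Set.Ioi 0 from hs)]
    by_cases hsC : s • rulPt q.1 q.2 ∈ C
    · rw [Set.indicator_of_mem (show s ∈ Set.Ioc 0 R from ⟨hs, h s hs hsC⟩),
        Set.indicator_of_mem hsC]
      simp
    · simp [Set.indicator_of_notMem hsC]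
  · simp [Set.indicator_of_notMem (show s ∉ Set.Ioi 0 from hs)]

theorem le_radial {C : Set (EuclideanSpace ℝ (Fin 3))} (hC : Convex ℝ C) (h0 : 0 ∈ C)
    {q : ℝ × ℝ} {R : ℝ} (hR : 0 < R) (h : R • rulPt q.1 q.2 ∈ C) :
    ENNReal.ofReal (R ^ 3 / 3) ≤ radial C q := by
  rw [radial, ← lintegral_Ioc_sq hR.le, ← lintegral_indicator measurableSet_Ioi,
    ← lintegral_indicator measurableSet_Ioc]
  refine lintegral_mono fun s => ?_
  by_cases hs : s ∈ Set.Ioc 0 R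
  · have hsC : s • rulPt q.1 q.2 ∈ C := by
      have := hC.smul_mem_of_zero_mem h0 h (t := s / R)
        ⟨div_nonneg hs.1.le hR.le, (div_le_one hR).2 hs.2⟩
      rwa [smul_smul, div_mul_cancel₀ _ hR.ne'] at this
    rw [Set.indicator_of_mem hs, Set.indicator_of_mem (show s ∈ Set.Ioi 0 from hs.1),
      Set.indicator_of_mem hsC]
    simp
  · simp [Set.indicator_of_notMem hs]

section Deriv

variable {L : Set (EuclideanSpace ℝ (Fin 3))} {HL : EuclideanSpace ℝ (Fin 3) → ℝ}

/-- The ratio of support functions in the normal direction of the ruling with parameter `x`. -/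
def suppRatio (HL : EuclideanSpace ℝ (Fin 3) → ℝ) (x : ℝ) : ℝ := HL (nrm x) / (1 / 2 + dl x ^ 2)

theorem radial_add_smul_le (hL : IsSupport L HL) (h0 : 0 ∈ L) {t : ℝ} (ht : 0 ≤ t) {q : ℝ × ℝ}
    (hx : q.1 ∈ Set.Ioo 0 (π / 2)) :
    radial (oloid + t • L) q ≤ ENNReal.ofReal ((1 + t * suppRatio HL q.1) ^ 3 / 3) := by
  have hdl := dl_pos q.1
  have hp : 0 < 1 / 2 + dl q.1 ^ 2 := by positivity
  have hn : 0 ≤ HL (nrm q.1) := by simpa using hL.le 0 h0 (nrm q.1)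
  refine radial_le (by unfold suppRatio; positivity) fun s _ hs => ?_
  have := (isSupport_oloid.add_smul hL ht).le _ hs (nrm q.1)
  rw [inner_smul_left, inner_rulPt_nrm hx, suppO_nrm, conj_trivial] at this
  rw [suppRatio, ← mul_le_mul_iff_of_pos_right hp]
  refine this.trans_eq ?_
  field_simp

theorem zero_mem_add_smul (h0 : 0 ∈ L) (t : ℝ) : 0 ∈ oloid + t • L :=
  ⟨0, zero_mem_oloid, 0, ⟨0, h0, smul_zero t⟩, add_zero 0⟩

theorem one_third_le_radial (hLc : Convex ℝ L) (h0 : 0 ∈ L) (t : ℝ) {q : ℝ × ℝ}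
    (hx : q.1 ∈ Set.Ioo 0 (π / 2)) (hl : q.2 ∈ Set.Ioo (0 : ℝ) 1) :
    ENNReal.ofReal (1 / 3) ≤ radial (oloid + t • L) q := by
  have := le_radial (convex_oloid.add (hLc.smul t)) (zero_mem_add_smul h0 t) (q := q) one_pos
    ⟨_, rulPt_mem hx ⟨hl.1.le, hl.2.le⟩, 0, ⟨0, h0, smul_zero t⟩, by simp⟩
  simpa using this

theorem eventually_le_radial (hL : IsSupport L HL) (hLc : Convex ℝ L) (h0 : 0 ∈ L)
    {q : ℝ × ℝ} (hx : q.1 ∈ Set.Ioo 0 (π / 2)) (hl : q.2 ∈ Set.Ioo (0 : ℝ) 1) {c : ℝ} (hc : 0 ≤ c)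
    (hcq : c < suppRatio HL q.1) : ∀ᶠ t in nhdsWithin (0 : ℝ) (Set.Ioi 0),
      ENNReal.ofReal ((1 + t * c) ^ 3 / 3) ≤ radial (oloid + t • L) q := by
  have hdl := dl_pos q.1
  have hp : 0 < 1 / 2 + dl q.1 ^ 2 := by positivity
  obtain ⟨y, hy, hyn⟩ := hL.attained (nrm q.1)
  have hd : inner ℝ (c • rulPt q.1 q.2 - y) (nrm q.1) < 0 := by
    rw [inner_sub_left, inner_smul_left, inner_rulPt_nrm hx, hyn, conj_trivial]
    rw [suppRatio, lt_div_iff₀ hp] at hcq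
    linarith
  filter_upwards [rulPt_add_smul_mem hx hl hd, self_mem_nhdsWithin] with t ht ht0
  have ht0 : 0 < t := ht0
  refine le_radial (convex_oloid.add (hLc.smul t)) (zero_mem_add_smul h0 t) (by positivity) ?_
  refine ⟨_, ht, t • y, ⟨y, hy, rfl⟩, ?_⟩
  simp only
  module

end Deriv

/-- The parameter domain of the rulings in the open wedge. -/
def rulParam : Set (ℝ × ℝ) := Set.Ioo 0 (π / 2) ×ˢ Set.Ioo (0 : ℝ) 1

theorem measurableSet_rulParam : MeasurableSet rulParam := measurableSet_Ioo.prod measurableSet_Ioo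

theorem jac_mul_integrableOn {f : ℝ × ℝ → ℝ} (hf : AEStronglyMeasurable f (volume.restrict rulParam))
    {B : ℝ} (hB : ∀ q ∈ rulParam, |f q| ≤ B) :
    IntegrableOn (fun q => jac q.1 q.2 * f q) rulParam := by
  have hK : IsCompact (Set.Icc 0 (π / 2) ×ˢ Set.Icc (0 : ℝ) 1) := isCompact_Icc.prod isCompact_Icc
  have hj : IntegrableOn (fun q : ℝ × ℝ => jac q.1 q.2) rulParam :=
    (continuous_jac.continuousOn.integrableOn_compact hK).mono_set
      (Set.prod_mono Set.Ioo_subset_Icc_self Set.Ioo_subset_Icc_self)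
  refine hj.mul_bdd hf (c := B) ?_
  filter_upwards [ae_restrict_mem measurableSet_rulParam] with q hq using hB q hq

theorem volume_inter_wedge_eq_lintegral {C : Set (EuclideanSpace ℝ (Fin 3))}
    (hC : MeasurableSet C) : volume (C ∩ wedge) =
      ∫⁻ q in rulParam, ENNReal.ofReal (jac q.1 q.2) * radial C q := by
  rw [volume_inter_wedge hC, rulParam, Measure.volume_eq_prod, ← Measure.prod_restrict,
    lintegral_prod]
  · rfl
  · exact (continuous_jac.measurable.ennreal_ofReal.mul (measurable_radial hC)).aemeasurable

theorem tendsto_cubic_difference_quotient {φ : ℝ → ℝ} {q : ℝ} (h1 : ∀ t, 0 < t → 1 / 3 ≤ φ t)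
    (h2 : ∀ t, 0 < t → φ t ≤ (1 + t * q) ^ 3 / 3)
    (h3 : ∀ c, 0 ≤ c → c < q → ∀ᶠ t in nhdsWithin (0 : ℝ) (Set.Ioi 0),
      (1 + t * c) ^ 3 / 3 ≤ φ t) :
    Filter.Tendsto (fun t => (φ t - 1 / 3) / t) (nhdsWithin 0 (Set.Ioi 0)) (nhds q) := by
  refine tendsto_order.2 ⟨fun a ha => ?_, fun b hb => ?_⟩
  · rcases lt_or_ge a 0 with h | h
    · filter_upwards [self_mem_nhdsWithin] with t ht
      exact h.trans_le (div_nonneg (sub_nonneg.2 (h1 t ht)) (le_of_lt ht))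
    · filter_upwards [self_mem_nhdsWithin, h3 ((a + q) / 2) (by linarith) (by linarith)] with t ht h4
      have ht : 0 < t := ht
      rw [lt_div_iff₀ ht]
      have hc : 0 ≤ t * ((a + q) / 2) := mul_nonneg ht.le (by linarith)
      have h5 : a * t < t * ((a + q) / 2) := by
        rw [mul_comm a]
        exact mul_lt_mul_of_pos_left (by linarith) ht
      nlinarith [pow_nonneg hc 2, pow_nonneg hc 3]
  · have hcont : Continuous fun t : ℝ => q + t * q ^ 2 + t ^ 2 * q ^ 3 / 3 := by fun_prop
    have hlt : ∀ᶠ t in nhds (0 : ℝ), q + t * q ^ 2 + t ^ 2 * q ^ 3 / 3 < b :=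
      hcont.continuousAt.eventually_lt continuousAt_const (by simpa using hb)
    filter_upwards [self_mem_nhdsWithin, nhdsWithin_le_nhds hlt] with t ht h4
    have ht : 0 < t := ht
    refine lt_of_le_of_lt ?_ h4
    rw [div_le_iff₀ ht]
    have := h2 t ht
    linarith [this, show (q + t * q ^ 2 + t ^ 2 * q ^ 3 / 3) * t = (1 + t * q) ^ 3 / 3 - 1 / 3 by ring]

section Deriv

variable {L : Set (EuclideanSpace ℝ (Fin 3))} {HL : EuclideanSpace ℝ (Fin 3) → ℝ}

theorem continuous_suppRatio (hH : Continuous HL) : Continuous (suppRatio HL) := by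
  have hd := continuous_dl
  unfold suppRatio
  refine (hH.comp continuous_nrm).div (by fun_prop) fun x => ?_
  have := dl_pos x
  positivity

theorem isCompact_oloid_add_smul (hLk : IsCompact L) (t : ℝ) : IsCompact (oloid + t • L) :=
  isCompact_oloid.add (hLk.smul t)

theorem suppRatio_nonneg (hL : IsSupport L HL) (h0 : 0 ∈ L) (x : ℝ) : 0 ≤ suppRatio HL x :=
  div_nonneg (by simpa using hL.le 0 h0 (nrm x)) (by positivity)

theorem toReal_radial_le (hL : IsSupport L HL) (h0 : 0 ∈ L) {t : ℝ} (ht : 0 ≤ t) {q : ℝ × ℝ}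
    (hq : q ∈ rulParam) :
    (radial (oloid + t • L) q).toReal ≤ (1 + t * suppRatio HL q.1) ^ 3 / 3 := by
  have := suppRatio_nonneg hL h0 q.1
  exact ENNReal.toReal_le_of_le_ofReal (by positivity) (radial_add_smul_le hL h0 ht hq.1)

theorem radial_ne_top (hL : IsSupport L HL) (h0 : 0 ∈ L) {t : ℝ} (ht : 0 ≤ t) {q : ℝ × ℝ}
    (hq : q ∈ rulParam) : radial (oloid + t • L) q ≠ ⊤ :=
  ((radial_add_smul_le hL h0 ht hq.1).trans_lt ENNReal.ofReal_lt_top).ne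

theorem one_third_le_toReal_radial (hL : IsSupport L HL) (hLc : Convex ℝ L) (h0 : 0 ∈ L) {t : ℝ}
    (ht : 0 ≤ t) {q : ℝ × ℝ} (hq : q ∈ rulParam) : 1 / 3 ≤ (radial (oloid + t • L) q).toReal :=
  (ENNReal.ofReal_le_iff_le_toReal (radial_ne_top hL h0 ht hq)).1
    (one_third_le_radial hLc h0 t hq.1 hq.2)

theorem volume_real_inter_wedge (hL : IsSupport L HL) (hLk : IsCompact L) (h0 : 0 ∈ L) {t : ℝ}
    (ht : 0 ≤ t) : volume.real ((oloid + t • L) ∩ wedge) =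
      ∫ q in rulParam, jac q.1 q.2 * (radial (oloid + t • L) q).toReal := by
  have hm := (isCompact_oloid_add_smul hLk t).measurableSet
  rw [Measure.real, volume_inter_wedge_eq_lintegral hm, ← integral_toReal]
  · refine setIntegral_congr_fun measurableSet_rulParam fun q hq => ?_
    simp only [ENNReal.toReal_mul]
    rw [ENNReal.toReal_ofReal (jac_pos hq.1 hq.2).le]
  · exact (continuous_jac.measurable.ennreal_ofReal.mul (measurable_radial hm)).aemeasurable
  · filter_upwards [ae_restrict_mem measurableSet_rulParam] with q hq
    exact ENNReal.mul_lt_top ENNReal.ofReal_lt_top (radial_ne_top hL h0 ht hq).lt_top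

theorem volume_real_oloid_inter_wedge :
    volume.real (oloid ∩ wedge) = ∫ q in rulParam, jac q.1 q.2 * (1 / 3) := by
  have h := volume_real_inter_wedge isSupport_oloid isCompact_oloid zero_mem_oloid le_rfl
  have h0 : oloid + (0 : ℝ) • oloid = oloid := by
    rw [Set.zero_smul_set ⟨0, zero_mem_oloid⟩, add_zero]
  rw [h0] at h
  rw [h]
  refine setIntegral_congr_fun measurableSet_rulParam fun q hq => ?_
  have h1 := toReal_radial_le isSupport_oloid zero_mem_oloid le_rfl hq
  have h2 := one_third_le_toReal_radial isSupport_oloid convex_oloid zero_mem_oloid le_rfl hq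
  rw [h0] at h1 h2
  rw [le_antisymm (h1.trans_eq (by norm_num)) h2]

theorem tendsto_volume_inter_wedge (hL : IsSupport L HL) (hH : Continuous HL) (hLc : Convex ℝ L)
    (hLk : IsCompact L) (h0 : 0 ∈ L) :
    Filter.Tendsto (fun t => (volume.real ((oloid + t • L) ∩ wedge) -
      volume.real (oloid ∩ wedge)) / t) (nhdsWithin 0 (Set.Ioi 0))
      (nhds (∫ q in rulParam, jac q.1 q.2 * suppRatio HL q.1)) := by
  obtain ⟨Q, hQ⟩ := isCompact_Icc.exists_bound_of_continuousOn
    (continuous_suppRatio hH).continuousOn (s := Set.Icc 0 (π / 2))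
  have hQ' : ∀ q ∈ rulParam, suppRatio HL q.1 ≤ Q := fun q hq =>
    (le_abs_self _).trans (hQ _ (Set.Ioo_subset_Icc_self hq.1))
  have hm := fun t => (measurable_radial (isCompact_oloid_add_smul hLk t).measurableSet).ennreal_toReal
  have h_int : ∀ t : ℝ, 0 ≤ t → IntegrableOn
      (fun q : ℝ × ℝ => jac q.1 q.2 * (radial (oloid + t • L) q).toReal) rulParam := fun t ht => by
    refine jac_mul_integrableOn (hm t).aestronglyMeasurable (B := (1 + t * Q) ^ 3 / 3) fun q hq => ?_
    have := suppRatio_nonneg hL h0 q.1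
    rw [abs_of_nonneg ENNReal.toReal_nonneg]
    refine (toReal_radial_le hL h0 ht hq).trans ?_
    gcongr
    exact hQ' q hq
  have integrable_third : IntegrableOn (fun q : ℝ × ℝ => jac q.1 q.2 * (1 / 3)) rulParam :=
    jac_mul_integrableOn aestronglyMeasurable_const (B := |1 / 3|) fun _ _ => le_rfl
  have key : Filter.Tendsto (fun t => ∫ q in rulParam,
      jac q.1 q.2 * (((radial (oloid + t • L) q).toReal - 1 / 3) / t)) (nhdsWithin 0 (Set.Ioi 0))
      (nhds (∫ q in rulParam, jac q.1 q.2 * suppRatio HL q.1)) := by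
    refine tendsto_integral_filter_of_dominated_convergence
      (fun q => jac q.1 q.2 * (Q + Q ^ 2 + Q ^ 3 / 3)) ?_ ?_ ?_ ?_
    · exact Filter.Eventually.of_forall fun t => (continuous_jac.measurable.mul
        (((hm t).sub_const _).div_const _)).aestronglyMeasurable
    · filter_upwards [self_mem_nhdsWithin, nhdsWithin_le_nhds (Iic_mem_nhds one_pos)] with t ht ht1
      have ht : 0 < t := ht
      have ht1 : t ≤ 1 := ht1
      filter_upwards [ae_restrict_mem measurableSet_rulParam] with q hq
      have h1 := toReal_radial_le hL h0 ht.le hq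
      have h2 := one_third_le_toReal_radial hL hLc h0 ht.le hq
      have h3 := hQ' q hq
      have h4 := suppRatio_nonneg hL h0 q.1
      have h5 : (1 + t * suppRatio HL q.1) ^ 3 / 3 ≤ (1 + t * Q) ^ 3 / 3 := by gcongr
      have hQ0 := h4.trans h3
      rw [norm_mul, Real.norm_of_nonneg (jac_pos hq.1 hq.2).le,
        Real.norm_of_nonneg (div_nonneg (sub_nonneg.2 h2) ht.le)]
      refine mul_le_mul_of_nonneg_left ?_ (jac_pos hq.1 hq.2).le
      rw [div_le_iff₀ ht]
      have h6 : t ^ 2 * Q ^ 2 ≤ t * Q ^ 2 :=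
        mul_le_mul_of_nonneg_right (by nlinarith) (by positivity)
      have h7 : t ^ 3 * Q ^ 3 ≤ t * Q ^ 3 :=
        mul_le_mul_of_nonneg_right (by nlinarith [mul_nonneg ht.le ht.le]) (by positivity)
      linarith [h1.trans h5,
        show (1 + t * Q) ^ 3 / 3 = 1 / 3 + t * Q + t ^ 2 * Q ^ 2 + t ^ 3 * Q ^ 3 / 3 by ring]
    · exact jac_mul_integrableOn aestronglyMeasurable_const (B := |Q + Q ^ 2 + Q ^ 3 / 3|)
        fun _ _ => le_rfl
    · filter_upwards [ae_restrict_mem measurableSet_rulParam] with q hq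
      refine (tendsto_cubic_difference_quotient
        (fun t ht => one_third_le_toReal_radial hL hLc h0 ht.le hq)
        (fun t ht => toReal_radial_le hL h0 ht.le hq) fun c hc hcq => ?_).const_mul _
      filter_upwards [eventually_le_radial hL hLc h0 hq.1 hq.2 hc hcq, self_mem_nhdsWithin]
        with t h ht
      exact (ENNReal.ofReal_le_iff_le_toReal (radial_ne_top hL h0 (le_of_lt ht) hq)).1 h
  refine key.congr' ?_
  filter_upwards [self_mem_nhdsWithin] with t ht
  rw [volume_real_inter_wedge hL hLk h0 (le_of_lt ht), volume_real_oloid_inter_wedge,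
    ← integral_sub (h_int t (le_of_lt ht)) integrable_third, ← integral_div]
  congr 1
  ext q
  ring

end Deriv

/-- The weight of the ruling with parameter `x`. -/
def rulWeight (x : ℝ) : ℝ := (1 / 2 + dl x ^ 2) ^ 2 / (2 * dl x ^ 3)

theorem integral_jac (x : ℝ) : ∫ l in Set.Ioo (0 : ℝ) 1, jac x l = rulWeight x := by
  have hd := dl_sq x
  have h2 := sin_sq_add_cos_sq x
  rw [← integral_Ioc_eq_integral_Ioo, ← intervalIntegral.integral_of_le zero_le_one]
  have : ∀ l, jac x l = (1 / 2 + dl x ^ 2) / (2 * dl x ^ 3) *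
      (3 * cos x ^ 2 + l * (3 / 2 * sin x ^ 2 - 3 * cos x ^ 2)) := fun l => by unfold jac; ring
  simp only [this]
  rw [intervalIntegral.integral_const_mul, intervalIntegral.integral_add (by simp)
    (Continuous.intervalIntegrable (by fun_prop) _ _), intervalIntegral.integral_const,
    intervalIntegral.integral_mul_const, integral_id, rulWeight]
  have h3 : 1 / 2 + dl x ^ 2 = 3 / 2 * cos x ^ 2 + 3 / 4 * sin x ^ 2 := by
    rw [hd]
    linear_combination 3 / 2 * (-h2)
  rw [sq (1 / 2 + dl x ^ 2)]
  nth_rw 3 [h3]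
  simp only [smul_eq_mul]
  ring

theorem integral_jac_mul {f : ℝ → ℝ} (hf : Continuous f) :
    ∫ q in rulParam, jac q.1 q.2 * f q.1 = ∫ x in (0 : ℝ)..(π / 2), f x * rulWeight x := by
  obtain ⟨B, hB⟩ := isCompact_Icc.exists_bound_of_continuousOn hf.continuousOn
    (s := Set.Icc 0 (π / 2))
  have h_int := jac_mul_integrableOn (f := fun q => f q.1)
    (hf.measurable.comp measurable_fst).aestronglyMeasurable
    (B := B) fun q hq => hB _ (Set.Ioo_subset_Icc_self hq.1)
  rw [rulParam, Measure.volume_eq_prod] at h_int ⊢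
  rw [setIntegral_prod _ h_int, intervalIntegral.integral_of_le (by positivity),
    integral_Ioc_eq_integral_Ioo]
  refine setIntegral_congr_fun measurableSet_Ioo fun x _ => ?_
  simp only
  rw [integral_mul_const, integral_jac, mul_comm]

theorem volume_image_isometry (T : EuclideanSpace ℝ (Fin 3) ≃ₗᵢ[ℝ] EuclideanSpace ℝ (Fin 3))
    (C : Set (EuclideanSpace ℝ (Fin 3))) : volume (T '' C) = volume C := by
  rw [congrFun (Set.image_eq_preimage_of_inverse T.symm_apply_apply T.apply_symm_apply) C]
  exact (show MeasurePreserving T.symm.toHomeomorph.toMeasurableEquiv volume volume from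
    T.symm.measurePreserving).measure_preimage_equiv C

/-- The reflection of `ℝ³` in the coordinate plane orthogonal to the `i`-th axis. -/
def mirror (i : Fin 3) : EuclideanSpace ℝ (Fin 3) ≃ₗᵢ[ℝ] EuclideanSpace ℝ (Fin 3) :=
  LinearIsometryEquiv.piLpCongrRight 2 fun j =>
    if j = i then LinearIsometryEquiv.neg ℝ else LinearIsometryEquiv.refl ℝ ℝ

theorem mirror_apply (i : Fin 3) (u : EuclideanSpace ℝ (Fin 3)) (j : Fin 3) :
    mirror i u j = if j = i then -u j else u j := by
  simp only [mirror, LinearIsometryEquiv.piLpCongrRight_apply]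
  split <;> rfl

theorem mirror_mirror (i : Fin 3) (u : EuclideanSpace ℝ (Fin 3)) : mirror i (mirror i u) = u := by
  ext j
  simp only [mirror_apply]
  split <;> simp

theorem mirror_image_eq_preimage (i : Fin 3) (C : Set (EuclideanSpace ℝ (Fin 3))) :
    mirror i '' C = mirror i ⁻¹' C :=
  congrFun (Set.image_eq_preimage_of_inverse (mirror_mirror i) (mirror_mirror i)) C

theorem mirror_image_oloid {i : Fin 3} (hi : i = 0 ∨ i = 2) : mirror i '' oloid = oloid := by
  have h : mirror i '' (kA ∪ kB) = kA ∪ kB := by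
    rw [mirror_image_eq_preimage]
    ext p
    rcases hi with rfl | rfl <;> simp [kA, kB, mirror_apply]
  rw [oloid]
  refine ((mirror i).toLinearEquiv.toLinearMap.image_convexHull _).trans ?_
  exact congrArg _ h

theorem volume_coordPlane (i : Fin 3) : volume {y : EuclideanSpace ℝ (Fin 3) | y i = 0} = 0 := by
  refine Measure.addHaar_submodule volume
    (LinearMap.ker (EuclideanSpace.proj i : EuclideanSpace ℝ (Fin 3) →L[ℝ] ℝ).toLinearMap) ?_
  intro h
  have : EuclideanSpace.single i (1 : ℝ) ∈ LinearMap.ker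
      (EuclideanSpace.proj i : EuclideanSpace ℝ (Fin 3) →L[ℝ] ℝ).toLinearMap := by
    rw [h]
    trivial
  simp at this

theorem volume_real_eq_add_mirror {C : Set (EuclideanSpace ℝ (Fin 3))} (hC : volume C ≠ ⊤)
    (i : Fin 3) : volume.real C =
      volume.real (C ∩ {y | 0 < y i}) + volume.real (mirror i '' C ∩ {y | 0 < y i}) := by
  have hm : MeasurableSet {y : EuclideanSpace ℝ (Fin 3) | 0 < y i} :=
    measurableSet_lt measurable_const (by fun_prop)
  rw [← measureReal_inter_add_sdiff hm hC]
  congr 1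
  have h1 : mirror i '' C ∩ {y | 0 < y i} = mirror i '' (C ∩ {y | y i < 0}) := by
    rw [mirror_image_eq_preimage, mirror_image_eq_preimage]
    ext y
    simp [mirror_apply]
  have h2 : volume.real (mirror i '' (C ∩ {y | y i < 0})) = volume.real (C ∩ {y | y i < 0}) := by
    rw [Measure.real, volume_image_isometry, Measure.real]
  rw [h1, h2]
  refine measureReal_congr ?_
  filter_upwards [measure_eq_zero_iff_ae_notMem.1 (volume_coordPlane i)] with y hy
  have hy : y i ≠ 0 := hy
  refine propext (and_congr_right fun _ => ?_)
  exact ⟨fun h => lt_of_le_of_ne (not_lt.1 h) hy, fun h h' => lt_asymm (show y i < 0 from h) h'⟩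

/-- The four symmetries of the oloid generated by the mirrors in its planes of symmetry. -/
def oloidSymm : Fin 4 → EuclideanSpace ℝ (Fin 3) ≃ₗᵢ[ℝ] EuclideanSpace ℝ (Fin 3) :=
  ![LinearIsometryEquiv.refl ℝ _, mirror 2, mirror 0, (mirror 0).trans (mirror 2)]

theorem volume_real_eq_sum_wedge {C : Set (EuclideanSpace ℝ (Fin 3))} (hC : volume C ≠ ⊤) :
    volume.real C = ∑ j, volume.real (oloidSymm j '' C ∩ wedge) := by
  have hw : wedge = {y | 0 < y 0} ∩ {y | 0 < y 2} := rfl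
  have hfin : ∀ D : Set (EuclideanSpace ℝ (Fin 3)), volume D ≠ ⊤ →
      volume (D ∩ {y | 0 < y 0}) ≠ ⊤ := fun D hD => measure_ne_top_of_subset Set.inter_subset_left hD
  have himg : volume (mirror 0 '' C) ≠ ⊤ := by
    rwa [volume_image_isometry]
  have h2 : ∀ D : Set (EuclideanSpace ℝ (Fin 3)),
      mirror 2 '' (D ∩ {y | 0 < y 0}) = mirror 2 '' D ∩ {y | 0 < y 0} := fun D => by
    rw [mirror_image_eq_preimage, mirror_image_eq_preimage]
    ext y
    simp [mirror_apply]
  rw [volume_real_eq_add_mirror hC 0, volume_real_eq_add_mirror (hfin _ hC) 2,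
    volume_real_eq_add_mirror (hfin _ himg) 2, h2, h2, Fin.sum_univ_four]
  simp only [oloidSymm, Matrix.cons_val, LinearIsometryEquiv.coe_refl, Set.image_id,
    LinearIsometryEquiv.coe_trans, Set.image_comp, hw, Set.inter_assoc]
  ring

theorem oloidSymm_image_oloid (j : Fin 4) : oloidSymm j '' oloid = oloid := by
  have h0 := mirror_image_oloid (Or.inl rfl)
  have h2 := mirror_image_oloid (Or.inr rfl)
  fin_cases j <;> simp [oloidSymm, Set.image_comp, h0, h2]

theorem image_add_smul (S T : EuclideanSpace ℝ (Fin 3) ≃ₗᵢ[ℝ] EuclideanSpace ℝ (Fin 3))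
    (C D : Set (EuclideanSpace ℝ (Fin 3))) (t : ℝ) :
    S '' (C + t • (T '' D)) = S '' C + t • ((T.trans S) '' D) := by
  rw [Set.image_add, LinearIsometryEquiv.coe_trans, Set.image_comp]
  congr 1
  exact Set.image_smul_comm _ _ _ fun y => map_smul S t y

/-- Three times the mixed volume `V(Ω₁, Ω₁, TΩ₁)`. -/
def mixedVol (T : EuclideanSpace ℝ (Fin 3) ≃ₗᵢ[ℝ] EuclideanSpace ℝ (Fin 3)) : ℝ :=
  ∑ j, ∫ x in (0 : ℝ)..(π / 2),
    suppRatio (fun u => suppO (T.symm ((oloidSymm j).symm u))) x * rulWeight x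

theorem volume_real_oloid_add_smul (T : EuclideanSpace ℝ (Fin 3) ≃ₗᵢ[ℝ] EuclideanSpace ℝ (Fin 3))
    (t : ℝ) : volume.real (oloid + t • (T '' oloid)) =
      ∑ j, volume.real ((oloid + t • ((T.trans (oloidSymm j)) '' oloid)) ∩ wedge) := by
  rw [volume_real_eq_sum_wedge]
  · simp only [image_add_smul, oloidSymm_image_oloid]
  · exact (isCompact_oloid_add_smul (isCompact_oloid.image T.continuous) t).measure_ne_top

theorem volume_real_oloid_eq_sum :
    volume.real oloid = ∑ _j : Fin 4, volume.real (oloid ∩ wedge) := by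
  rw [volume_real_eq_sum_wedge isCompact_oloid.measure_ne_top]
  simp only [oloidSymm_image_oloid]

theorem tendsto_volume_add_smul (T : EuclideanSpace ℝ (Fin 3) ≃ₗᵢ[ℝ] EuclideanSpace ℝ (Fin 3)) :
    Filter.Tendsto (fun t => (volume.real (oloid + t • (T '' oloid)) - volume.real oloid) / t)
      (nhdsWithin 0 (Set.Ioi 0)) (nhds (mixedVol T)) := by
  have h : ∀ j, Filter.Tendsto (fun t => (volume.real ((oloid +
      t • ((T.trans (oloidSymm j)) '' oloid)) ∩ wedge) - volume.real (oloid ∩ wedge)) / t)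
      (nhdsWithin 0 (Set.Ioi 0)) (nhds (∫ x in (0 : ℝ)..(π / 2),
        suppRatio (fun u => suppO (T.symm ((oloidSymm j).symm u))) x * rulWeight x)) := fun j => by
    have hc : Continuous fun u => suppO (T.symm ((oloidSymm j).symm u)) :=
      continuous_suppO.comp (T.symm.continuous.comp (oloidSymm j).symm.continuous)
    rw [← integral_jac_mul (continuous_suppRatio hc)]
    exact tendsto_volume_inter_wedge (isSupport_oloid.image (T.trans (oloidSymm j))) hc
      (convex_oloid.linear_image (T.trans (oloidSymm j)).toLinearEquiv.toLinearMap)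
      (isCompact_oloid.image (T.trans (oloidSymm j)).continuous)
      ⟨0, zero_mem_oloid, map_zero _⟩
  refine (tendsto_finsetSum Finset.univ fun j _ => h j).congr fun t => ?_
  rw [volume_real_oloid_add_smul, volume_real_oloid_eq_sum, ← Finset.sum_sub_distrib,
    Finset.sum_div]

/-- The linear coefficient of the volume polynomial is `mixedVol`. -/
theorem exists_volume_oloid_add_smul_eq
    (T : EuclideanSpace ℝ (Fin 3) ≃ₗᵢ[ℝ] EuclideanSpace ℝ (Fin 3)) :
    ∃ c₂ c₃ : ℝ, ∀ t : ℝ, 0 ≤ t → volume.real (oloid + t • (T '' oloid)) =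
      volume.real oloid + mixedVol T * t + c₂ * t ^ 2 + c₃ * t ^ 3 := by
  obtain ⟨c₀, c₁, c₂, c₃, h⟩ := exists_volume_oloid_add_smul_image_eq_cubic T
  have h0 : volume.real oloid = c₀ := by
    have := h 0 le_rfl
    rw [Set.zero_smul_set (Set.Nonempty.image T ⟨0, zero_mem_oloid⟩), add_zero] at this
    simpa using this
  refine ⟨c₂, c₃, fun t ht => ?_⟩
  have hlim : Filter.Tendsto (fun t : ℝ => c₁ + c₂ * t + c₃ * t ^ 2)
      (nhdsWithin 0 (Set.Ioi 0)) (nhds c₁) := by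
    have hc : Continuous fun t : ℝ => c₁ + c₂ * t + c₃ * t ^ 2 := by fun_prop
    simpa using (hc.tendsto 0).mono_left nhdsWithin_le_nhds
  have h1 : mixedVol T = c₁ := by
    refine tendsto_nhds_unique (tendsto_volume_add_smul T) (hlim.congr' ?_)
    filter_upwards [self_mem_nhdsWithin] with t ht
    have ht : 0 < t := ht
    rw [h t ht.le, h0]
    field_simp
    ring
  rw [h t ht, h0, h1]

theorem volume_real_add_smul_swap (T : EuclideanSpace ℝ (Fin 3) ≃ₗᵢ[ℝ] EuclideanSpace ℝ (Fin 3))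
    {t : ℝ} (ht : 0 < t) : volume.real (oloid + t • (T '' oloid)) =
      t ^ 3 * volume.real (oloid + t⁻¹ • (T.symm '' oloid)) := by
  have h1 : T '' (oloid + t⁻¹ • (T.symm '' oloid)) = T '' oloid + t⁻¹ • oloid := by
    rw [image_add_smul]
    simp
  have h2 : oloid + t • (T '' oloid) = t • (T '' (oloid + t⁻¹ • (T.symm '' oloid))) := by
    rw [h1, smul_add, smul_smul, mul_inv_cancel₀ ht.ne', one_smul, add_comm]
  rw [h2, Measure.real, Measure.addHaar_smul, ENNReal.toReal_mul, finrank_euclideanSpace_fin,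
    ENNReal.toReal_ofReal (abs_nonneg _), abs_of_pos (by positivity)]
  rw [volume_image_isometry, Measure.real]

theorem volume_real_oloid_add_image (T : EuclideanSpace ℝ (Fin 3) ≃ₗᵢ[ℝ] EuclideanSpace ℝ (Fin 3)) :
    volume.real (oloid + T '' oloid) =
      2 * volume.real oloid + mixedVol T + mixedVol T.symm := by
  obtain ⟨c₂, c₃, h⟩ := exists_volume_oloid_add_smul_eq T
  obtain ⟨d₂, d₃, h'⟩ := exists_volume_oloid_add_smul_eq T.symm
  have key : ∀ t : ℝ, 0 < t → volume.real oloid + mixedVol T * t + c₂ * t ^ 2 + c₃ * t ^ 3 =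
      volume.real oloid * t ^ 3 + mixedVol T.symm * t ^ 2 + d₂ * t + d₃ := fun t ht => by
    rw [← h t ht.le, volume_real_add_smul_swap T ht, h' _ (inv_nonneg.2 ht.le)]
    field_simp
  have h1 := h 1 zero_le_one
  rw [one_smul] at h1
  linarith [key 1 (by norm_num), key 2 (by norm_num), key 3 (by norm_num), key 4 (by norm_num)]

theorem SO3.transpose_mul (θ : SO3) : θ.1.transpose * θ.1 = 1 :=
  (Matrix.mem_orthogonalGroup_iff' (Fin 3) ℝ).1 (Matrix.mem_specialOrthogonalGroup_iff.1 θ.2).1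

theorem continuous_SO3_inv : Continuous fun θ : SO3 => θ⁻¹ :=
  Continuous.subtype_mk (continuous_subtype_val.matrix_transpose) _

theorem isCompact_SO3 : IsCompact (SO3 : Set (Matrix (Fin 3) (Fin 3) ℝ)) := by
  have hK : IsCompact (Set.univ.pi fun _ : Fin 3 => Set.univ.pi fun _ : Fin 3 =>
      Set.Icc (-1 : ℝ) 1) :=
    isCompact_univ_pi fun _ => isCompact_univ_pi fun _ => isCompact_Icc
  refine hK.of_isClosed_subset ?_ fun A hA i _ j _ => ?_
  · have h : (SO3 : Set (Matrix (Fin 3) (Fin 3) ℝ)) =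
        {A | A.transpose * A = 1} ∩ {A | A.det = 1} := by
      ext A
      exact Matrix.mem_specialOrthogonalGroup_iff.trans
        (and_congr_left fun _ => Matrix.mem_orthogonalGroup_iff' (Fin 3) ℝ)
    rw [h]
    exact (isClosed_eq (continuous_id.matrix_transpose.matrix_mul continuous_id)
      continuous_const).inter (isClosed_eq continuous_id.matrix_det continuous_const)
  · have h := congrFun (congrFun (SO3.transpose_mul ⟨A, hA⟩) j) j
    rw [Matrix.mul_apply, Matrix.one_apply_eq] at h
    have h2 : A i j * A i j ≤ 1 := h ▸ Finset.single_le_sum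
      (f := fun k => A k j * A k j) (fun k _ => mul_self_nonneg _) (Finset.mem_univ i)
    exact abs_le.1 (abs_le_one_iff_mul_self_le_one.2 h2)

instance : CompactSpace SO3 := isCompact_iff_compactSpace.1 isCompact_SO3

instance : SecondCountableTopology SO3 :=
  haveI : SecondCountableTopology (Matrix (Fin 3) (Fin 3) ℝ) :=
    inferInstanceAs (SecondCountableTopology (Fin 3 → Fin 3 → ℝ))
  TopologicalSpace.Subtype.secondCountableTopology _

theorem rotate_apply (θ : SO3) (u : EuclideanSpace ℝ (Fin 3)) (i : Fin 3) :
    rotate θ u i = θ.1.mulVec u.ofLp i := rfl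

theorem rotate_mul (θ φ : SO3) (u : EuclideanSpace ℝ (Fin 3)) :
    rotate (θ * φ) u = rotate θ (rotate φ u) := by
  ext i
  simp only [rotate_apply, Submonoid.coe_mul]
  rw [← Matrix.mulVec_mulVec]
  rfl

theorem rotate_one (u : EuclideanSpace ℝ (Fin 3)) : rotate 1 u = u := by
  ext i
  simp [rotate_apply]

theorem continuous_rotate :
    Continuous fun p : SO3 × EuclideanSpace ℝ (Fin 3) => rotate p.1 p.2 :=
  (PiLp.continuous_toLp 2 _).comp ((continuous_subtype_val.comp continuous_fst).matrix_mulVec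
    ((PiLp.continuous_ofLp 2 _).comp continuous_snd))

theorem norm_rotate (θ : SO3) (u : EuclideanSpace ℝ (Fin 3)) : ‖rotate θ u‖ = ‖u‖ := by
  have h : ∀ v : EuclideanSpace ℝ (Fin 3), ‖v‖ ^ 2 = v.ofLp ⬝ᵥ v.ofLp := fun v => by
    rw [EuclideanSpace.real_norm_sq_eq, dotProduct]
    simp [sq]
  rw [← sq_eq_sq₀ (norm_nonneg _) (norm_nonneg _), h, h]
  change θ.1.mulVec u.ofLp ⬝ᵥ θ.1.mulVec u.ofLp = _
  rw [Matrix.dotProduct_mulVec, Matrix.vecMul_mulVec, SO3.transpose_mul, Matrix.vecMul_one]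

/-- The isometry `u ↦ -θu` for a rotation `θ`. -/
def negRotate (θ : SO3) : EuclideanSpace ℝ (Fin 3) ≃ₗᵢ[ℝ] EuclideanSpace ℝ (Fin 3) where
  toFun u := -rotate θ u
  invFun u := -rotate θ⁻¹ u
  map_add' u v := by
    ext i
    simp [rotate_apply, Matrix.mulVec_add]
    ring
  map_smul' c u := by
    ext i
    simp [rotate_apply, Matrix.mulVec_smul]
  left_inv u := by
    ext i
    have h := congrFun (congrArg WithLp.ofLp (rotate_mul θ⁻¹ θ u)) i
    simp only [inv_mul_cancel, rotate_one] at h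
    simp only [rotate_apply, PiLp.neg_apply, WithLp.ofLp_neg, Matrix.mulVec_neg, Pi.neg_apply,
      neg_neg]
    exact h.symm
  right_inv u := by
    ext i
    have h := congrFun (congrArg WithLp.ofLp (rotate_mul θ θ⁻¹ u)) i
    simp only [mul_inv_cancel, rotate_one] at h
    simp only [rotate_apply, PiLp.neg_apply, WithLp.ofLp_neg, Matrix.mulVec_neg, Pi.neg_apply,
      neg_neg]
    exact h.symm
  norm_map' u := (norm_neg _).trans (norm_rotate θ u)

theorem negRotate_apply (θ : SO3) (u : EuclideanSpace ℝ (Fin 3)) :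
    negRotate θ u = -rotate θ u := rfl

theorem negRotate_symm (θ : SO3) : (negRotate θ).symm = negRotate θ⁻¹ := rfl

attribute [irreducible] negRotate

theorem continuous_negRotate :
    Continuous fun p : EuclideanSpace ℝ (Fin 3) × SO3 => negRotate p.2 p.1 := by
  simp only [negRotate_apply]
  exact (continuous_rotate.comp continuous_swap).neg

theorem continuous_negRotate_inv :
    Continuous fun p : EuclideanSpace ℝ (Fin 3) × SO3 => negRotate p.2⁻¹ p.1 := by
  have h : Continuous fun p : EuclideanSpace ℝ (Fin 3) × SO3 => (p.2⁻¹, p.1) :=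
    (continuous_SO3_inv.comp continuous_snd).prodMk continuous_fst
  simp only [negRotate_apply]
  exact (continuous_rotate.comp h).neg

theorem halfTurn_mem_SO3 (a b c : ℝ) {k : ℝ} (hk : k * (a * a + b * b + c * c) = 2) :
    !![k * (a * a) - 1, k * (a * b), k * (a * c); k * (b * a), k * (b * b) - 1, k * (b * c);
      k * (c * a), k * (c * b), k * (c * c) - 1] ∈ SO3 := by
  rw [Matrix.mem_specialOrthogonalGroup_iff, Matrix.mem_orthogonalGroup_iff']
  constructor
  · ext i j
    rw [Matrix.mul_apply, Fin.sum_univ_three]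
    fin_cases i <;> fin_cases j <;> simp
    · linear_combination k * (a * a) * hk
    · linear_combination k * (a * b) * hk
    · linear_combination k * (a * c) * hk
    · linear_combination k * (b * a) * hk
    · linear_combination k * (b * b) * hk
    · linear_combination k * (b * c) * hk
    · linear_combination k * (c * a) * hk
    · linear_combination k * (c * b) * hk
    · linear_combination k * (c * c) * hk
  · rw [Matrix.det_fin_three]
    simp
    linear_combination hk

/-- The half-turn about the axis spanned by `w`. -/
theorem exists_halfTurn {w : EuclideanSpace ℝ (Fin 3)} {k : ℝ} (hk : k * ‖w‖ ^ 2 = 2) :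
    ∃ φ : SO3, ∀ u, rotate φ u = (k * inner ℝ w u) • w - u := by
  rw [← real_inner_self_eq_norm_sq, inner_eq_sum] at hk
  refine ⟨⟨_, halfTurn_mem_SO3 _ _ _ hk⟩, fun u => ?_⟩
  ext i
  rw [rotate_apply, inner_eq_sum]
  simp only [Matrix.mulVec, dotProduct, Fin.sum_univ_three]
  fin_cases i <;> simp <;> ring

theorem exists_rotate_eq {u v : EuclideanSpace ℝ (Fin 3)} (h : ‖u‖ = ‖v‖) :
    ∃ φ : SO3, rotate φ u = v := by
  by_cases hw : u + v = 0
  · obtain rfl := eq_neg_of_add_eq_zero_right hw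
    obtain ⟨w, hw0, hwu⟩ : ∃ w : EuclideanSpace ℝ (Fin 3), w ≠ 0 ∧ inner ℝ w u = 0 := by
      by_cases h0 : u 0 = 0 ∧ u 1 = 0
      · refine ⟨!₂[1, 0, 0], fun h => ?_, ?_⟩
        · simpa using congrFun (congrArg WithLp.ofLp h) 0
        · simp [inner_eq_sum, h0.1]
      · refine ⟨!₂[u 1, -u 0, 0], fun h => h0 ⟨?_, ?_⟩, ?_⟩
        · simpa using congrFun (congrArg WithLp.ofLp h) 1
        · simpa using congrFun (congrArg WithLp.ofLp h) 0
        · simp [inner_eq_sum]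
          ring
    obtain ⟨φ, hφ⟩ := exists_halfTurn (w := w) (k := 2 / ‖w‖ ^ 2)
      (div_mul_cancel₀ _ (by positivity))
    exact ⟨φ, by rw [hφ, hwu]; simp⟩
  · have hn : ‖u + v‖ ^ 2 ≠ 0 := by positivity
    obtain ⟨φ, hφ⟩ := exists_halfTurn (w := u + v) (k := 2 / ‖u + v‖ ^ 2)
      (div_mul_cancel₀ _ hn)
    refine ⟨φ, ?_⟩
    have h2 : ‖u + v‖ ^ 2 = 2 * inner ℝ (u + v) u := by
      rw [norm_add_sq_real, inner_add_left, real_inner_self_eq_norm_sq, ← h, real_inner_comm u v]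
      ring
    rw [hφ, div_mul_eq_mul_div, ← h2, div_self hn, one_smul, add_sub_cancel_left]

theorem integrable_prod_SO3 {X : Type*} [TopologicalSpace X] [T2Space X] [SecondCountableTopology X]
    [MeasurableSpace X] [BorelSpace X] (μ : Measure X) [SFinite μ] [IsFiniteMeasureOnCompacts μ]
    (ν : Measure SO3) [IsProbabilityMeasure ν] {K : Set X} (hK : IsCompact K) {f : X × SO3 → ℝ}
    (hf : Continuous f) : Integrable f ((μ.restrict K).prod ν) := by
  have h : (μ.restrict K).prod ν = (μ.prod ν).restrict (K ×ˢ Set.univ) := by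
    rw [← Measure.prod_restrict, Measure.restrict_univ]
  rw [h]
  exact hf.continuousOn.integrableOn_compact (hK.prod isCompact_univ)

/-- The average over the rotation group of `suppO (-θ⁻¹n)`. -/
def avgSupp (ν : Measure SO3) (n : EuclideanSpace ℝ (Fin 3)) : ℝ :=
  ∫ θ, suppO (negRotate θ⁻¹ n) ∂ν

section Average

variable (ν : Measure SO3) [ν.IsMulLeftInvariant]

theorem avgSupp_rotate (φ : SO3) (n : EuclideanSpace ℝ (Fin 3)) :
    avgSupp ν (rotate φ n) = avgSupp ν n := by
  unfold avgSupp
  rw [← integral_mul_left_eq_self _ φ]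
  congr 1
  ext θ
  rw [negRotate_apply, negRotate_apply, ← rotate_mul]
  simp

theorem avgSupp_eq (n : EuclideanSpace ℝ (Fin 3)) :
    avgSupp ν n = avgSupp ν (EuclideanSpace.single 0 1) * ‖n‖ := by
  obtain ⟨φ, hφ⟩ := exists_rotate_eq (u := n) (v := ‖n‖ • EuclideanSpace.single 0 1)
    (by simp [norm_smul])
  rw [← avgSupp_rotate ν φ, hφ, mul_comm]
  unfold avgSupp
  rw [← integral_const_mul]
  congr 1
  ext θ
  rw [map_smul, suppO_smul (norm_nonneg n)]

variable [IsProbabilityMeasure ν]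

theorem integral_suppO_negRotate (n : EuclideanSpace ℝ (Fin 3)) :
    ∫ θ, suppO (negRotate θ n) ∂ν = avgSupp ν (EuclideanSpace.single 0 1) * ‖n‖ := by
  have hcont : Continuous fun p : SO3 × SO3 => suppO (negRotate p.2⁻¹ (rotate p.1 n)) := by
    have h : Continuous fun p : SO3 × SO3 => (rotate p.1 n, p.2) :=
      (continuous_rotate.comp (continuous_fst.prodMk continuous_const)).prodMk continuous_snd
    exact continuous_suppO.comp (continuous_negRotate_inv.comp h)
  have h1 : ∀ φ : SO3, ∫ θ, suppO (negRotate φ⁻¹ (rotate θ n)) ∂ν =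
      ∫ θ, suppO (negRotate θ n) ∂ν := fun φ => by
    have h := integral_mul_left_eq_self (μ := ν) (fun θ => suppO (negRotate θ n)) φ⁻¹
    simp only [negRotate_apply, rotate_mul] at h ⊢
    exact h
  have h2 : ∫ θ, ∫ φ, suppO (negRotate φ⁻¹ (rotate θ n)) ∂ν ∂ν =
      ∫ φ, ∫ θ, suppO (negRotate φ⁻¹ (rotate θ n)) ∂ν ∂ν :=
    integral_integral_swap_of_hasCompactSupport hcont (HasCompactSupport.of_compactSpace _)
  have h3 : ∀ θ : SO3, ∫ φ, suppO (negRotate φ⁻¹ (rotate θ n)) ∂ν =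
      avgSupp ν (EuclideanSpace.single 0 1) * ‖n‖ := fun θ => by
    rw [← norm_rotate θ n]
    exact avgSupp_eq ν _
  simp only [h1, h3] at h2
  simpa using h2.symm

theorem setIntegral_closedBall_isometry (T : EuclideanSpace ℝ (Fin 3) ≃ₗᵢ[ℝ] EuclideanSpace ℝ (Fin 3))
    (f : EuclideanSpace ℝ (Fin 3) → ℝ) :
    ∫ u in Metric.closedBall 0 1, f (T u) = ∫ u in Metric.closedBall 0 1, f u := by
  have h := T.measurePreserving.setIntegral_preimage_emb
    T.toHomeomorph.measurableEmbedding f (Metric.closedBall 0 1)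
  rwa [LinearIsometryEquiv.preimage_closedBall, map_zero] at h

theorem integral_norm_closedBall :
    ∫ u in Metric.closedBall (0 : EuclideanSpace ℝ (Fin 3)) 1, ‖u‖ = π := by
  have h := integral_fun_norm_addHaar (volume : Measure (EuclideanSpace ℝ (Fin 3)))
    ((Set.Iic (1 : ℝ)).indicator fun y => y)
  rw [← integral_indicator Metric.isClosed_closedBall.measurableSet]
  have h1 : (Metric.closedBall (0 : EuclideanSpace ℝ (Fin 3)) 1).indicator (fun u => ‖u‖) =
      fun u => (Set.Iic (1 : ℝ)).indicator (fun y => y) ‖u‖ := by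
    ext u
    by_cases hu : ‖u‖ ≤ 1 <;> simp [Set.indicator, hu]
  rw [h1, h, finrank_euclideanSpace_fin, Measure.real, EuclideanSpace.volume_ball_fin_three]
  have h2 : ∫ y in Set.Ioi (0 : ℝ), y ^ (3 - 1) • (Set.Iic (1 : ℝ)).indicator (fun y => y) y
      = 1 / 4 := by
    have : ∀ y : ℝ, y ^ (3 - 1) • (Set.Iic (1 : ℝ)).indicator (fun y => y) y =
        (Set.Iic (1 : ℝ)).indicator (fun y => y ^ 3) y := fun y => by
      by_cases hy : y ≤ 1
      · simp [Set.indicator, hy]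
        ring
      · simp [Set.indicator, hy]
    simp only [this]
    rw [setIntegral_indicator measurableSet_Iic, Set.Ioi_inter_Iic,
      ← intervalIntegral.integral_of_le zero_le_one, integral_pow]
    norm_num
  rw [h2, ENNReal.toReal_mul, ENNReal.toReal_ofReal (by positivity)]
  simp
  ring

theorem avgSupp_mul_pi : avgSupp ν (EuclideanSpace.single 0 1) * π =
    ∫ u in Metric.closedBall (0 : EuclideanSpace ℝ (Fin 3)) 1, suppO u := by
  rw [← integral_norm_closedBall, ← integral_const_mul]
  simp only [← avgSupp_eq]
  unfold avgSupp
  rw [integral_integral_swap]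
  · simp only [setIntegral_closedBall_isometry]
    simp
  · exact integrable_prod_SO3 _ ν (isCompact_closedBall 0 1)
      (continuous_suppO.comp continuous_negRotate_inv)

end Average

theorem dl_eq_sqrt (x : ℝ) : √(1 - (√3 / 2) ^ 2 * sin x ^ 2) = dl x := by
  rw [div_pow, sqrt_three_sq, dl]
  norm_num

theorem integral_dl : ∫ x in (0 : ℝ)..(π / 2), dl x = ellipticE (√3 / 2) := by
  simp only [ellipticE, dl_eq_sqrt]

theorem integral_one_div_dl : ∫ x in (0 : ℝ)..(π / 2), 1 / dl x = ellipticK (√3 / 2) := by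
  simp only [ellipticK, dl_eq_sqrt]

theorem continuous_one_div_dl_pow (n : ℕ) : Continuous fun x => 1 / dl x ^ n :=
  continuous_const.div (continuous_dl.pow n) fun x => pow_ne_zero n (dl_pos x).ne'

theorem integral_one_div_dl_cube :
    ∫ x in (0 : ℝ)..(π / 2), 1 / dl x ^ 3 = 4 * ellipticE (√3 / 2) := by
  have hd : ∀ x, HasDerivAt (fun x => sin x * cos x / dl x)
      (4 / 3 * dl x - 1 / 3 * (1 / dl x ^ 3)) x := fun x => by
    have h0 := (dl_pos x).ne'
    have h2 := dl_sq x
    have h3 := sin_sq_add_cos_sq x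
    refine (((hasDerivAt_sin x).fun_mul (hasDerivAt_cos x)).fun_div
      (hasDerivAt_dl x) h0).congr_deriv ?_
    have h4 : cos x ^ 2 = 1 - sin x ^ 2 := by linarith
    field_simp
    rw [show dl x ^ 4 = (dl x ^ 2) ^ 2 by ring, h2, h4]
    ring
  have hi : IntervalIntegrable (fun x => 4 / 3 * dl x - 1 / 3 * (1 / dl x ^ 3)) volume 0 (π / 2) :=
    ((continuous_dl.const_mul _).sub
      ((continuous_one_div_dl_pow 3).const_mul _)).intervalIntegrable _ _
  have h := intervalIntegral.integral_eq_sub_of_hasDerivAt (fun x _ => hd x) hi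
  rw [intervalIntegral.integral_sub ((continuous_dl.const_mul _).intervalIntegrable _ _)
    (((continuous_one_div_dl_pow 3).const_mul _).intervalIntegrable _ _),
    intervalIntegral.integral_const_mul, intervalIntegral.integral_const_mul, integral_dl] at h
  simp only [sin_pi_div_two, cos_pi_div_two, sin_zero, cos_zero, mul_zero, zero_mul, zero_div,
    sub_zero] at h
  linarith

theorem integral_one_div_dl_sq : ∫ x in (0 : ℝ)..(π / 2), 1 / dl x ^ 2 = π := by
  have hd : ∀ x, HasDerivAt (fun x => 2 * x - 2 * arctan (sin x * cos x / (1 + cos x ^ 2)))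
      (1 / dl x ^ 2) x := fun x => by
    have h3 := sin_sq_add_cos_sq x
    have h5 : 0 < 1 + cos x ^ 2 := by positivity
    have h6 : 0 < 1 + 3 * cos x ^ 2 := by positivity
    have h1 := (((hasDerivAt_sin x).fun_mul (hasDerivAt_cos x)).fun_div
      (((hasDerivAt_cos x).fun_pow 2).const_add 1) h5.ne').arctan
    refine (((hasDerivAt_id' x).const_mul 2).fun_sub (h1.const_mul 2)).congr_deriv ?_
    have h4 : sin x ^ 2 = 1 - cos x ^ 2 := by linarith
    have h7 : dl x ^ 2 = (1 + 3 * cos x ^ 2) / 4 := by rw [dl_sq, h4]; ring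
    have h8 : 1 + (sin x * cos x / (1 + cos x ^ 2)) ^ 2 =
        (1 + 3 * cos x ^ 2) / (1 + cos x ^ 2) ^ 2 := by
      field_simp
      rw [h4]
      ring
    rw [h7, h8]
    field_simp
    simp
    rw [h4]
    ring
  have h := intervalIntegral.integral_eq_sub_of_hasDerivAt (fun x _ => hd x)
    ((continuous_one_div_dl_pow 2).intervalIntegrable 0 (π / 2))
  rw [h]
  simp
  ring

theorem volume_real_oloid :
    volume.real oloid = (4 * ellipticE (√3 / 2) + 2 * ellipticK (√3 / 2)) / 3 := by
  have h := integral_jac_mul (f := fun _ => 1 / 3) continuous_const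
  rw [volume_real_oloid_eq_sum, volume_real_oloid_inter_wedge, h]
  have h1 : ∀ x, 1 / 3 * rulWeight x = 1 / 6 * dl x + (1 / 6 * (1 / dl x) + 1 / 24 * (1 / dl x ^ 3)) :=
    fun x => by
      have := (dl_pos x).ne'
      rw [rulWeight]
      field_simp
      ring
  have c1 := continuous_one_div_dl_pow 1
  simp only [pow_one] at c1
  have i0 := (continuous_dl.const_mul (1 / 6)).intervalIntegrable (μ := volume) 0 (π / 2)
  have i1 := (c1.const_mul (1 / 6)).intervalIntegrable (μ := volume) 0 (π / 2)
  have i3 := ((continuous_one_div_dl_pow 3).const_mul (1 / 24)).intervalIntegrable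
    (μ := volume) 0 (π / 2)
  simp only [h1]
  rw [intervalIntegral.integral_add i0 (i1.add i3), intervalIntegral.integral_add i1 i3]
  simp only [intervalIntegral.integral_const_mul]
  rw [integral_dl, integral_one_div_dl, integral_one_div_dl_cube]
  simp
  ring

theorem continuous_rulWeight : Continuous rulWeight := by
  have hd := continuous_dl
  refine Continuous.div (by fun_prop) (by fun_prop) fun x => ?_
  have := dl_pos x
  positivity

theorem integral_two_mul_dl_ratio (c : ℝ) : ∫ x in (0 : ℝ)..(π / 2),
    c * ‖nrm x‖ / (1 / 2 + dl x ^ 2) * rulWeight x = c * π := by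
  have h1 : ∀ x, c * ‖nrm x‖ / (1 / 2 + dl x ^ 2) * rulWeight x = c * (1 + 1 / 2 * (1 / dl x ^ 2)) :=
    fun x => by
      have := dl_pos x
      rw [rulWeight, norm_nrm]
      field_simp
      ring
  simp only [h1]
  rw [intervalIntegral.integral_const_mul, intervalIntegral.integral_add (by simp)
    (((continuous_one_div_dl_pow 2).const_mul _).intervalIntegrable _ _),
    intervalIntegral.integral_const_mul, integral_one_div_dl_sq, intervalIntegral.integral_const,
    smul_eq_mul]
  ring

section Average

variable (ν : Measure SO3) [IsProbabilityMeasure ν]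

theorem integral_suppRatio_average {G : EuclideanSpace ℝ (Fin 3) × SO3 → ℝ} (hG : Continuous G)
    {c : ℝ} (hc : ∀ u, ∫ θ, G (u, θ) ∂ν = c * ‖u‖)
    (S : EuclideanSpace ℝ (Fin 3) ≃ₗᵢ[ℝ] EuclideanSpace ℝ (Fin 3)) :
    Integrable (fun θ => ∫ x in (0 : ℝ)..(π / 2),
        suppRatio (fun u => G (S u, θ)) x * rulWeight x) ν ∧
      ∫ θ, (∫ x in (0 : ℝ)..(π / 2),
        suppRatio (fun u => G (S u, θ)) x * rulWeight x) ∂ν = c * π := by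
  have hcont : Continuous fun p : ℝ × SO3 =>
      suppRatio (fun u => G (S u, p.2)) p.1 * rulWeight p.1 := by
    have h1 : Continuous fun p : ℝ × SO3 => (S (nrm p.1), p.2) :=
      (S.continuous.comp (continuous_nrm.comp continuous_fst)).prodMk continuous_snd
    have hd := continuous_dl
    refine Continuous.mul (Continuous.div (hG.comp h1) (by fun_prop) fun p => ?_)
      (continuous_rulWeight.comp continuous_fst)
    have := dl_pos p.1
    positivity
  have h_int := integrable_prod_SO3 volume ν (isCompact_Icc (a := (0 : ℝ)) (b := π / 2)) hcont
  simp only [intervalIntegral.integral_of_le (show (0 : ℝ) ≤ π / 2 by positivity),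
    ← integral_Icc_eq_integral_Ioc]
  refine ⟨h_int.integral_prod_right, ?_⟩
  rw [← integral_integral_swap (f := fun x θ =>
      suppRatio (fun u => G (S u, θ)) x * rulWeight x) h_int, ← integral_two_mul_dl_ratio c,
    intervalIntegral.integral_of_le (show (0 : ℝ) ≤ π / 2 by positivity),
    ← integral_Icc_eq_integral_Ioc]
  congr 1
  ext x
  simp only [suppRatio]
  rw [integral_mul_const, integral_div, hc, S.norm_map]

variable [ν.IsMulLeftInvariant]

theorem integral_mixedVol_negRotate :
    Integrable (fun θ => mixedVol (negRotate θ)) ν ∧ ∫ θ, mixedVol (negRotate θ) ∂ν =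
      4 * (avgSupp ν (EuclideanSpace.single 0 1) * π) := by
  have h := fun j => integral_suppRatio_average ν
    (continuous_suppO.comp continuous_negRotate_inv) (avgSupp_eq ν) (oloidSymm j).symm
  simp only [Function.comp_apply] at h
  simp only [mixedVol, negRotate_symm]
  refine ⟨integrable_finsetSum _ fun j _ => (h j).1, ?_⟩
  rw [integral_finsetSum _ fun j _ => (h j).1]
  refine (Finset.sum_congr rfl fun j _ => (h j).2).trans ?_
  simp

theorem integral_mixedVol_negRotate_symm :
    Integrable (fun θ => mixedVol (negRotate θ).symm) ν ∧ ∫ θ, mixedVol (negRotate θ).symm ∂ν =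
      4 * (avgSupp ν (EuclideanSpace.single 0 1) * π) := by
  have h := fun j => integral_suppRatio_average ν
    (continuous_suppO.comp continuous_negRotate) (integral_suppO_negRotate ν) (oloidSymm j).symm
  simp only [Function.comp_apply] at h
  simp only [mixedVol, LinearIsometryEquiv.symm_symm]
  refine ⟨integrable_finsetSum _ fun j _ => (h j).1, ?_⟩
  rw [integral_finsetSum _ fun j _ => (h j).1]
  refine (Finset.sum_congr rfl fun j _ => (h j).2).trans ?_
  simp

theorem setOf_inter_moveSet_nonempty (r : ℝ) (θ : SO3) :
    {x : EuclideanSpace ℝ (Fin 3) | (oloidR r ∩ moveSet θ x (oloidR r)).Nonempty} =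
      r • (oloid + negRotate θ '' oloid) := by
  have h1 : r • (negRotate θ '' oloid) = negRotate θ '' (oloidR r) :=
    (Set.image_smul_comm _ _ _ fun y => map_smul (negRotate θ) r y).symm
  rw [smul_add, h1]
  ext x
  constructor
  · rintro ⟨_, hp, q, hq, rfl⟩
    refine ⟨_, hp, _, ⟨q, hq, rfl⟩, ?_⟩
    rw [negRotate_apply]
    simp
  · rintro ⟨p, hp, _, ⟨q, hq, rfl⟩, rfl⟩
    refine ⟨p, hp, q, hq, ?_⟩
    rw [negRotate_apply]
    simp

theorem lintegral_hitting {r : ℝ} (hr : 0 < r) :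
    ∫⁻ θ : SO3, volume {x : EuclideanSpace ℝ (Fin 3) |
        (oloidR r ∩ moveSet θ x (oloidR r)).Nonempty} ∂ν =
      ENNReal.ofReal (r ^ 3 * (2 * volume.real oloid +
        8 * ∫ u in Metric.closedBall (0 : EuclideanSpace ℝ (Fin 3)) 1, suppO u)) := by
  have h1 : ∀ θ : SO3, volume {x : EuclideanSpace ℝ (Fin 3) |
      (oloidR r ∩ moveSet θ x (oloidR r)).Nonempty} =
      ENNReal.ofReal (r ^ 3) * ENNReal.ofReal (2 * volume.real oloid + mixedVol (negRotate θ) +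
        mixedVol (negRotate θ).symm) := fun θ => by
    have hk := isCompact_oloid.add (isCompact_oloid.image (negRotate θ).continuous)
    rw [setOf_inter_moveSet_nonempty, Measure.addHaar_smul, finrank_euclideanSpace_fin,
      abs_of_pos (by positivity), ← volume_real_oloid_add_image, Measure.real,
      ENNReal.ofReal_toReal hk.measure_ne_top]
  obtain ⟨i1, e1⟩ := integral_mixedVol_negRotate ν
  obtain ⟨i2, e2⟩ := integral_mixedVol_negRotate_symm ν
  have i0 : Integrable (fun _ : SO3 => 2 * volume.real oloid) ν := integrable_const _
  simp only [h1]
  rw [lintegral_const_mul' _ _ ENNReal.ofReal_ne_top, ← ofReal_integral_eq_lintegral_ofReal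
    ((i0.fun_add i1).fun_add i2), ← ENNReal.ofReal_mul (by positivity),
    integral_add (i0.fun_add i1) i2, integral_add i0 i1, e1, e2, avgSupp_mul_pi]
  · congr 2
    simp
    ring
  · refine Filter.Eventually.of_forall fun θ => ?_
    simp only [Pi.zero_apply]
    rw [← volume_real_oloid_add_image]
    exact measureReal_nonneg

end Average

theorem lintegral_lintegral_polar {f : ℝ × ℝ → ENNReal} (hf : Measurable f) :
    ∫⁻ x, ∫⁻ y, f (x, y) = ∫⁻ t in Set.Ioo (-π) π, ∫⁻ r in Set.Ioi (0 : ℝ),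
      ENNReal.ofReal r * f (r * cos t, r * sin t) := by
  have hm : Measurable fun p : ℝ × ℝ =>
      ENNReal.ofReal p.1 * f (p.1 * cos p.2, p.1 * sin p.2) := by fun_prop
  rw [← lintegral_prod _ hf.aemeasurable, ← Measure.volume_eq_prod,
    ← lintegral_comp_polarCoord_symm]
  exact setLIntegral_prod_symm (s := Set.Ioi 0) (t := Set.Ioo (-π) π) _ hm.aemeasurable

theorem cos_pos_iff_of_mem_Ioo {t : ℝ} (ht : t ∈ Set.Ioo (-π) π) :
    0 < cos t ↔ t ∈ Set.Ioo (-(π / 2)) (π / 2) := by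
  refine ⟨fun h => ?_, cos_pos_of_mem_Ioo⟩
  by_contra hn
  rw [Set.mem_Ioo, not_and_or, not_lt, not_lt] at hn
  obtain hn | hn := hn
  · have := cos_nonpos_of_pi_div_two_le_of_le (x := -t) (by linarith) (by linarith [ht.1])
    rw [cos_neg] at this
    linarith
  · linarith [cos_nonpos_of_pi_div_two_le_of_le hn (by linarith [ht.2])]

theorem setLIntegral_lintegral_polar {f : ℝ × ℝ → ENNReal} (hf : Measurable f) :
    ∫⁻ x in Set.Ioi (0 : ℝ), ∫⁻ y, f (x, y) =
      ∫⁻ t in Set.Ioo (-(π / 2)) (π / 2), ∫⁻ r in Set.Ioi (0 : ℝ),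
        ENNReal.ofReal r * f (r * cos t, r * sin t) := by
  have hs : MeasurableSet {p : ℝ × ℝ | 0 < p.1} := measurableSet_lt measurable_const measurable_fst
  have h := lintegral_lintegral_polar (hf.indicator hs)
  rw [← lintegral_indicator measurableSet_Ioi]
  have h1 : ∀ x : ℝ, (Set.Ioi (0 : ℝ)).indicator (fun x => ∫⁻ y, f (x, y)) x =
      ∫⁻ y, {p : ℝ × ℝ | 0 < p.1}.indicator f (x, y) := fun x => by
    by_cases hx : 0 < x
    · rw [Set.indicator_of_mem (show x ∈ Set.Ioi 0 from hx)]
      exact lintegral_congr fun y =>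
        (Set.indicator_of_mem (show (x, y) ∈ {p : ℝ × ℝ | 0 < p.1} from hx) f).symm
    · rw [Set.indicator_of_notMem (show x ∉ Set.Ioi 0 from hx)]
      exact (lintegral_eq_zero_of_ae_eq_zero (Filter.Eventually.of_forall fun y =>
        Set.indicator_of_notMem (show (x, y) ∉ {p : ℝ × ℝ | 0 < p.1} from hx) f)).symm
  have h2 : Set.Ioo (-(π / 2)) (π / 2) ⊆ Set.Ioo (-π) π :=
    Set.Ioo_subset_Ioo (by linarith [pi_pos]) (by linarith [pi_pos])
  rw [lintegral_congr h1, h, ← Set.inter_eq_left.2 h2, ← setLIntegral_indicator measurableSet_Ioo]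
  refine setLIntegral_congr_fun measurableSet_Ioo fun t ht => ?_
  by_cases hc : t ∈ Set.Ioo (-(π / 2)) (π / 2)
  · rw [Set.indicator_of_mem hc]
    refine setLIntegral_congr_fun measurableSet_Ioi fun r hr => ?_
    have hp : 0 < r * cos t := mul_pos hr (cos_pos_of_mem_Ioo hc)
    rw [Set.indicator_of_mem (show (r * cos t, r * sin t) ∈ {p : ℝ × ℝ | 0 < p.1} from hp)]
  · rw [Set.indicator_of_notMem hc]
    refine (setLIntegral_congr_fun measurableSet_Ioi fun r hr => ?_).trans lintegral_zero
    have hp : ¬ 0 < r * cos t := fun h0 =>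
      hc ((cos_pos_iff_of_mem_Ioo ht).1 (pos_of_mul_pos_right h0 (le_of_lt hr)))
    rw [Set.indicator_of_notMem (show (r * cos t, r * sin t) ∉ {p : ℝ × ℝ | 0 < p.1} from hp),
      mul_zero]

theorem lintegral_spherical {F : EuclideanSpace ℝ (Fin 3) → ENNReal} (hF : Measurable F) :
    ∫⁻ u, F u = ∫⁻ φ in Set.Ioo (-π) π, ∫⁻ ψ in Set.Ioo (-(π / 2)) (π / 2),
      ∫⁻ ρ in Set.Ioi (0 : ℝ), ENNReal.ofReal (ρ ^ 2 * cos ψ) *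
        F !₂[ρ * cos ψ * sin φ, ρ * cos ψ * cos φ, ρ * sin ψ] := by
  have hm : Measurable fun p : (ℝ × ℝ) × ℝ => F !₂[p.1.2, p.1.1, p.2] :=
    hF.comp (by fun_prop)
  have hm2 : Measurable fun p : ℝ × ℝ => ∫⁻ c, F !₂[p.1, p.2, c] :=
    Measurable.lintegral_prod_right' (f := fun p : (ℝ × ℝ) × ℝ => F !₂[p.1.1, p.1.2, p.2])
      (hF.comp (by fun_prop))
  rw [lintegral_euclidean_fin_three hF, lintegral_lintegral_swap hm2.aemeasurable,
    lintegral_lintegral_polar (f := fun p => ∫⁻ c, F !₂[p.2, p.1, c])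
      hm.lintegral_prod_right']
  refine lintegral_congr fun φ => ?_
  have hm3 : Measurable fun p : ℝ × ℝ =>
      ENNReal.ofReal p.1 * F !₂[p.1 * sin φ, p.1 * cos φ, p.2] :=
    Measurable.mul (by fun_prop) (hF.comp (by fun_prop))
  have h := setLIntegral_lintegral_polar hm3
  have h1 : ∀ r : ℝ, ENNReal.ofReal r * ∫⁻ c, F !₂[r * sin φ, r * cos φ, c] =
      ∫⁻ c, ENNReal.ofReal r * F !₂[r * sin φ, r * cos φ, c] := fun r =>
    (lintegral_const_mul' _ _ ENNReal.ofReal_ne_top).symm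
  simp only [h1]
  rw [h]
  refine lintegral_congr fun ψ => setLIntegral_congr_fun measurableSet_Ioi fun ρ hρ => ?_
  simp only
  rw [← mul_assoc, ← ENNReal.ofReal_mul (le_of_lt hρ)]
  congr 2
  ring

/-- Spherical coordinates about the third axis. -/
def sphericalPt (φ ψ ρ : ℝ) : EuclideanSpace ℝ (Fin 3) :=
  !₂[ρ * cos ψ * sin φ, ρ * cos ψ * cos φ, ρ * sin ψ]

theorem norm_sphericalPt (φ ψ : ℝ) {ρ : ℝ} (hρ : 0 < ρ) : ‖sphericalPt φ ψ ρ‖ = ρ := by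
  rw [EuclideanSpace.norm_eq, Fin.sum_univ_three]
  simp only [sphericalPt, norm_eq_abs, sq_abs]
  simp only [Matrix.cons_val]
  rw [show (ρ * cos ψ * sin φ) ^ 2 + (ρ * cos ψ * cos φ) ^ 2 + (ρ * sin ψ) ^ 2 =
    ρ ^ 2 * (cos ψ ^ 2 * (sin φ ^ 2 + cos φ ^ 2) + sin ψ ^ 2) by ring, sin_sq_add_cos_sq, mul_one,
    cos_sq_add_sin_sq, mul_one, sqrt_sq hρ.le]

theorem suppA_sphericalPt (φ : ℝ) {ψ ρ : ℝ} (hψ : 0 < cos ψ) (hρ : 0 < ρ) :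
    suppA (sphericalPt φ ψ ρ) = ρ * cos ψ * (1 - cos φ / 2) := by
  simp only [suppA, sphericalPt, Matrix.cons_val]
  rw [show (ρ * cos ψ * sin φ) ^ 2 + (ρ * cos ψ * cos φ) ^ 2 =
    (ρ * cos ψ) ^ 2 * (sin φ ^ 2 + cos φ ^ 2) by ring, sin_sq_add_cos_sq, mul_one,
    sqrt_sq (by positivity)]
  ring

theorem suppB_sphericalPt (φ : ℝ) {ψ ρ : ℝ} (hψ : 0 < cos ψ) (hρ : 0 < ρ) :
    suppB (sphericalPt φ ψ ρ) =
      ρ * cos ψ * (√(cos φ ^ 2 + tan ψ ^ 2) + cos φ / 2) := by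
  simp only [suppB, sphericalPt, Matrix.cons_val]
  rw [← tan_mul_cos hψ.ne', show (ρ * cos ψ * cos φ) ^ 2 + (ρ * (tan ψ * cos ψ)) ^ 2 =
    (ρ * cos ψ) ^ 2 * (cos φ ^ 2 + tan ψ ^ 2) by ring, sqrt_mul (by positivity),
    sqrt_sq (by positivity)]
  ring

theorem suppB_lt_suppA_sphericalPt {φ ψ ρ : ℝ} (hψ : ψ ∈ Set.Ioo (-(π / 2)) (π / 2)) (hρ : 0 < ρ)
    (h : |ψ| < arctan √(1 - 2 * cos φ)) :
    suppB (sphericalPt φ ψ ρ) < suppA (sphericalPt φ ψ ρ) := by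
  have hc := cos_pos_of_mem_Ioo hψ
  rw [suppA_sphericalPt φ hc hρ, suppB_sphericalPt φ hc hρ]
  refine mul_lt_mul_of_pos_left ?_ (by positivity)
  have h1 : |tan ψ| < √(1 - 2 * cos φ) := by
    rw [abs_lt] at h ⊢
    rw [← arctan_neg] at h
    nth_rewrite 1 2 [← arctan_tan hψ.1 hψ.2] at h
    exact ⟨arctan_strictMono.lt_iff_lt.1 h.1, arctan_strictMono.lt_iff_lt.1 h.2⟩
  have h2 : tan ψ ^ 2 < 1 - 2 * cos φ := by
    rw [← sq_abs]
    exact (lt_sqrt (abs_nonneg _)).1 h1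
  have h3 : √(cos φ ^ 2 + tan ψ ^ 2) < 1 - cos φ := by
    rw [sqrt_lt' (by nlinarith [sq_nonneg (tan ψ)])]
    nlinarith
  linarith

theorem suppA_lt_suppB_sphericalPt {φ ψ ρ : ℝ} (hψ : ψ ∈ Set.Ioo (-(π / 2)) (π / 2)) (hρ : 0 < ρ)
    (h : arctan √(1 - 2 * cos φ) < |ψ|) :
    suppA (sphericalPt φ ψ ρ) < suppB (sphericalPt φ ψ ρ) := by
  have hc := cos_pos_of_mem_Ioo hψ
  rw [suppA_sphericalPt φ hc hρ, suppB_sphericalPt φ hc hρ]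
  refine mul_lt_mul_of_pos_left ?_ (by positivity)
  have h1 : √(1 - 2 * cos φ) < |tan ψ| := by
    rw [lt_abs] at h ⊢
    nth_rewrite 1 2 [← arctan_tan hψ.1 hψ.2] at h
    rw [← arctan_neg] at h
    exact h.imp arctan_strictMono.lt_iff_lt.1 arctan_strictMono.lt_iff_lt.1
  have h2 : 1 - 2 * cos φ < tan ψ ^ 2 := by
    rw [← sq_abs]
    exact lt_sq_of_sqrt_lt h1
  have h3 : 1 - cos φ < √(cos φ ^ 2 + tan ψ ^ 2) := by
    refine lt_sqrt_of_sq_lt ?_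
    nlinarith
  linarith

theorem setLIntegral_Ioi_cube {k : ℝ} (hk : 0 ≤ k) :
    ∫⁻ ρ in Set.Ioi (0 : ℝ), (Set.Iic (1 : ℝ)).indicator (fun ρ => ENNReal.ofReal (k * ρ ^ 3)) ρ =
      ENNReal.ofReal (k / 4) := by
  rw [setLIntegral_indicator measurableSet_Iic, Set.inter_comm, Set.Ioi_inter_Iic,
    ← ofReal_integral_eq_lintegral_ofReal,
    ← intervalIntegral.integral_of_le zero_le_one, intervalIntegral.integral_const_mul,
    integral_pow]
  · norm_num
    ring_nf
  · exact (by fun_prop : Continuous fun ρ : ℝ => k * ρ ^ 3).integrableOn_Ioc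
  · refine (ae_restrict_iff' measurableSet_Ioc).2 (Filter.Eventually.of_forall fun ρ hρ => ?_)
    exact mul_nonneg hk (pow_nonneg hρ.1.le 3)

/-- Integral of `cos²` over the symmetric interval with endpoint `arctan z`. -/
def gapWeight (z : ℝ) : ℝ := arctan z + z / (1 + z ^ 2)

theorem gapWeight_nonneg {z : ℝ} (hz : 0 ≤ z) : 0 ≤ gapWeight z :=
  add_nonneg (arctan_nonneg.2 hz) (by positivity)

theorem continuous_gapWeight : Continuous gapWeight :=
  continuous_arctan.add (continuous_id.div (by fun_prop) fun z => by positivity)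

theorem setLIntegral_cos_sq {k z : ℝ} (hk : 0 ≤ k) (hz : 0 ≤ z) :
    ∫⁻ ψ in Set.Ioo (-(π / 2)) (π / 2), (Set.Icc (-arctan z) (arctan z)).indicator
      (fun ψ => ENNReal.ofReal (k * cos ψ ^ 2)) ψ = ENNReal.ofReal (k * gapWeight z) := by
  have h0 : -arctan z ≤ arctan z := by linarith [arctan_nonneg.2 hz]
  have hs : Set.Icc (-arctan z) (arctan z) ⊆ Set.Ioo (-(π / 2)) (π / 2) := fun ψ hψ =>
    ⟨by linarith [hψ.1, arctan_lt_pi_div_two z], by linarith [hψ.2, arctan_lt_pi_div_two z]⟩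
  rw [setLIntegral_indicator measurableSet_Icc, Set.inter_eq_left.2 hs,
    ← ofReal_integral_eq_lintegral_ofReal, integral_Icc_eq_integral_Ioc,
    ← intervalIntegral.integral_of_le h0, intervalIntegral.integral_const_mul, integral_cos_sq]
  · congr 2
    rw [cos_neg, sin_neg, cos_arctan, sin_arctan, gapWeight]
    have h1 : √(1 + z ^ 2) ^ 2 = 1 + z ^ 2 := sq_sqrt (by positivity)
    have h2 : 0 < √(1 + z ^ 2) := by positivity
    have h3 : z / √(1 + z ^ 2) * (1 / √(1 + z ^ 2)) = z / (1 + z ^ 2) := by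
      rw [div_mul_div_comm, mul_one, ← sq, h1]
    linear_combination h3
  · exact (by fun_prop : Continuous fun ψ : ℝ => k * cos ψ ^ 2).integrableOn_Icc
  · exact Filter.Eventually.of_forall fun ψ => mul_nonneg hk (sq_nonneg _)

theorem suppA_nonneg (u : EuclideanSpace ℝ (Fin 3)) : 0 ≤ suppA u := by
  have h : |u 1| ≤ √(u 0 ^ 2 + u 1 ^ 2) := abs_le_sqrt (by nlinarith [sq_nonneg (u 0)])
  have := le_abs_self (u 1)
  have := abs_nonneg (u 1)
  unfold suppA
  linarith

theorem continuous_suppA : Continuous suppA := by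
  unfold suppA
  fun_prop

theorem continuous_suppB : Continuous suppB := by
  unfold suppB
  fun_prop

/-- The density in the azimuth of the integral of `suppA` over the part of the unit ball
where it dominates. -/
def azimuthDensity (φ : ℝ) : ℝ := 1 / 4 * (1 - cos φ / 2) * gapWeight √(1 - 2 * cos φ)

theorem continuous_azimuthDensity : Continuous azimuthDensity :=
  (by fun_prop : Continuous fun φ : ℝ => 1 / 4 * (1 - cos φ / 2)).mul
    (continuous_gapWeight.comp (by fun_prop))

theorem azimuthDensity_nonneg (φ : ℝ) : 0 ≤ azimuthDensity φ :=
  mul_nonneg (by linarith [cos_le_one φ]) (gapWeight_nonneg (sqrt_nonneg _))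

theorem lintegral_suppA {S : Set (EuclideanSpace ℝ (Fin 3))} (hS : MeasurableSet S)
    (h1 : ∀ u, suppB u < suppA u → u ∈ S) (h2 : ∀ u ∈ S, suppB u ≤ suppA u) :
    ∫⁻ u in Metric.closedBall 0 1 ∩ S, ENNReal.ofReal (suppA u) =
      ENNReal.ofReal (∫ φ in (-π)..π, azimuthDensity φ) := by
  have hm : MeasurableSet (Metric.closedBall (0 : EuclideanSpace ℝ (Fin 3)) 1 ∩ S) :=
    Metric.isClosed_closedBall.measurableSet.inter hS
  rw [← lintegral_indicator hm, lintegral_spherical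
    ((continuous_suppA.measurable.ennreal_ofReal).indicator hm),
    intervalIntegral.integral_of_le (by linarith [pi_pos]), integral_Ioc_eq_integral_Ioo,
    ofReal_integral_eq_lintegral_ofReal (continuous_azimuthDensity.integrableOn_Icc.mono_set
      Set.Ioo_subset_Icc_self) (Filter.Eventually.of_forall azimuthDensity_nonneg)]
  refine lintegral_congr fun φ => ?_
  have hk : 0 ≤ 1 / 4 * (1 - cos φ / 2) := by linarith [cos_le_one φ]
  rw [azimuthDensity, ← setLIntegral_cos_sq hk (sqrt_nonneg _)]
  refine lintegral_congr_ae ?_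
  have hne : ∀ᵐ ψ : ℝ, |ψ| ≠ arctan √(1 - 2 * cos φ) := by
    have hf : ({arctan √(1 - 2 * cos φ), -arctan √(1 - 2 * cos φ)} : Set ℝ).Finite :=
      Set.toFinite _
    filter_upwards [hf.countable.ae_notMem volume] with ψ hψ he
    refine hψ ?_
    obtain h | h := abs_choice ψ
    · left; rw [← he, h]
    · right; rw [Set.mem_singleton_iff, ← he, h, neg_neg]
  filter_upwards [ae_restrict_of_ae hne, ae_restrict_mem measurableSet_Ioo] with ψ hψ hψ'
  have hc := cos_pos_of_mem_Ioo hψ'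
  obtain hlt | hlt := lt_or_gt_of_ne hψ
  · rw [Set.indicator_of_mem (Set.mem_Icc.2 (abs_le.1 hlt.le)), show 1 / 4 * (1 - cos φ / 2) * cos ψ ^ 2 =
      (1 - cos φ / 2) * cos ψ ^ 2 / 4 by ring,
      ← setLIntegral_Ioi_cube (mul_nonneg (by linarith [cos_le_one φ]) (sq_nonneg _))]
    refine setLIntegral_congr_fun measurableSet_Ioi fun ρ hρ => ?_
    have hmem := h1 _ (suppB_lt_suppA_sphericalPt hψ' hρ hlt)
    have hA := suppA_sphericalPt φ hc hρ
    have hn := norm_sphericalPt φ ψ hρ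
    rw [sphericalPt] at hmem hA hn
    by_cases hρ1 : ρ ≤ 1
    · have hb : sphericalPt φ ψ ρ ∈ Metric.closedBall 0 1 ∩ S :=
        ⟨by rwa [sphericalPt, mem_closedBall_zero_iff, hn], by rwa [sphericalPt]⟩
      rw [sphericalPt] at hb
      rw [Set.indicator_of_mem hb,
        Set.indicator_of_mem (show ρ ∈ Set.Iic 1 from hρ1), hA, ← ENNReal.ofReal_mul
          (mul_nonneg (sq_nonneg _) hc.le)]
      congr 1
      ring
    · rw [Set.indicator_of_notMem (show ρ ∉ Set.Iic 1 from hρ1), Set.indicator_of_notMem,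
        mul_zero]
      rintro ⟨hb, -⟩
      rw [mem_closedBall_zero_iff, hn] at hb
      exact hρ1 hb
  · have hI : ψ ∉ Set.Icc (-arctan √(1 - 2 * cos φ)) (arctan √(1 - 2 * cos φ)) :=
      fun h => hlt.not_ge (abs_le.2 h)
    rw [Set.indicator_of_notMem hI]
    refine (setLIntegral_congr_fun measurableSet_Ioi fun ρ hρ => ?_).trans lintegral_zero
    have hA := suppA_lt_suppB_sphericalPt hψ' hρ hlt
    have hI : sphericalPt φ ψ ρ ∉ Metric.closedBall 0 1 ∩ S := fun h => hA.not_ge (h2 _ h.2)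
    rw [sphericalPt] at hI
    rw [Set.indicator_of_notMem hI, mul_zero]

theorem integral_suppO_closedBall : ∫ u in Metric.closedBall (0 : EuclideanSpace ℝ (Fin 3)) 1,
    suppO u = 2 * ∫ φ in (-π)..π, azimuthDensity φ := by
  set B := Metric.closedBall (0 : EuclideanSpace ℝ (Fin 3)) 1
  have hB : MeasurableSet B := Metric.isClosed_closedBall.measurableSet
  have hS : MeasurableSet {u | suppB u < suppA u} :=
    measurableSet_lt continuous_suppB.measurable continuous_suppA.measurable
  have hT : MeasurableSet {u | suppB u ≤ suppA u} :=
    measurableSet_le continuous_suppB.measurable continuous_suppA.measurable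
  have hj : 0 ≤ ∫ φ in (-π)..π, azimuthDensity φ :=
    intervalIntegral.integral_nonneg (by linarith [pi_pos]) fun φ _ => azimuthDensity_nonneg φ
  have e1 := lintegral_suppA hS (fun u h => h) fun u h => le_of_lt h
  have e2 := lintegral_suppA hT (fun u h => le_of_lt h) fun u h => h
  have hA : ∀ u, suppA (swapAB u) = suppB u := fun u => by
    simp [suppA, suppB, swapAB_apply]
    ring_nf
  have hBs : ∀ u, suppB (swapAB u) = suppA u := fun u => by
    simp [suppA, suppB, swapAB_apply]
    ring_nf
  have hp : swapAB ⁻¹' (B ∩ {u | suppB u < suppA u}) = B ∩ {u | suppB u ≤ suppA u}ᶜ := by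
    ext u
    simp only [B, Set.mem_preimage, Set.mem_inter_iff, mem_closedBall_zero_iff,
      LinearIsometryEquiv.norm_map, Set.mem_ofPred_eq, Set.mem_compl_iff, not_le, hA, hBs]
  have e3 : ∫⁻ u in B ∩ {u | suppB u ≤ suppA u}ᶜ, ENNReal.ofReal (suppO u) =
      ∫⁻ u in B ∩ {u | suppB u < suppA u}, ENNReal.ofReal (suppA u) := by
    rw [← swapAB.measurePreserving.setLIntegral_comp_preimage (hB.inter hS)
      continuous_suppA.measurable.ennreal_ofReal, hp]
    refine setLIntegral_congr_fun (hB.inter hT.compl) fun u hu => ?_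
    have hlt : suppA u < suppB u := not_le.1 hu.2
    simp only [hA, suppO, max_eq_right hlt.le]
  have e4 : ∫⁻ u in B ∩ {u | suppB u ≤ suppA u}, ENNReal.ofReal (suppO u) =
      ∫⁻ u in B ∩ {u | suppB u ≤ suppA u}, ENNReal.ofReal (suppA u) :=
    setLIntegral_congr_fun (hB.inter hT) fun u hu => by
      have hle : suppB u ≤ suppA u := hu.2
      simp only [suppO, max_eq_left hle]
  have hn : ∀ u, 0 ≤ suppO u := fun u => (suppA_nonneg u).trans (le_max_left _ _)
  rw [integral_eq_lintegral_of_nonneg_ae (Filter.Eventually.of_forall hn) continuous_suppO.aestronglyMeasurable,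
    ← lintegral_inter_add_sdiff _ B hT, Set.sdiff_eq, e3, e4, e1, e2,
    ← ENNReal.ofReal_add hj hj, ENNReal.toReal_ofReal (by linarith)]
  ring

/-- The decreasing involution of `[π/3, π]` with `cos (cosInvol y) = -cos y / (1 - cos y)`. -/
def cosInvol (y : ℝ) : ℝ := arccos (-cos y / (1 - cos y))

theorem cos_le_half {y : ℝ} (hy : y ∈ Set.Icc (π / 3) π) : cos y ≤ 1 / 2 :=
  cos_pi_div_three ▸ cos_le_cos_of_nonneg_of_le_pi (by positivity) hy.2 hy.1

theorem cosInvol_eq {y : ℝ} (hy : y ∈ Set.Icc (π / 3) π) :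
    cosInvol y = π - 2 * arctan √(1 - 2 * cos y) := by
  have hc := cos_le_half hy
  have h1 := arctan_lt_pi_div_two √(1 - 2 * cos y)
  have h2 := arctan_nonneg.2 (sqrt_nonneg (1 - 2 * cos y))
  rw [cosInvol, ← arccos_cos (x := π - 2 * arctan √(1 - 2 * cos y)) (by linarith) (by linarith),
    cos_pi_sub, cos_two_mul, cos_sq_arctan, sq_sqrt (by linarith)]
  congr 1
  have h3 : 1 - cos y ≠ 0 := by linarith
  rw [show 1 + (1 - 2 * cos y) = 2 * (1 - cos y) by ring]
  field_simp
  ring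

theorem continuousOn_cosInvol : ContinuousOn cosInvol (Set.Icc (π / 3) π) :=
  continuous_arccos.comp_continuousOn (ContinuousOn.div (by fun_prop) (by fun_prop) fun y hy => by
    linarith [cos_le_half hy])

theorem cosInvol_cosInvol {y : ℝ} (hy : y ∈ Set.Icc (π / 3) π) : cosInvol (cosInvol y) = y := by
  have hc := cos_le_half hy
  have h1 := neg_one_le_cos y
  have h3 : 0 < 1 - cos y := by linarith
  have h2 : cos (cosInvol y) = -cos y / (1 - cos y) :=
    cos_arccos (by rw [le_div_iff₀ h3]; linarith) (by rw [div_le_iff₀ h3]; linarith)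
  have hpi := pi_pos
  rw [cosInvol, h2]
  conv_rhs => rw [← arccos_cos (x := y) (by linarith [hy.1]) hy.2]
  congr 1
  have h4 : 1 - -cos y / (1 - cos y) = 1 / (1 - cos y) := by
    field_simp
    ring
  rw [h4]
  field_simp

theorem integral_cosInvol_right : ∫ y in (π / 2)..π, cosInvol y = constI := by
  have h := intervalIntegral.integral_comp_sub_left (a := 0) (b := π / 2) cosInvol π
  rw [sub_zero, show π - π / 2 = π / 2 by ring] at h
  rw [← h, constI]
  simp [cosInvol, cos_pi_sub]

/-- The derivative of `cosInvol`. -/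
def cosInvolDeriv (y : ℝ) : ℝ := -(1 / √(1 - (-cos y / (1 - cos y)) ^ 2)) *
  ((sin y * (1 - cos y) - -cos y * sin y) / (1 - cos y) ^ 2)

theorem neg_cos_div_mem {y : ℝ} (hy : y ∈ Set.Icc (π / 2) π) :
    1 - cos y ≠ 0 ∧ -cos y / (1 - cos y) ∈ Set.Icc (0 : ℝ) (1 / 2) := by
  have hc : cos y ≤ 0 := cos_nonpos_of_pi_div_two_le_of_le hy.1 (by linarith [hy.2, pi_pos])
  have h1 := neg_one_le_cos y
  have h3 : 0 < 1 - cos y := by linarith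
  exact ⟨h3.ne', div_nonneg (by linarith) h3.le, by rw [div_le_iff₀ h3]; linarith⟩

theorem hasDerivAt_cosInvol {y : ℝ} (hy : y ∈ Set.Icc (π / 2) π) :
    HasDerivAt cosInvol (cosInvolDeriv y) y := by
  obtain ⟨h1, h2, h3⟩ := neg_cos_div_mem hy
  have h := ((hasDerivAt_cos y).fun_neg.fun_div ((hasDerivAt_cos y).const_sub 1) h1)
  refine ((hasDerivAt_arccos (by linarith) (by linarith)).comp y h).congr_deriv ?_
  simp only [cosInvolDeriv, neg_neg]

theorem continuousOn_cosInvolDeriv : ContinuousOn cosInvolDeriv (Set.Icc (π / 2) π) := by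
  have hq : ContinuousOn (fun y => -cos y / (1 - cos y)) (Set.Icc (π / 2) π) :=
    ContinuousOn.div (by fun_prop) (by fun_prop) fun y hy => (neg_cos_div_mem hy).1
  refine ContinuousOn.mul (ContinuousOn.neg (ContinuousOn.div (by fun_prop) (by fun_prop)
    fun y hy => ?_)) (ContinuousOn.div (by fun_prop) (by fun_prop) fun y hy =>
      pow_ne_zero 2 (neg_cos_div_mem hy).1)
  obtain ⟨-, h2, h3⟩ := neg_cos_div_mem hy
  exact (sqrt_pos.2 (by nlinarith)).ne'

theorem cosInvol_mem {y : ℝ} (hy : y ∈ Set.Icc (π / 2) π) :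
    cosInvol y ∈ Set.Icc (π / 3) (π / 2) := by
  obtain ⟨-, h2, h3⟩ := neg_cos_div_mem hy
  refine ⟨?_, arccos_le_pi_div_two.2 h2⟩
  have h := antitone_arccos h3
  rwa [← cos_pi_div_three, arccos_cos (by positivity) (by linarith [pi_pos])] at h

theorem cosInvol_pi_div_two : cosInvol (π / 2) = π / 2 := by
  simp [cosInvol]

theorem cosInvol_pi : cosInvol π = π / 3 := by
  rw [cosInvol, cos_pi, show -(-1 : ℝ) / (1 - -1) = 1 / 2 by norm_num, ← cos_pi_div_three,
    arccos_cos (by positivity) (by linarith [pi_pos])]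

theorem integral_cosInvol_left : ∫ y in (π / 3)..(π / 2), cosInvol y = constI - π ^ 2 / 12 := by
  have hpi := pi_pos
  have hu : Set.uIcc (π / 2) π = Set.Icc (π / 2) π := Set.uIcc_of_le (by linarith)
  have hsub : Set.Icc (π / 2) π ⊆ Set.Icc (π / 3) π := Set.Icc_subset_Icc_left (by linarith)
  have hd : ∀ y ∈ Set.uIcc (π / 2) π, HasDerivAt cosInvol (cosInvolDeriv y) y :=
    fun y hy => hasDerivAt_cosInvol (hu ▸ hy)
  have hc : ContinuousOn cosInvolDeriv (Set.uIcc (π / 2) π) := hu ▸ continuousOn_cosInvolDeriv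
  have h1 := intervalIntegral.integral_comp_mul_deriv' (g := cosInvol) hd hc
    (continuousOn_cosInvol.mono fun z hz => by
      obtain ⟨y, hy, rfl⟩ := hz
      have := cosInvol_mem (hu ▸ hy)
      exact ⟨this.1, this.2.trans (by linarith)⟩)
  have h2 := intervalIntegral.integral_mul_deriv_eq_deriv_mul (u := fun y => y) (u' := fun _ => 1)
    (fun y _ => hasDerivAt_id' y) hd intervalIntegrable_const hc.intervalIntegrable
  have h3 : ∫ y in (π / 2)..π, (cosInvol ∘ cosInvol) y * cosInvolDeriv y =
      ∫ y in (π / 2)..π, y * cosInvolDeriv y :=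
    intervalIntegral.integral_congr fun y hy => by
      simp only [Function.comp_apply, cosInvol_cosInvol (hsub (hu ▸ hy))]
  simp only [one_mul] at h2
  rw [h3, h2, cosInvol_pi_div_two, cosInvol_pi, integral_cosInvol_right,
    intervalIntegral.integral_symm] at h1
  linarith

theorem integral_arctan_sqrt_cos :
    ∫ y in (π / 3)..π, arctan √(1 - 2 * cos y) = 3 * π ^ 2 / 8 - constI := by
  have hpi := pi_pos
  have hi : ∀ a b, π / 3 ≤ a → a ≤ b → b ≤ π → IntervalIntegrable cosInvol volume a b :=
    fun a b h1 h2 h3 => (continuousOn_cosInvol.mono (Set.uIcc_of_le h2 ▸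
      Set.Icc_subset_Icc h1 h3)).intervalIntegrable
  have h1 : ∫ y in (π / 3)..π, cosInvol y = 2 * constI - π ^ 2 / 12 := by
    rw [← intervalIntegral.integral_add_adjacent_intervals
      (hi (π / 3) (π / 2) le_rfl (by linarith) (by linarith))
      (hi (π / 2) π (by linarith) (by linarith) le_rfl), integral_cosInvol_left,
      integral_cosInvol_right]
    ring
  have h2 : ∫ y in (π / 3)..π, arctan √(1 - 2 * cos y) =
      ∫ y in (π / 3)..π, (π / 2 - 1 / 2 * cosInvol y) :=
    intervalIntegral.integral_congr fun y hy => by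
      rw [Set.uIcc_of_le (by linarith)] at hy
      simp only [cosInvol_eq hy]
      ring
  rw [h2, intervalIntegral.integral_sub intervalIntegrable_const
    ((hi _ _ le_rfl (by linarith) le_rfl).const_mul _), intervalIntegral.integral_const,
    intervalIntegral.integral_const_mul, h1, smul_eq_mul]
  ring

/-- The azimuth corresponding to the parameter of the rulings. -/
def azimuth (x : ℝ) : ℝ := 2 * arccos (√3 / 2 * sin x)

theorem cos_azimuth (x : ℝ) : cos (azimuth x) = 1 - 2 * dl x ^ 2 := by
  have h := sqrt_three_sq
  have h1 : |√3 / 2 * sin x| ≤ 1 := by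
    rw [← sq_le_one_iff_abs_le_one, mul_pow, div_pow, h]
    nlinarith [sin_sq_le_one x]
  rw [abs_le] at h1
  rw [azimuth, cos_two_mul, cos_arccos h1.1 h1.2, mul_pow, div_pow, h, dl_sq]
  ring

theorem hasDerivAt_azimuth (x : ℝ) : HasDerivAt azimuth (-(√3 * cos x / dl x)) x := by
  have h := sqrt_three_sq
  have h1 : (√3 / 2 * sin x) ^ 2 < 1 := by
    rw [mul_pow, div_pow, h]
    nlinarith [sin_sq_le_one x]
  have h2 : √(1 - (√3 / 2 * sin x) ^ 2) = dl x := by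
    rw [dl, mul_pow, div_pow, h]
    norm_num
  refine (((hasDerivAt_arccos (fun h0 => ?_) fun h0 => ?_).comp x
    ((hasDerivAt_sin x).const_mul (√3 / 2))).const_mul 2).congr_deriv ?_
  · rw [h0] at h1
    norm_num at h1
  · rw [h0] at h1
    norm_num at h1
  · rw [h2]
    ring

theorem azimuth_zero : azimuth 0 = π := by
  simp [azimuth]
  ring

theorem azimuth_pi_div_two : azimuth (π / 2) = π / 3 := by
  rw [azimuth, sin_pi_div_two, mul_one, ← cos_pi_div_six,
    arccos_cos (by positivity) (by linarith [pi_pos])]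
  ring

theorem integral_comp_azimuth {f : ℝ → ℝ} (hf : Continuous f) :
    ∫ y in (π / 3)..π, f y = ∫ x in (0 : ℝ)..(π / 2), f (azimuth x) * (√3 * cos x / dl x) := by
  have hc : Continuous fun x => -(√3 * cos x / dl x) :=
    (Continuous.div (by fun_prop) continuous_dl fun x => (dl_pos x).ne').neg
  have h := intervalIntegral.integral_comp_mul_deriv (a := 0) (b := π / 2)
    (fun x _ => hasDerivAt_azimuth x) hc.continuousOn hf
  rw [azimuth_zero, azimuth_pi_div_two, intervalIntegral.integral_symm (π / 3) π] at h
  simp only [Function.comp_apply, mul_neg, intervalIntegral.integral_neg] at h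
  exact (neg_injective h).symm

theorem sqrt_cos_azimuth {x : ℝ} (hx : x ∈ Set.Icc 0 (π / 2)) :
    √(1 - 2 * cos (azimuth x)) = √3 * cos x := by
  have hc : 0 ≤ cos x := cos_nonneg_of_mem_Icc ⟨by linarith [hx.1, pi_pos], hx.2⟩
  rw [← sqrt_sq (mul_nonneg (sqrt_nonneg 3) hc), cos_azimuth, dl_sq, mul_pow, sqrt_three_sq, cos_sq']
  ring_nf

theorem integral_azimuthDensity_sub :
    ∫ y in (π / 3)..π, (4 * azimuthDensity y - arctan √(1 - 2 * cos y)) =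
      3 / 4 * ellipticK (√3 / 2) := by
  have hpi := pi_pos
  have hf : Continuous fun y => 4 * azimuthDensity y - arctan √(1 - 2 * cos y) :=
    (continuous_azimuthDensity.const_mul 4).sub (continuous_arctan.comp (by fun_prop))
  rw [integral_comp_azimuth hf]
  have hd : ∀ x, HasDerivAt (fun x => 1 / 2 * (√3 * dl x * sin x * arctan (√3 * cos x)))
      (-(1 / 2) * (1 - 2 * dl x ^ 2) * arctan (√3 * cos x) * (√3 * cos x / dl x) -
        (1 - dl x ^ 2) / (2 * dl x)) x := fun x => by
    have h0 := dl_pos x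
    have h := sqrt_three_sq
    have h4 : 1 + (√3 * cos x) ^ 2 = 4 * dl x ^ 2 := by
      rw [mul_pow, h, dl_sq, cos_sq']
      ring
    refine (((((hasDerivAt_dl x).const_mul √3).fun_mul (hasDerivAt_sin x)).fun_mul
      ((hasDerivAt_cos x).const_mul √3).arctan).const_mul (1 / 2)).congr_deriv ?_
    rw [h4]
    have h5 : sin x ^ 2 = 4 / 3 * (1 - dl x ^ 2) := by
      rw [dl_sq]
      ring
    field_simp
    linear_combination (-3 * √3 * cos x * arctan (√3 * cos x) - √3 ^ 2) * h5 -
      4 / 3 * (1 - dl x ^ 2) * h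
  have hdl := continuous_dl
  have hne : ∀ x, dl x ≠ 0 := fun x => (dl_pos x).ne'
  have hDc : Continuous fun x => -(1 / 2) * (1 - 2 * dl x ^ 2) * arctan (√3 * cos x) *
      (√3 * cos x / dl x) - (1 - dl x ^ 2) / (2 * dl x) :=
    ((by fun_prop : Continuous fun x => -(1 / 2) * (1 - 2 * dl x ^ 2) * arctan (√3 * cos x)).mul
      (Continuous.div (by fun_prop) hdl hne)).sub
      (Continuous.div (by fun_prop) (by fun_prop) fun x => mul_ne_zero two_ne_zero (hne x))
  have hD := intervalIntegral.integral_eq_sub_of_hasDerivAt (fun x _ => hd x)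
    (hDc.intervalIntegrable 0 (π / 2))
  simp only [sin_zero, cos_pi_div_two, mul_zero, arctan_zero, zero_mul, sub_zero] at hD
  have c1 := continuous_one_div_dl_pow 1
  simp only [pow_one] at c1
  have i0 := hDc.intervalIntegrable (μ := volume) 0 (π / 2)
  have i1 := (hdl.const_mul (1 / 2)).intervalIntegrable (μ := volume) 0 (π / 2)
  have i2 := (c1.const_mul (3 / 4)).intervalIntegrable (μ := volume) 0 (π / 2)
  have i3 := ((continuous_one_div_dl_pow 3).const_mul (1 / 8)).intervalIntegrable
    (μ := volume) 0 (π / 2)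
  have hsum : ∫ x in (0 : ℝ)..(π / 2),
      (4 * azimuthDensity (azimuth x) - arctan √(1 - 2 * cos (azimuth x))) * (√3 * cos x / dl x) =
      ∫ x in (0 : ℝ)..(π / 2), ((-(1 / 2) * (1 - 2 * dl x ^ 2) * arctan (√3 * cos x) *
        (√3 * cos x / dl x) - (1 - dl x ^ 2) / (2 * dl x)) +
        (1 / 2 * dl x + 3 / 4 * (1 / dl x) - 1 / 8 * (1 / dl x ^ 3))) :=
    intervalIntegral.integral_congr fun x hx => by
      rw [Set.uIcc_of_le (by positivity)] at hx
      have h0 := dl_pos x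
      have h4 : 1 + (√3 * cos x) ^ 2 = 4 * dl x ^ 2 := by
        rw [mul_pow, sqrt_three_sq, dl_sq, cos_sq']
        ring
      simp only [azimuthDensity, gapWeight]
      rw [sqrt_cos_azimuth hx, cos_azimuth, h4]
      field_simp
      linear_combination 8 * (1 + 2 * dl x ^ 2) * h4
  rw [hsum, intervalIntegral.integral_add i0 ((i1.add i2).sub i3),
    intervalIntegral.integral_sub (i1.add i2) i3, intervalIntegral.integral_add i1 i2, hD]
  simp only [intervalIntegral.integral_const_mul, integral_dl, integral_one_div_dl,
    integral_one_div_dl_cube]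
  ring

theorem azimuthDensity_eq_zero {y : ℝ} (hy : y ∈ Set.Icc 0 (π / 3)) : azimuthDensity y = 0 := by
  have h : 1 / 2 ≤ cos y :=
    cos_pi_div_three ▸ cos_le_cos_of_nonneg_of_le_pi hy.1 (by linarith [pi_pos]) hy.2
  rw [azimuthDensity, sqrt_eq_zero_of_nonpos (by linarith), gapWeight]
  simp

theorem integral_azimuthDensity : ∫ y in (-π)..π, azimuthDensity y =
    (3 * π ^ 2 + 6 * ellipticK (√3 / 2) - 8 * constI) / 16 := by
  have hpi := pi_pos
  have hc := continuous_azimuthDensity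
  have hi : ∀ a b, IntervalIntegrable azimuthDensity volume a b := hc.intervalIntegrable
  have ha : Continuous fun y => arctan √(1 - 2 * cos y) := continuous_arctan.comp (by fun_prop)
  have h1 := integral_azimuthDensity_sub
  rw [intervalIntegral.integral_sub ((hc.const_mul 4).intervalIntegrable _ _)
    (ha.intervalIntegrable _ _), intervalIntegral.integral_const_mul,
    integral_arctan_sqrt_cos] at h1
  have h2 : ∫ y in (0 : ℝ)..(π / 3), azimuthDensity y = 0 := by
    rw [intervalIntegral.integral_congr (g := fun _ => 0) fun y hy => azimuthDensity_eq_zero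
      (Set.uIcc_of_le (show (0 : ℝ) ≤ π / 3 by positivity) ▸ hy), intervalIntegral.integral_zero]
  have h3 : ∫ y in (-π)..0, azimuthDensity y = ∫ y in (0 : ℝ)..π, azimuthDensity y := by
    have h := intervalIntegral.integral_comp_neg (a := 0) (b := π) azimuthDensity
    rw [neg_zero] at h
    rw [← h]
    simp only [azimuthDensity, cos_neg]
  rw [← intervalIntegral.integral_add_adjacent_intervals (hi (-π) 0) (hi 0 π), h3,
    ← intervalIntegral.integral_add_adjacent_intervals (hi 0 (π / 3)) (hi (π / 3) π), h2]
  linarith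

/-- The kinematic measure of the set of rigid motions bringing a moving oloid into a
hitting position with a fixed congruent oloid:
`∫_{SO(3)} λ{x : Ω_r ∩ (θ·Ω_r + x) ≠ ∅} dν(θ) = (r³/3)·[9π² + 8E(√3/2) + 22K(√3/2) − 24I]`,
where `ν` is the Haar probability measure on `SO(3)`. -/
theorem kinematic_measure_oloid_oloid (r : ℝ) (hr : 0 < r)
    (ν : Measure SO3) [IsProbabilityMeasure ν] [ν.IsMulLeftInvariant] :
    ∫⁻ θ : SO3, volume {x : EuclideanSpace ℝ (Fin 3) |
        (oloidR r ∩ moveSet θ x (oloidR r)).Nonempty} ∂ν =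
      ENNReal.ofReal
        (r ^ 3 / 3 * (9 * π ^ 2 + 8 * ellipticE (Real.sqrt 3 / 2)
          + 22 * ellipticK (Real.sqrt 3 / 2) - 24 * constI)) := by
  rw [lintegral_hitting ν hr, volume_real_oloid, integral_suppO_closedBall, integral_azimuthDensity]
  congr 1
  ring
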